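/- If 0 < α < 1 then the correlation length condition (CL) holds: β_c < ∞ and for every p > 0 there exists a constant C_p < ∞ such that ξ_p(β_c, r) ≤ C_p·r for every r ≥ 1. -/

import Mathlib

open MeasureTheory ENNReal Filter
open scoped Classical

namespace LRP

/-! ## Generic Bernoulli bond percolation -/

/-- The probability that an edge with rate `t ≥ 0` is open: `1 - e^{-t}`. -/
noncomputable def edgeProb (t : ℝ) : ℝ := 1 - Real.exp (-t)

/-- `μ` is the law of Bernoulli bond percolation in which every unordered pair `e`
of vertices is open independently with probability `p e`: every finite cylinder
event has the corresponding product probability.  (This characterises `μ` uniquely.) -/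
def IsPerc {Vt : Type*} (μ : Measure (Sym2 Vt → Bool)) (p : Sym2 Vt → ℝ) : Prop :=
  IsProbabilityMeasure μ ∧
    ∀ (s : Finset (Sym2 Vt)) (f : Sym2 Vt → Bool),
      μ {ω | ∀ e ∈ s, ω e = f e} =
        ∏ e ∈ s, ENNReal.ofReal (if f e then p e else 1 - p e)

/-- Two vertices are connected if they are joined by a path of open edges. -/
def Conn {Vt : Type*} (ω : Sym2 Vt → Bool) (x y : Vt) : Prop :=
  Relation.ReflTransGen (fun a b => ω s(a, b) = true) x y

/-- The open cluster of a vertex. -/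
def cluster {Vt : Type*} (ω : Sym2 Vt → Bool) (x : Vt) : Set Vt := {y | Conn ω x y}

/-- The number of points of a set, as an extended nonnegative real. -/
noncomputable def eCard {Vt : Type*} (s : Set Vt) : ℝ≥0∞ :=
  if s.Finite then (s.ncard : ℝ≥0∞) else ∞

/-! ## Long-range percolation on `ℤ^d` -/

abbrev V (d : ℕ) := Fin d → ℤ

abbrev Config (d : ℕ) := Sym2 (V d) → Bool

noncomputable def toR {d : ℕ} (x : V d) : Fin d → ℝ := fun i => (x i : ℝ)

/-- The Euclidean norm of a lattice point. -/
noncomputable def enorm2 {d : ℕ} (x : V d) : ℝ := Real.sqrt (∑ i, ((x i : ℝ)) ^ 2)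

/-- The `p`-th moment of the volume of the cluster of the origin. -/
noncomputable def clMom {d : ℕ} (μ : Measure (Config d)) (p : ℕ) : ℝ≥0∞ :=
  ∫⁻ ω, (eCard (cluster ω (0 : V d))) ^ p ∂μ

/-- `E Σ_{x ∈ K} ‖x‖₂^p`. -/
noncomputable def gyr {d : ℕ} (μ : Measure (Config d)) (p : ℝ) : ℝ≥0∞ :=
  ∫⁻ ω, ∑' x : cluster ω (0 : V d), ENNReal.ofReal (enorm2 (x : V d) ^ p) ∂μ

/-- The `L^p` radius of gyration. -/
noncomputable def xi {d : ℕ} (μ : Measure (Config d)) (p : ℝ) : ℝ≥0∞ :=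
  (gyr μ p / clMom μ 1) ^ (1 / p)

/-- A decreasing function `(0, ∞) → (0, 1]` decaying faster than any power. -/
def RapidDecay (h : ℝ → ℝ) : Prop :=
  AntitoneOn h (Set.Ioi (0 : ℝ)) ∧ (∀ t : ℝ, 0 < t → 0 < h t ∧ h t ≤ 1) ∧
    ∀ p : ℝ, 0 < p → Tendsto (fun t => h t * t ^ p) atTop (nhds 0)

/-- The data of a long-range percolation kernel `J(x,y) = 𝟙(x ≠ y) J(‖x - y‖)` on `ℤ^d`,
together with the standing regularity and normalisation assumptions: `‖⋅‖` is a norm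
whose unit ball has unit Lebesgue measure, `J` is decreasing and differentiable with
`|J'(r)| = (1 + δ_r) r^{-d-α-1}`, `δ_r → 0`, and `∫_{r₀}^∞ |δ_r| dr/r < ∞`. -/
structure Kernel (d : ℕ) (α : ℝ) where
  N : Seminorm ℝ (Fin d → ℝ)
  N_pos : ∀ x : Fin d → ℝ, x ≠ 0 → 0 < N x
  N_ball : volume {x : Fin d → ℝ | N x ≤ 1} = 1
  J : ℝ → ℝ
  J' : ℝ → ℝ
  δ : ℝ → ℝ
  J_nonneg : ∀ r : ℝ, 0 < r → 0 ≤ J r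
  J_anti : AntitoneOn J (Set.Ioi (0 : ℝ))
  J_hasDeriv : ∀ r : ℝ, 0 < r → HasDerivAt J (J' r) r
  J'_eq : ∀ r : ℝ, 0 < r → |J' r| = (1 + δ r) * r ^ (-(d : ℝ) - α - 1)
  δ_lim : Tendsto δ atTop (nhds 0)
  δ_int : ∃ r₀ : ℝ, 0 < r₀ ∧ IntegrableOn (fun r => |δ r| / r) (Set.Ioi r₀)

namespace Kernel

variable {d : ℕ} {α : ℝ} (κ : Kernel d α)

/-- The distance between two lattice points in the norm `N`. -/
noncomputable def nd (x y : V d) : ℝ := κ.N (toR x - toR y)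

theorem nd_symm (x y : V d) : κ.nd x y = κ.nd y x := by
  show κ.N (toR x - toR y) = κ.N (toR y - toR x)
  rw [show toR y - toR x = -(toR x - toR y) by abel, map_neg_eq_map]

/-- The kernel `J(x, y)`. -/
noncomputable def ker (x y : V d) : ℝ := if x = y then 0 else κ.J (κ.nd x y)

theorem ker_symm (x y : V d) : κ.ker x y = κ.ker y x := by
  show (if x = y then 0 else κ.J (κ.nd x y)) = (if y = x then 0 else κ.J (κ.nd y x))
  rw [κ.nd_symm x y]
  exact if_congr eq_comm rfl rfl

/-- The cut-off kernel `J_r(x, y)`. -/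
noncomputable def kerCut (r : ℝ) (x y : V d) : ℝ :=
  if x ≠ y ∧ κ.nd x y ≤ r then ∫ s in Set.Ioc (κ.nd x y) r, |κ.J' s| else 0

theorem kerCut_symm (r : ℝ) (x y : V d) : κ.kerCut r x y = κ.kerCut r y x := by
  show (if x ≠ y ∧ κ.nd x y ≤ r then ∫ s in Set.Ioc (κ.nd x y) r, |κ.J' s| else 0) =
    (if y ≠ x ∧ κ.nd y x ≤ r then ∫ s in Set.Ioc (κ.nd y x) r, |κ.J' s| else 0)
  rw [κ.nd_symm x y]
  exact if_congr (and_congr_left' ne_comm) rfl rfl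

/-- Edge probabilities at inverse temperature `β` for the kernel `J`. -/
noncomputable def edgeP (β : ℝ) : Sym2 (V d) → ℝ :=
  Sym2.lift ⟨fun x y => edgeProb (β * κ.ker x y), fun x y => by
    show edgeProb (β * κ.ker x y) = edgeProb (β * κ.ker y x)
    rw [κ.ker_symm x y]⟩

/-- Edge probabilities at inverse temperature `β` for the cut-off kernel `J_r`. -/
noncomputable def edgePCut (β r : ℝ) : Sym2 (V d) → ℝ :=
  Sym2.lift ⟨fun x y => edgeProb (β * κ.kerCut r x y), fun x y => by
    show edgeProb (β * κ.kerCut r x y) = edgeProb (β * κ.kerCut r y x)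
    rw [κ.kerCut_symm r x y]⟩

/-- The ball of radius `r` about the origin of `ℤ^d`, in the norm `N`. -/
def ball (r : ℝ) : Set (V d) := {x : V d | κ.N (toR x) ≤ r}

/-- There is an infinite cluster with positive probability at `β`. -/
def percolates (β : ℝ) : Prop :=
  ∀ μ : Measure (Config d), IsPerc μ (κ.edgeP β) →
    0 < μ {ω | ∃ x : V d, (cluster ω x).Infinite}

/-- The critical point `β_c`. -/
noncomputable def betaC : ℝ := sInf {β : ℝ | 0 ≤ β ∧ κ.percolates β}

/-- The correlation length condition for effectively long-range critical behaviour: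
`β_c < ∞` and for every `p > 0` the `L^p` radius of gyration of the cut-off model
at `β_c` satisfies `ξ_p(β_c, r) ≤ C_p r`. -/
def CL : Prop :=
  (∃ β : ℝ, 0 ≤ β ∧ κ.percolates β) ∧
    ∀ p : ℝ, 0 < p → ∃ C : ℝ, 0 < C ∧
      ∀ r : ℝ, 1 ≤ r → ∀ μ : Measure (Config d), IsPerc μ (κ.edgePCut κ.betaC r) →
        xi μ p ≤ ENNReal.ofReal (C * r)

/-- The weak correlation length condition: `β_c < ∞` and for each `ε > 0` there is
`C` with `E_{β_c,r}|K|^p ≤ (1+ε) E_{β_c,r}|K ∩ B_{Cr}|^p` for all `r ≥ 1`, `p = 1,2,3,4`. -/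
def wCL : Prop :=
  (∃ β : ℝ, 0 ≤ β ∧ κ.percolates β) ∧
    ∀ ε : ℝ, 0 < ε → ∃ C : ℝ, 0 < C ∧
      ∀ r : ℝ, 1 ≤ r → ∀ p : ℕ, p ∈ ({1, 2, 3, 4} : Finset ℕ) →
        ∀ μ : Measure (Config d), IsPerc μ (κ.edgePCut κ.betaC r) →
          (∫⁻ ω, (eCard (cluster ω (0 : V d))) ^ p ∂μ) ≤
            ENNReal.ofReal (1 + ε) *
              ∫⁻ ω, (eCard (cluster ω (0 : V d) ∩ κ.ball (C * r))) ^ p ∂μ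

/-- The `p`-th moment `E_β |K|^p` (for the full kernel). -/
noncomputable def mom (β : ℝ) (p : ℕ) : ℝ≥0∞ :=
  ⨆ μ ∈ {μ : Measure (Config d) | IsPerc μ (κ.edgeP β)}, clMom μ p

/-- The susceptibility `χ(β) = E_β |K|`. -/
noncomputable def chi (β : ℝ) : ℝ≥0∞ := κ.mom β 1

/-- `ζ(β) = E_β|K|² / E_β|K|`. -/
noncomputable def zeta (β : ℝ) : ℝ≥0∞ := κ.mom β 2 / κ.mom β 1

/-- The tail `P_β(|K| ≥ n)` of the cluster volume. -/
noncomputable def tailP (β : ℝ) (n : ℕ) : ℝ≥0∞ :=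
  ⨆ μ ∈ {μ : Measure (Config d) | IsPerc μ (κ.edgeP β)},
    μ {ω | (n : ℝ≥0∞) ≤ eCard (cluster ω (0 : V d))}

/-- The `L^p` radius of gyration `ξ_p(β)` (for the full kernel). -/
noncomputable def xiFull (β : ℝ) (p : ℝ) : ℝ≥0∞ :=
  ⨆ μ ∈ {μ : Measure (Config d) | IsPerc μ (κ.edgeP β)}, xi μ p

/-- The `p`-th moment `E_{β,r} |K|^p` for the cut-off kernel. -/
noncomputable def momCut (β r : ℝ) (p : ℕ) : ℝ≥0∞ :=
  ⨆ μ ∈ {μ : Measure (Config d) | IsPerc μ (κ.edgePCut β r)}, clMom μ p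

/-- `ξ*(β) = χ(β)^{1/α}`. -/
noncomputable def xiStar (β : ℝ) : ℝ := (κ.chi β).toReal ^ α⁻¹

/-- `ζ*(β) = ζ(β_c, ξ*(β))`, where `ζ(β,r) = E_{β,r}|K|²/E_{β,r}|K|`. -/
noncomputable def zetaStar (β : ℝ) : ℝ :=
  (κ.momCut κ.betaC (κ.xiStar β) 2 / κ.momCut κ.betaC (κ.xiStar β) 1).toReal

/-- The edian `M_r` of the maximal cluster volume in `B_r` under `P_{β_c, r}`. -/
noncomputable def MrCut (r : ℝ) : ℕ :=
  sInf {n : ℕ | ∀ μ : Measure (Config d), IsPerc μ (κ.edgePCut κ.betaC r) →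
    μ {ω | ∃ x : V d, (n : ℝ≥0∞) ≤ eCard (cluster ω x ∩ κ.ball r)} ≤
      ENNReal.ofReal (Real.exp (-1))}

/-- The edian `M_r^*` of the maximal cluster volume in `B_r` under `P_{β_c}`. -/
noncomputable def MrFull (r : ℝ) : ℕ :=
  sInf {n : ℕ | ∀ μ : Measure (Config d), IsPerc μ (κ.edgeP κ.betaC) →
    μ {ω | ∃ x : V d, (n : ℝ≥0∞) ≤ eCard (cluster ω x ∩ κ.ball r)} ≤
      ENNReal.ofReal (Real.exp (-1))}

/-- `f(β) = |β - β_c|^{-c ± o(1)}` as `β ↑ β_c`, i.e. the critical exponent of `f`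
at `β_c` is well-defined and equal to `c`. -/
def HasExp (f : ℝ → ℝ≥0∞) (c : ℝ) : Prop :=
  Tendsto (fun β => Real.log (f β).toReal / Real.log (1 / (κ.betaC - β)))
    (nhdsWithin κ.betaC (Set.Iio κ.betaC)) (nhds c)

end Kernel

/-! ## Product structure of Bernoulli percolation -/

/-- Closing all edges outside `T`. -/
noncomputable def cut {ι : Type*} (T : Set ι) (ω : ι → Bool) : ι → Bool :=
  fun e => if e ∈ T then ω e else false

theorem cut_congr {ι : Type*} {T : Set ι} {ω ω' : ι → Bool} (h : ∀ e ∈ T, ω e = ω' e) :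
    cut T ω = cut T ω' := by
  funext e
  by_cases he : e ∈ T
  · simp [cut, he, h e he]
  · simp [cut, he]

theorem cut_eq_of_mem {ι : Type*} {T : Set ι} {ω : ι → Bool} {e : ι} (h : e ∈ T) :
    cut T ω e = ω e := by
  simp [cut, h]

theorem cut_eq_true {ι : Type*} {T : Set ι} {ω : ι → Bool} {e : ι} :
    cut T ω e = true ↔ e ∈ T ∧ ω e = true := by
  by_cases h : e ∈ T <;> simp [cut, h]

theorem dependsOn_cut {ι β : Type*} (T : Set ι) (g : (ι → Bool) → β) :
    DependsOn (fun ω => g (cut T ω)) T := by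
  intro ω ω' h
  show g _ = g _
  rw [cut_congr h]

theorem measurable_cut {ι : Type*} (T : Set ι) :
    Measurable (cut T : (ι → Bool) → (ι → Bool)) := by
  refine measurable_pi_lambda _ fun e => ?_
  by_cases h : e ∈ T
  · simpa [cut, h] using measurable_pi_apply e
  · simp [cut, h]

/-- The configuration whose open edges are those of the finite set `s`. -/
noncomputable def indic {ι : Type*} (s : Finset ι) : ι → Bool := fun e => decide (e ∈ s)

/-- The expectation of `f` under independent choices of the elements of `F`. -/
noncomputable def Pf {ι : Type*} (F : Finset ι) (p : ι → ℝ) (f : Finset ι → ℝ) : ℝ :=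
  ∑ s ∈ F.powerset, (∏ e ∈ F, if e ∈ s then p e else 1 - p e) * f s

theorem Pf_empty {ι : Type*} (p : ι → ℝ) (f : Finset ι → ℝ) : Pf ∅ p f = f ∅ := by
  simp [Pf]

theorem Pf_insert {ι : Type*} {F : Finset ι} {a : ι} (ha : a ∉ F) (p : ι → ℝ)
    (f : Finset ι → ℝ) :
    Pf (insert a F) p f = (1 - p a) * Pf F p f + p a * Pf F p (fun s => f (insert a s)) := by
  unfold Pf
  rw [Finset.sum_powerset_insert ha, Finset.mul_sum, Finset.mul_sum]
  congr 1
  · refine Finset.sum_congr rfl fun s hs => ?_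
    have has : a ∉ s := fun h => ha (Finset.mem_powerset.1 hs h)
    rw [Finset.prod_insert ha, if_neg has]
    ring
  · refine Finset.sum_congr rfl fun s hs => ?_
    rw [Finset.prod_insert ha, if_pos (Finset.mem_insert_self a s)]
    have : ∏ x ∈ F, (if x ∈ insert a s then p x else 1 - p x) =
        ∏ x ∈ F, (if x ∈ s then p x else 1 - p x) := by
      refine Finset.prod_congr rfl fun x hx => ?_
      have hxa : x ≠ a := fun h => ha (h ▸ hx)
      simp [hxa]
    rw [this]
    ring

theorem Pf_congr {ι : Type*} {F : Finset ι} {p : ι → ℝ} {f g : Finset ι → ℝ}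
    (h : ∀ s ⊆ F, f s = g s) : Pf F p f = Pf F p g :=
  Finset.sum_congr rfl fun s hs => by rw [h s (Finset.mem_powerset.1 hs)]

theorem Pf_add {ι : Type*} (F : Finset ι) (p : ι → ℝ) (f g : Finset ι → ℝ) :
    Pf F p (fun s => f s + g s) = Pf F p f + Pf F p g := by
  simp [Pf, mul_add, Finset.sum_add_distrib]

theorem Pf_mul_left {ι : Type*} (F : Finset ι) (p : ι → ℝ) (c : ℝ) (f : Finset ι → ℝ) :
    Pf F p (fun s => c * f s) = c * Pf F p f := by
  simp only [Pf, Finset.mul_sum]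
  exact Finset.sum_congr rfl fun s _ => by ring

theorem Pf_weight_nonneg {ι : Type*} {p : ι → ℝ} (hp : ∀ e, 0 ≤ p e ∧ p e ≤ 1)
    (F s : Finset ι) : 0 ≤ ∏ e ∈ F, (if e ∈ s then p e else 1 - p e) := by
  refine Finset.prod_nonneg fun e _ => ?_
  split_ifs
  · exact (hp e).1
  · linarith [(hp e).2]

theorem Pf_mono {ι : Type*} {F : Finset ι} {p : ι → ℝ} (hp : ∀ e, 0 ≤ p e ∧ p e ≤ 1)
    {f g : Finset ι → ℝ} (h : ∀ s ⊆ F, f s ≤ g s) : Pf F p f ≤ Pf F p g :=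
  Finset.sum_le_sum fun s hs =>
    mul_le_mul_of_nonneg_left (h s (Finset.mem_powerset.1 hs)) (Pf_weight_nonneg hp F s)

theorem Pf_nonneg {ι : Type*} {F : Finset ι} {p : ι → ℝ} (hp : ∀ e, 0 ≤ p e ∧ p e ≤ 1)
    {f : Finset ι → ℝ} (h : ∀ s ⊆ F, 0 ≤ f s) : 0 ≤ Pf F p f :=
  Finset.sum_nonneg fun s hs =>
    mul_nonneg (Pf_weight_nonneg hp F s) (h s (Finset.mem_powerset.1 hs))

/-- Expectations of increasing functions increase with the edge probabilities. -/
theorem Pf_mono_prob {ι : Type*} (F : Finset ι) {p q : ι → ℝ} (hp : ∀ e, 0 ≤ p e ∧ p e ≤ 1)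
    (hq : ∀ e, 0 ≤ q e ∧ q e ≤ 1) (hpq : ∀ e, p e ≤ q e) :
    ∀ f : Finset ι → ℝ, Monotone f → Pf F p f ≤ Pf F q f := by
  induction F using Finset.induction_on with
  | empty => intro f _; simp [Pf_empty]
  | insert a F ha ih =>
    intro f hf
    rw [Pf_insert ha, Pf_insert ha]
    have h1 := ih f hf
    have h2 := ih (fun s => f (insert a s)) fun s t h => hf (Finset.insert_subset_insert a h)
    have h3 : Pf F q f ≤ Pf F q (fun s => f (insert a s)) :=
      Pf_mono hq fun s _ => hf (Finset.subset_insert a s)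
    nlinarith [hp a, hpq a, mul_le_mul_of_nonneg_left h1 (by linarith [(hp a).2] : 0 ≤ 1 - p a),
      mul_le_mul_of_nonneg_left h2 (hp a).1,
      mul_nonneg (sub_nonneg.2 (hpq a)) (sub_nonneg.2 h3)]

theorem continuous_Pf {ι : Type*} (F : Finset ι) (p : ℝ → ι → ℝ)
    (hp : ∀ e, Continuous fun b => p b e) (f : Finset ι → ℝ) :
    Continuous fun b => Pf F (p b) f := by
  unfold Pf
  refine continuous_finsetSum _ fun s _ => Continuous.mul ?_ continuous_const
  refine continuous_finsetProd _ fun e _ => ?_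
  split_ifs
  · exact hp e
  · exact continuous_const.sub (hp e)

theorem ite_add_ite_or_le {a b c : Prop} (ha : c → a) (hb : c → b) :
    (if c then (1 : ℝ) else 0) + (if a ∨ b then 1 else 0) ≤
      (if a then 1 else 0) + (if b then 1 else 0) := by
  by_cases h1 : a <;> by_cases h2 : b <;> by_cases h3 : c <;> simp_all

/-- The van den Berg–Kesten inequality, for increasing properties of a pair of
disjoint sets of open edges. -/
theorem Pf_disjoint_le {ι : Type*} (F : Finset ι) {p : ι → ℝ} (hp : ∀ e, 0 ≤ p e ∧ p e ≤ 1) :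
    ∀ D : Finset ι → Finset ι → Prop,
      (∀ s s' t t', s ⊆ s' → t ⊆ t' → D s t → D s' t') →
      Pf F p (fun s => if ∃ I J, I ⊆ s ∧ J ⊆ s ∧ Disjoint I J ∧ D I J then 1 else 0) ≤
        Pf F p (fun s => Pf F p (fun t => if D s t then 1 else 0)) := by
  induction F using Finset.induction_on with
  | empty =>
    intro D _
    simp only [Pf_empty]
    split_ifs with h1 h2 h2
    · exact le_rfl
    · obtain ⟨I, J, hI, hJ, -, hD⟩ := h1
      rw [Finset.subset_empty.1 hI, Finset.subset_empty.1 hJ] at hD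
      exact absurd hD h2
    · exact zero_le_one
    · exact le_rfl
  | insert a F ha ih =>
    intro D hD
    set U : Finset ι → Finset ι → Prop := fun s t => D (insert a s) t ∨ D s (insert a t) with hU
    have hUm : ∀ s s' t t', s ⊆ s' → t ⊆ t' → U s t → U s' t' := by
      rintro s s' t t' hs ht (h | h)
      · exact Or.inl (hD _ _ _ _ (Finset.insert_subset_insert a hs) ht h)
      · exact Or.inr (hD _ _ _ _ hs (Finset.insert_subset_insert a ht) h)
    have h0 := ih D hD
    have h1 := ih U hUm
    set X00 := Pf F p (fun s => Pf F p (fun t => if D s t then (1 : ℝ) else 0)) with hX00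
    set X10 := Pf F p (fun s => Pf F p (fun t => if D (insert a s) t then (1 : ℝ) else 0))
      with hX10
    set X01 := Pf F p (fun s => Pf F p (fun t => if D s (insert a t) then (1 : ℝ) else 0))
      with hX01
    set X11 := Pf F p (fun s => Pf F p (fun t => if D (insert a s) (insert a t) then (1 : ℝ) else 0))
      with hX11
    set XU := Pf F p (fun s => Pf F p (fun t => if U s t then (1 : ℝ) else 0)) with hXU
    have hR : Pf (insert a F) p (fun s => Pf (insert a F) p (fun t => if D s t then (1 : ℝ) else 0))
        = (1 - p a) * ((1 - p a) * X00 + p a * X01) + p a * ((1 - p a) * X10 + p a * X11) := by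
      rw [Pf_insert ha]
      simp only [Pf_insert ha, Pf_add, Pf_mul_left]
      rfl
    have hUX : X00 + XU ≤ X10 + X01 := by
      rw [hX00, hXU, hX10, hX01, ← Pf_add, ← Pf_add]
      refine Pf_mono hp fun s _ => ?_
      rw [← Pf_add, ← Pf_add]
      refine Pf_mono hp fun t _ => ?_
      have e1 : D s t → D (insert a s) t :=
        hD _ _ _ _ (Finset.subset_insert a s) subset_rfl
      have e2 : D s t → D s (insert a t) :=
        hD _ _ _ _ subset_rfl (Finset.subset_insert a t)
      exact ite_add_ite_or_le e1 e2
    have hU1 : XU ≤ X11 := by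
      refine Pf_mono hp fun s _ => Pf_mono hp fun t _ => ?_
      by_cases c1 : U s t
      · have : D (insert a s) (insert a t) := by
          rcases c1 with c | c
          · exact hD _ _ _ _ subset_rfl (Finset.subset_insert a t) c
          · exact hD _ _ _ _ (Finset.subset_insert a s) subset_rfl c
        simp [c1, this]
      · rw [if_neg c1]
        split_ifs <;> norm_num
    have hL0 : Pf F p (fun s => if ∃ I J, I ⊆ insert a s ∧ J ⊆ insert a s ∧ Disjoint I J ∧ D I J
        then (1 : ℝ) else 0) ≤
        Pf F p (fun s => if ∃ I J, I ⊆ s ∧ J ⊆ s ∧ Disjoint I J ∧ U I J then (1 : ℝ) else 0) := by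
      refine Pf_mono hp fun s hs => ?_
      by_cases c : ∃ I J, I ⊆ insert a s ∧ J ⊆ insert a s ∧ Disjoint I J ∧ D I J
      · obtain ⟨I, J, hI, hJ, hIJ, hDD⟩ := c
        have : ∃ I J, I ⊆ s ∧ J ⊆ s ∧ Disjoint I J ∧ U I J := by
          refine ⟨I.erase a, J.erase a, ?_, ?_, ?_, ?_⟩
          · exact Finset.subset_insert_iff.1 hI
          · exact Finset.subset_insert_iff.1 hJ
          · exact Finset.disjoint_of_subset_left (Finset.erase_subset _ _)
              (Finset.disjoint_of_subset_right (Finset.erase_subset _ _) hIJ)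
          · by_cases haI : a ∈ I
            · left
              have haJ : a ∉ J := fun h => Finset.disjoint_left.1 hIJ haI h
              rw [Finset.insert_erase haI, Finset.erase_eq_of_notMem haJ]
              exact hDD
            · right
              rw [Finset.erase_eq_of_notMem haI]
              exact hD _ _ _ _ subset_rfl (Finset.insert_erase_subset a J) hDD
        rw [if_pos this]
        split_ifs <;> norm_num
      · rw [if_neg c]
        split_ifs <;> norm_num
    rw [hR, Pf_insert ha]
    have h1' := hL0.trans (h1.trans_eq (by rw [hXU]; congr!) : _ ≤ XU)
    clear_value X00 X10 X01 X11 XU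
    have hpa := hp a
    have key : ∀ L0 L1 : ℝ, L0 ≤ X00 → L1 ≤ XU → (1 - p a) * L0 + p a * L1 ≤
        (1 - p a) * ((1 - p a) * X00 + p a * X01) + p a * ((1 - p a) * X10 + p a * X11) := by
      intro L0 L1 hL hL'
      nlinarith [mul_le_mul_of_nonneg_left hL (by linarith : 0 ≤ 1 - p a),
        mul_le_mul_of_nonneg_left hL' hpa.1,
        mul_le_mul_of_nonneg_left hUX (mul_nonneg hpa.1 (by linarith : 0 ≤ 1 - p a)),
        mul_le_mul_of_nonneg_left hU1 (mul_nonneg hpa.1 hpa.1)]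
    exact key _ _ h0 h1'

section Percolation

variable {Vt : Type*} {μ ν : Measure (Sym2 Vt → Bool)} {p : Sym2 Vt → ℝ}

theorem measurableSet_open (e : Sym2 Vt) : MeasurableSet {ω : Sym2 Vt → Bool | ω e = true} := by
  have : {ω : Sym2 Vt → Bool | ω e = true} = (fun ω => ω e) ⁻¹' {true} := by ext; simp
  rw [this]
  exact measurable_pi_apply e (measurableSet_singleton true)

theorem cylinder_decomposition {F : Finset (Sym2 Vt)} {E : Set (Sym2 Vt → Bool)}
    (hE : DependsOn (fun ω => ω ∈ E) (F : Set (Sym2 Vt))) :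
    E = ⋃ s ∈ F.powerset.filter (fun s => indic s ∈ E), {ω | ∀ e ∈ F, ω e = indic s e} := by
  ext ω
  simp only [Set.mem_iUnion, Finset.mem_filter, Finset.mem_powerset, Set.mem_ofPred_eq]
  constructor
  · intro h
    have hag : ∀ e ∈ F, ω e = indic (F.filter fun e => ω e = true) e := by
      intro e he
      cases h : ω e <;> simp [indic, he, h]
    exact ⟨F.filter fun e => ω e = true, ⟨Finset.filter_subset _ _, (hE hag).mp h⟩, hag⟩
  · rintro ⟨s, ⟨-, hs⟩, h⟩
    exact (hE h).mpr hs

theorem measurableSet_agree (F : Finset (Sym2 Vt)) (f : Sym2 Vt → Bool) :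
    MeasurableSet {ω : Sym2 Vt → Bool | ∀ e ∈ F, ω e = f e} := by
  have : {ω : Sym2 Vt → Bool | ∀ e ∈ F, ω e = f e} = ⋂ e ∈ F, (fun ω => ω e) ⁻¹' {f e} := by
    ext; simp
  rw [this]
  exact Finset.measurableSet_biInter _ fun e _ => measurable_pi_apply e (measurableSet_singleton _)

theorem measurableSet_of_dependsOn {F : Finset (Sym2 Vt)} {E : Set (Sym2 Vt → Bool)}
    (hE : DependsOn (fun ω => ω ∈ E) (F : Set (Sym2 Vt))) : MeasurableSet E := by
  rw [cylinder_decomposition hE]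
  exact Finset.measurableSet_biUnion _ fun s _ => measurableSet_agree F _

/-- Probabilities of events depending on finitely many edges are finite sums. -/
theorem IsPerc.measure_eq_Pf (h : IsPerc μ p) (hp : ∀ e, 0 ≤ p e ∧ p e ≤ 1)
    {F : Finset (Sym2 Vt)} {E : Set (Sym2 Vt → Bool)}
    (hE : DependsOn (fun ω => ω ∈ E) (F : Set (Sym2 Vt))) :
    μ E = ENNReal.ofReal (Pf F p (fun s => if indic s ∈ E then 1 else 0)) := by
  conv_lhs => rw [cylinder_decomposition hE]
  rw [measure_biUnion_finset]
  · unfold Pf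
    rw [ENNReal.ofReal_sum_of_nonneg]
    · rw [Finset.sum_filter]
      refine Finset.sum_congr rfl fun s _ => ?_
      by_cases hs : indic s ∈ E
      · simp only [hs, if_true]
        rw [h.2 F (indic s), mul_one, ENNReal.ofReal_prod_of_nonneg]
        · refine Finset.prod_congr rfl fun e _ => ?_
          by_cases hes : e ∈ s <;> simp [indic, hes]
        · intro e _
          split_ifs
          · exact (hp e).1
          · linarith [(hp e).2]
      · simp [hs]
    · intro s _
      refine mul_nonneg (Pf_weight_nonneg hp F s) ?_
      by_cases hs : indic s ∈ E <;> simp [hs]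
  · intro s hs t ht hst
    simp only [Finset.coe_filter, Finset.mem_powerset, Set.mem_ofPred_eq] at hs ht
    refine Set.disjoint_left.2 fun ω h1 h2 => hst ?_
    ext e
    by_cases he : e ∈ F
    · have := (h1 e he).symm.trans (h2 e he)
      simpa [indic] using this
    · exact ⟨fun h => absurd (hs.1 h) he, fun h => absurd (ht.1 h) he⟩
  · exact fun s _ => measurableSet_agree F _

theorem IsPerc.unique (h : IsPerc μ p) (h' : IsPerc ν p) (hp : ∀ e, 0 ≤ p e ∧ p e ≤ 1) :
    μ = ν := by
  have := h.1
  have := h'.1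
  refine ext_of_generate_finite (measurableCylinders fun _ : Sym2 Vt => Bool)
    generateFrom_measurableCylinders.symm isPiSystem_measurableCylinders ?_ (by simp)
  intro E hE
  obtain ⟨F, S, -, rfl⟩ := (mem_measurableCylinders _).1 hE
  have hd : DependsOn (fun ω => ω ∈ cylinder (α := fun _ : Sym2 Vt => Bool) F S) (F : Set (Sym2 Vt)) := by
    intro ω ω' hω
    have : F.restrict ω = F.restrict ω' := by
      funext e
      exact hω e e.2
    simp [mem_cylinder, this]
  rw [h.measure_eq_Pf hp hd, h'.measure_eq_Pf hp hd]

theorem IsPerc.iIndep (h : IsPerc μ p) :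
    ProbabilityTheory.iIndep
      (fun e => MeasurableSpace.generateFrom {{ω : Sym2 Vt → Bool | ω e = true}}) μ := by
  have hm : ∀ e, MeasurableSet {ω : Sym2 Vt → Bool | ω e = true} := measurableSet_open
  have h1 : ∀ e, μ {ω : Sym2 Vt → Bool | ω e = true} = ENNReal.ofReal (p e) := by
    intro e
    have := h.2 {e} (fun _ => true)
    simpa using this
  refine (ProbabilityTheory.iIndepSet_iff_meas_biInter hm).2 fun s => ?_
  have := h.2 s (fun _ => true)
  simp only [if_true] at this
  rw [Finset.prod_congr rfl fun e _ => h1 e, ← this]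
  congr 1
  ext ω
  simp

/-- Events depending on disjoint sets of edges are independent. -/
theorem IsPerc.indep (h : IsPerc μ p) {S T : Set (Sym2 Vt)} (hST : Disjoint S T)
    {E G : Set (Sym2 Vt → Bool)} (hEm : MeasurableSet E) (hGm : MeasurableSet G)
    (hE : DependsOn (fun ω => ω ∈ E) S) (hG : DependsOn (fun ω => ω ∈ G) T) :
    μ (E ∩ G) = μ E * μ G := by
  have hle : ∀ e : Sym2 Vt, MeasurableSpace.generateFrom {{ω : Sym2 Vt → Bool | ω e = true}} ≤
      MeasurableSpace.pi := fun e => MeasurableSpace.generateFrom_le (by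
    rintro _ rfl
    exact measurableSet_open e)
  have key : ∀ (R : Set (Sym2 Vt)) (A : Set (Sym2 Vt → Bool)), MeasurableSet A →
      DependsOn (fun ω => ω ∈ A) R →
      MeasurableSet[⨆ e ∈ R, MeasurableSpace.generateFrom {{ω : Sym2 Vt → Bool | ω e = true}}]
        A := by
    intro R A hA hAR
    have h1 : A = cut R ⁻¹' A := by
      ext ω
      have : ∀ e ∈ R, ω e = cut R ω e := fun e he => (cut_eq_of_mem he).symm
      exact iff_of_eq (hAR this)
    rw [h1]
    suffices hc : @Measurable _ _ (⨆ e ∈ R,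
        MeasurableSpace.generateFrom {{ω : Sym2 Vt → Bool | ω e = true}}) MeasurableSpace.pi
        (cut R : (Sym2 Vt → Bool) → (Sym2 Vt → Bool)) from hc hA
    refine @measurable_pi_lambda _ _ _ (_) _ _ fun e => ?_
    by_cases he : e ∈ R
    · simp only [cut, he, if_true]
      refine @measurable_to_bool _ (_) _ ?_
      refine le_iSup₂_of_le (f := fun e (_ : e ∈ R) =>
        MeasurableSpace.generateFrom {{ω : Sym2 Vt → Bool | ω e = true}}) e he le_rfl _ ?_
      exact MeasurableSpace.measurableSet_generateFrom rfl
    · simp only [cut, he, if_false]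
      exact @measurable_const _ _ _ (_) _
  have hi := ProbabilityTheory.indep_iSup_of_disjoint hle h.iIndep hST
  rw [ProbabilityTheory.Indep_iff] at hi
  exact hi E G (key S E hEm hE) (key T G hGm hG)

theorem IsPerc.measure_open (h : IsPerc μ p) (e : Sym2 Vt) :
    μ {ω | ω e = true} = ENNReal.ofReal (p e) := by
  simpa using h.2 {e} (fun _ => true)

/-- The probability that all edges of a finite set are closed. -/
theorem IsPerc.measure_closed_le (h : IsPerc μ p) {F : Finset (Sym2 Vt)} {g : ℝ}
    (hF : ∀ e ∈ F, 1 - p e ≤ Real.exp (-g)) :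
    μ {ω | ∀ e ∈ F, ω e = false} ≤ ENNReal.ofReal (Real.exp (-(g * F.card))) := by
  rw [h.2 F (fun _ => false)]
  calc _ ≤ ∏ e ∈ F, ENNReal.ofReal (Real.exp (-g)) := by
        refine Finset.prod_le_prod' fun e he => ENNReal.ofReal_le_ofReal ?_
        simpa using hF e he
    _ = _ := by
        rw [Finset.prod_const, ← ENNReal.ofReal_pow (Real.exp_nonneg _), ← Real.exp_nat_mul]
        congr 2
        ring

end Percolation

/-! ## Connectivity and cluster sizes -/

section Connectivity

variable {Vt : Type*}

theorem Conn.mono {ω ω' : Sym2 Vt → Bool} (h : ω ≤ ω') {x y : Vt} (hc : Conn ω x y) :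
    Conn ω' x y :=
  Relation.ReflTransGen.mono (fun a b hab => by
    have := h s(a, b)
    rw [hab] at this
    exact top_le_iff.1 this) _ _ hc

theorem Conn.refl (ω : Sym2 Vt → Bool) (x : Vt) : Conn ω x x := Relation.ReflTransGen.refl

theorem Conn.trans {ω : Sym2 Vt → Bool} {x y z : Vt} (h : Conn ω x y) (h' : Conn ω y z) :
    Conn ω x z := Relation.ReflTransGen.trans h h'

theorem Conn.of_open {ω : Sym2 Vt → Bool} {x y : Vt} (h : ω s(x, y) = true) : Conn ω x y :=
  Relation.ReflTransGen.single h

theorem Conn.symm {ω : Sym2 Vt → Bool} {x y : Vt} (h : Conn ω x y) : Conn ω y x := by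
  induction h with
  | refl => exact Conn.refl _ _
  | tail _ hbc ih =>
    exact (Conn.of_open (by rw [Sym2.eq_swap]; exact hbc)).trans ih

theorem cut_mono {ι : Type*} {T T' : Set ι} (h : T ⊆ T') (ω : ι → Bool) :
    cut T ω ≤ cut T' ω := by
  intro e
  by_cases he : e ∈ T
  · rw [cut_eq_of_mem he, cut_eq_of_mem (h he)]
  · simp [cut, he]

theorem cut_le {ι : Type*} (T : Set ι) (ω : ι → Bool) : cut T ω ≤ ω := by
  intro e
  by_cases he : e ∈ T
  · rw [cut_eq_of_mem he]
  · simp [cut, he]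

theorem cut_le_cut {ι : Type*} (T : Set ι) {ω ω' : ι → Bool} (h : ω ≤ ω') :
    cut T ω ≤ cut T ω' := by
  intro e
  by_cases he : e ∈ T
  · rw [cut_eq_of_mem he, cut_eq_of_mem he]
    exact h e
  · simp [cut, he]

theorem indic_le {ι : Type*} {s t : Finset ι} (h : s ⊆ t) : indic s ≤ indic t := fun e => by
  by_cases hes : e ∈ s
  · simp [indic, hes, h hes]
  · simp [indic, hes]

theorem indic_eq_true {ι : Type*} {s : Finset ι} {e : ι} : indic s e = true ↔ e ∈ s := by
  simp [indic]

theorem cut_indic {ι : Type*} {s F : Finset ι} (h : s ⊆ F) :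
    cut (F : Set ι) (indic s) = indic s := by
  funext e
  by_cases he : e ∈ F
  · rw [cut_eq_of_mem (by exact_mod_cast he)]
  · have : e ∉ s := fun h' => he (h h')
    simp [cut, he, indic, this]

/-- A path from a set to its complement uses an open boundary edge. -/
theorem Conn.exists_boundary {ω : Sym2 Vt → Bool} {x y : Vt} (h : Conn ω x y) {S : Set Vt}
    (hx : x ∈ S) (hy : y ∉ S) : ∃ u v, u ∈ S ∧ v ∉ S ∧ ω s(u, v) = true := by
  induction h with
  | refl => exact absurd hx hy
  | tail hab hbc ih =>
    rename_i b c
    by_cases hb : b ∈ S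
    · exact ⟨b, c, hb, hy, hbc⟩
    · exact ih hb

theorem Conn.mem_of_cut {Λ : Finset Vt} {ω : Sym2 Vt → Bool} {x y : Vt}
    (h : Conn (cut (Λ.sym2 : Set (Sym2 Vt)) ω) x y) (hx : x ∈ Λ) : y ∈ Λ := by
  by_contra hy
  obtain ⟨u, v, -, hv, huv⟩ := h.exists_boundary (S := (Λ : Set Vt)) (by simpa using hx)
    (by simpa using hy)
  have := (cut_eq_true.1 huv).1
  simp only [Finset.mem_coe, Finset.mk_mem_sym2_iff] at this
  exact hv (by simpa using this.2)

theorem measurableSet_conn [Countable Vt] (x y : Vt) :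
    MeasurableSet {ω : Sym2 Vt → Bool | Conn ω x y} := by
  let R : ℕ → Vt → Set (Sym2 Vt → Bool) := fun n => Nat.rec (fun z => {_ω | x = z})
    (fun _ S z => ⋃ u, S u ∩ {ω | ω s(u, z) = true}) n
  have hR : ∀ n z, MeasurableSet (R n z) := by
    intro n
    induction n with
    | zero => exact fun z => MeasurableSet.const _
    | succ n ih =>
      exact fun z => MeasurableSet.iUnion fun u => (ih u).inter (measurableSet_open _)
  have : {ω : Sym2 Vt → Bool | Conn ω x y} = ⋃ n, R n y := by
    ext ω
    simp only [Set.mem_ofPred_eq, Set.mem_iUnion]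
    constructor
    · intro h
      induction h with
      | refl => exact ⟨0, rfl⟩
      | tail hab hbc ih =>
        rename_i b c
        obtain ⟨n, hn⟩ := ih
        exact ⟨n + 1, Set.mem_iUnion.2 ⟨b, hn, hbc⟩⟩
    · rintro ⟨n, hn⟩
      induction n generalizing y with
      | zero =>
        obtain rfl : x = y := hn
        exact Conn.refl _ _
      | succ n ih =>
        obtain ⟨u, hu, hω⟩ := Set.mem_iUnion.1 hn
        exact (ih u hu).trans (Conn.of_open hω)
  rw [this]
  exact MeasurableSet.iUnion fun n => hR n y

/-- The cluster of `x` has at least `M` points. -/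
def Big (ω : Sym2 Vt → Bool) (x : Vt) (M : ℕ) : Prop :=
  ∃ S : Finset Vt, M ≤ S.card ∧ ∀ y ∈ S, Conn ω x y

theorem Big.mono {ω ω' : Sym2 Vt → Bool} (h : ω ≤ ω') {x : Vt} {M M' : ℕ} (hM : M' ≤ M)
    (hB : Big ω x M) : Big ω' x M' := by
  obtain ⟨S, hS, hc⟩ := hB
  exact ⟨S, hM.trans hS, fun y hy => (hc y hy).mono h⟩

/-! ## Splitting trees -/

/-- `Tr F x S`: the edge set `F` is a tree with root `x` and vertex set `S`. -/
inductive Tr : Finset (Sym2 Vt) → Vt → Finset Vt → Prop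
  | single (x : Vt) : Tr ∅ x {x}
  | graft {F G : Finset (Sym2 Vt)} {x y : Vt} {S T : Finset Vt} :
      Tr F x S → Tr G y T → Disjoint S T → Tr (insert s(x, y) (F ∪ G)) x (S ∪ T)

theorem Tr.root_mem {F : Finset (Sym2 Vt)} {x : Vt} {S : Finset Vt} (h : Tr F x S) : x ∈ S := by
  induction h with
  | single x => simp
  | graft _ _ _ ih _ => exact Finset.mem_union_left _ ih

theorem Tr.mem_of_mem {F : Finset (Sym2 Vt)} {x : Vt} {S : Finset Vt} (h : Tr F x S) :
    ∀ e ∈ F, ∀ v ∈ e, v ∈ S := by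
  induction h with
  | single x => simp
  | graft h1 h2 _ ih1 ih2 =>
    intro e he v hv
    rcases Finset.mem_insert.1 he with rfl | he
    · rcases Sym2.mem_iff.1 hv with rfl | rfl
      · exact Finset.mem_union_left _ h1.root_mem
      · exact Finset.mem_union_right _ h2.root_mem
    · rcases Finset.mem_union.1 he with he | he
      · exact Finset.mem_union_left _ (ih1 e he v hv)
      · exact Finset.mem_union_right _ (ih2 e he v hv)

theorem Tr.conn {F : Finset (Sym2 Vt)} {x : Vt} {S : Finset Vt} (h : Tr F x S) :
    ∀ v ∈ S, Conn (indic F) x v := by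
  induction h with
  | single x =>
    intro v hv
    rw [Finset.mem_singleton.1 hv]
    exact Conn.refl _ _
  | @graft F G x y S T h1 h2 _ ih1 ih2 =>
    intro v hv
    have hF : F ⊆ insert s(x, y) (F ∪ G) :=
      Finset.subset_union_left.trans (Finset.subset_insert _ _)
    have hG : G ⊆ insert s(x, y) (F ∪ G) :=
      Finset.subset_union_right.trans (Finset.subset_insert _ _)
    rcases Finset.mem_union.1 hv with hv | hv
    · exact (ih1 v hv).mono (indic_le hF)
    · exact (Conn.of_open (indic_eq_true.2 (Finset.mem_insert_self _ _))).trans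
        ((ih2 v hv).mono (indic_le hG))

theorem Tr.grow {F : Finset (Sym2 Vt)} {x : Vt} {S : Finset Vt} (h : Tr F x S) {z w : Vt}
    (hz : z ∈ S) (hw : w ∉ S) :
    ∃ F', Tr F' x (insert w S) ∧ F' ⊆ insert s(z, w) F := by
  induction h with
  | single x =>
    rw [Finset.mem_singleton.1 hz]
    refine ⟨_, (?_ : Tr (insert s(x, w) (∅ ∪ ∅)) x _), by simp⟩
    have := Tr.graft (Tr.single x) (Tr.single w)
      (by simpa [eq_comm] using hw : Disjoint ({x} : Finset Vt) {w})
    rwa [Finset.union_comm {x} {w}, ← Finset.insert_eq] at this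
  | @graft F G x y S T h1 h2 hd ih1 ih2 =>
    simp only [Finset.mem_union, not_or] at hw
    rcases Finset.mem_union.1 hz with hz | hz
    · obtain ⟨F', hF', hs⟩ := ih1 hz hw.1
      have := Tr.graft hF' h2 (by
        rw [Finset.disjoint_insert_left]
        exact ⟨hw.2, hd⟩)
      rw [Finset.insert_union] at this
      refine ⟨_, this, ?_⟩
      intro e he
      have h3 := @hs e
      simp only [Finset.mem_insert, Finset.mem_union] at he h3 ⊢
      tauto
    · obtain ⟨G', hG', hs⟩ := ih2 hz hw.2
      have := Tr.graft h1 hG' (by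
        rw [Finset.disjoint_insert_right]
        exact ⟨hw.1, hd⟩)
      rw [Finset.union_insert] at this
      refine ⟨_, this, ?_⟩
      intro e he
      have h3 := @hs e
      simp only [Finset.mem_insert, Finset.mem_union] at he h3 ⊢
      tauto

/-- A cluster of size at least `n` contains an open tree with exactly `n` vertices. -/
theorem Big.exists_tree {ω : Sym2 Vt → Bool} {x : Vt} {n : ℕ} (hn : 1 ≤ n) (h : Big ω x n) :
    ∃ F S, Tr F x S ∧ S.card = n ∧ ∀ e ∈ F, ω e = true := by
  induction n, hn using Nat.le_induction with
  | base => exact ⟨∅, {x}, Tr.single x, by simp, by simp⟩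
  | succ n _ ih =>
    obtain ⟨F, S, hT, hS, hF⟩ := ih (h.mono le_rfl (Nat.le_succ n))
    obtain ⟨B, hB, hc⟩ := h
    obtain ⟨y, hy, hyS⟩ : ∃ y ∈ B, y ∉ S := by
      by_contra! hcon
      have := Finset.card_le_card hcon
      omega
    obtain ⟨u, v, hu, hv, huv⟩ := (hc y hy).exists_boundary (S := (S : Set Vt))
      (by simpa using hT.root_mem) (by simpa using hyS)
    have hv' : v ∉ S := by simpa using hv
    obtain ⟨F', hT', hF'⟩ := hT.grow (by simpa using hu) hv'
    refine ⟨F', _, hT', by rw [Finset.card_insert_of_notMem hv', hS], fun e he => ?_⟩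
    rcases Finset.mem_insert.1 (hF' he) with rfl | he
    · exact huv
    · exact hF e he

/-- A large tree splits into two edge-disjoint large trees, one of them containing the root. -/
theorem Tr.split {F : Finset (Sym2 Vt)} {x : Vt} {S : Finset Vt} (h : Tr F x S) {M : ℕ}
    (hM : 1 ≤ M) (hS : M ≤ S.card) :
    ∃ (I J : Finset (Sym2 Vt)) (z : Vt) (A B : Finset Vt), I ⊆ F ∧ J ⊆ F ∧ Disjoint I J ∧
      A ⊆ S ∧ B ⊆ S ∧ z ∈ S ∧ (∀ v ∈ A, Conn (indic I) x v) ∧ (∀ v ∈ B, Conn (indic J) z v) ∧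
      M ≤ B.card ∧ B.card < 2 * M ∧ S.card + 1 ≤ A.card + B.card := by
  induction h with
  | single x =>
    have h1 : ∀ v ∈ ({x} : Finset Vt), Conn (indic ∅) x v := fun v hv => by
      rw [Finset.mem_singleton.1 hv]
      exact Conn.refl _ _
    refine ⟨∅, ∅, x, {x}, {x}, subset_rfl, subset_rfl, Finset.disjoint_empty_left _, subset_rfl,
      subset_rfl, by simp, h1, h1, hS, ?_, ?_⟩ <;> simp <;> omega
  | @graft F G x y S T h1 h2 hd ih1 ih2 =>
    have hFs : F ⊆ insert s(x, y) (F ∪ G) :=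
      Finset.subset_union_left.trans (Finset.subset_insert _ _)
    have hGs : G ⊆ insert s(x, y) (F ∪ G) :=
      Finset.subset_union_right.trans (Finset.subset_insert _ _)
    have hFG : ∀ e, e ∈ F → e ∈ G → False := by
      intro e
      induction e with
      | _ a b =>
        intro hF hG
        exact Finset.disjoint_left.1 hd (h1.mem_of_mem _ hF a (by simp))
          (h2.mem_of_mem _ hG a (by simp))
    have hxG : s(x, y) ∉ G := fun h =>
      Finset.disjoint_left.1 hd h1.root_mem (h2.mem_of_mem _ h x (by simp))
    have hyF : s(x, y) ∉ F := fun h =>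
      Finset.disjoint_left.1 hd (h1.mem_of_mem _ h y (by simp)) h2.root_mem
    have hcard := Finset.card_union_of_disjoint hd
    by_cases hT : M ≤ T.card
    · obtain ⟨I, J, z, A, B, hI, hJ, hIJ, hA, hB, hz, hcA, hcB, hB1, hB2, hAB⟩ := ih2 hT
      refine ⟨insert s(x, y) (F ∪ I), J, z, S ∪ A, B, ?_, hJ.trans hGs, ?_, ?_,
        hB.trans Finset.subset_union_right, Finset.mem_union_right _ hz, ?_, hcB, hB1, hB2, ?_⟩
      · exact Finset.insert_subset_insert _ (Finset.union_subset_union subset_rfl hI)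
      · rw [Finset.disjoint_left]
        intro e he heJ
        rcases Finset.mem_insert.1 he with rfl | he
        · exact hxG (hJ heJ)
        · rcases Finset.mem_union.1 he with he | he
          · exact hFG e he (hJ heJ)
          · exact Finset.disjoint_left.1 hIJ he heJ
      · exact Finset.union_subset_union subset_rfl hA
      · intro v hv
        rcases Finset.mem_union.1 hv with hv | hv
        · exact (h1.conn v hv).mono (indic_le
            (Finset.subset_union_left.trans (Finset.subset_insert _ _)))
        · exact (Conn.of_open (indic_eq_true.2 (Finset.mem_insert_self _ _))).trans
            ((hcA v hv).mono (indic_le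
              (Finset.subset_union_right.trans (Finset.subset_insert _ _))))
      · rw [Finset.card_union_of_disjoint (Finset.disjoint_of_subset_right hA hd), hcard]
        omega
    · by_cases hS' : M ≤ S.card
      · obtain ⟨I, J, z, A, B, hI, hJ, hIJ, hA, hB, hz, hcA, hcB, hB1, hB2, hAB⟩ := ih1 hS'
        refine ⟨insert s(x, y) (I ∪ G), J, z, A ∪ T, B, ?_, hJ.trans hFs, ?_, ?_,
          hB.trans Finset.subset_union_left, Finset.mem_union_left _ hz, ?_, hcB, hB1, hB2, ?_⟩
        · exact Finset.insert_subset_insert _ (Finset.union_subset_union hI subset_rfl)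
        · rw [Finset.disjoint_left]
          intro e he heJ
          rcases Finset.mem_insert.1 he with rfl | he
          · exact hyF (hJ heJ)
          · rcases Finset.mem_union.1 he with he | he
            · exact Finset.disjoint_left.1 hIJ he heJ
            · exact hFG e (hJ heJ) he
        · exact Finset.union_subset_union hA subset_rfl
        · intro v hv
          rcases Finset.mem_union.1 hv with hv | hv
          · exact (hcA v hv).mono (indic_le
              (Finset.subset_union_left.trans (Finset.subset_insert _ _)))
          · exact (Conn.of_open (indic_eq_true.2 (Finset.mem_insert_self _ _))).trans
              ((h2.conn v hv).mono (indic_le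
                (Finset.subset_union_right.trans (Finset.subset_insert _ _))))
        · rw [Finset.card_union_of_disjoint (Finset.disjoint_of_subset_left hA hd), hcard]
          omega
      · refine ⟨∅, insert s(x, y) (F ∪ G), x, {x}, S ∪ T, Finset.empty_subset _, subset_rfl,
          Finset.disjoint_empty_left _, ?_, subset_rfl, Finset.mem_union_left _ h1.root_mem, ?_,
          (Tr.graft h1 h2 hd).conn, hS, by omega, by simp⟩
        · simpa using Or.inl h1.root_mem
        · intro v hv
          rw [Finset.mem_singleton.1 hv]
          exact Conn.refl _ _

/-! ## Tightness of cluster sizes -/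

variable {μ : Measure (Sym2 Vt → Bool)} {p : Sym2 Vt → ℝ}

theorem dependsOn_big (F : Set (Sym2 Vt)) (x : Vt) (M : ℕ) :
    DependsOn (fun ω => ω ∈ {ω | Big (cut F ω) x M}) F :=
  dependsOn_cut F fun ω => Big ω x M

/-- Large clusters are unlikely to be much larger than the typical largest cluster. -/
theorem IsPerc.big_three_mul_le (h : IsPerc μ p) (hp : ∀ e, 0 ≤ p e ∧ p e ≤ 1) {Λ : Finset Vt}
    {x : Vt} (hx : x ∈ Λ) {M : ℕ} (hM : 1 ≤ M) :
    μ {ω | Big (cut (Λ.sym2 : Set (Sym2 Vt)) ω) x (3 * M)} ≤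
      μ {ω | Big (cut (Λ.sym2 : Set (Sym2 Vt)) ω) x M} *
        μ {ω | ∃ z ∈ Λ, Big (cut (Λ.sym2 : Set (Sym2 Vt)) ω) z M} := by
  set F := Λ.sym2 with hF
  have hd : DependsOn (fun ω => ω ∈ {ω | ∃ z ∈ Λ, Big (cut (F : Set (Sym2 Vt)) ω) z M})
      (F : Set (Sym2 Vt)) := dependsOn_cut (F : Set (Sym2 Vt)) fun ω => ∃ z ∈ Λ, Big ω z M
  rw [h.measure_eq_Pf hp (dependsOn_big _ x (3 * M)), h.measure_eq_Pf hp (dependsOn_big _ x M),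
    h.measure_eq_Pf hp hd, ← ENNReal.ofReal_mul]
  swap
  · refine Pf_nonneg hp fun s _ => ?_
    split_ifs <;> norm_num
  refine ENNReal.ofReal_le_ofReal ?_
  let D : Finset (Sym2 Vt) → Finset (Sym2 Vt) → Prop := fun I J =>
    Big (indic I) x M ∧ ∃ z ∈ Λ, Big (indic J) z M
  have hD : ∀ s s' t t', s ⊆ s' → t ⊆ t' → D s t → D s' t' := by
    rintro s s' t t' hs ht ⟨h1, z, hz, h2⟩
    exact ⟨h1.mono (indic_le hs) le_rfl, z, hz, h2.mono (indic_le ht) le_rfl⟩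
  have hBK := Pf_disjoint_le F hp D hD
  refine le_trans (Pf_mono hp fun s hs => ?_) (hBK.trans (le_of_eq ?_))
  · by_cases hb : Big (indic s) x (3 * M)
    · obtain ⟨G, S, hT, hS, hG⟩ := hb.exists_tree (by omega)
      obtain ⟨I, J, z, A, B, hI, hJ, hIJ, -, -, hz, hcA, hcB, hB1, hB2, hAB⟩ :=
        hT.split hM (by omega)
      have hGs : G ⊆ s := fun e he => indic_eq_true.1 (hG e he)
      have hzΛ : z ∈ Λ := by
        have := (hT.conn z hz).mono (indic_le hGs)
        rw [← cut_indic hs, hF] at this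
        exact this.mem_of_cut hx
      have hcon : ∃ I J, I ⊆ s ∧ J ⊆ s ∧ Disjoint I J ∧ D I J :=
        ⟨I, J, hI.trans hGs, hJ.trans hGs, hIJ, ⟨A, by omega, hcA⟩, z, hzΛ, B, hB1, hcB⟩
      rw [if_pos hcon]
      split_ifs <;> norm_num
    · have : indic s ∉ {ω | Big (cut (F : Set (Sym2 Vt)) ω) x (3 * M)} := by
        simpa [cut_indic hs] using hb
      rw [if_neg this]
      split_ifs <;> norm_num
  · rw [mul_comm, ← Pf_mul_left]
    refine Pf_congr fun s hs => ?_
    rw [mul_comm, ← Pf_mul_left]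
    refine Pf_congr fun t ht => ?_
    simp only [D, Set.mem_ofPred_eq, cut_indic hs, cut_indic ht]
    by_cases h1 : Big (indic s) x M <;> by_cases h2 : ∃ z ∈ Λ, Big (indic t) z M <;> simp [h1, h2]

end Connectivity

/-! ## Boxes and translations -/

section Boxes

variable {d : ℕ}

/-- The lattice box of side `L` with index `z`. -/
noncomputable def box (L : ℕ) (z : V d) : Finset (V d) :=
  Fintype.piFinset fun i => Finset.Ico ((L : ℤ) * z i) ((L : ℤ) * z i + L)

theorem mem_box {L : ℕ} {z x : V d} :
    x ∈ box L z ↔ ∀ i, (L : ℤ) * z i ≤ x i ∧ x i < (L : ℤ) * z i + L := by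
  simp [box, Fintype.mem_piFinset]

theorem card_box (L : ℕ) (z : V d) : (box L z).card = L ^ d := by
  simp [box, Fintype.card_piFinset]

theorem box_one (z : V d) : box 1 z = {z} := by
  ext x
  simp only [mem_box, Finset.mem_singleton, funext_iff]
  refine forall_congr' fun i => ?_
  push_cast
  omega

theorem abs_sub_le_of_mem_box {L : ℕ} {z x y : V d} (hx : x ∈ box L z) (hy : y ∈ box L z) (i) :
    |x i - y i| ≤ L := by
  have h1 := mem_box.1 hx i
  have h2 := mem_box.1 hy i
  rw [abs_le]
  constructor <;> linarith

theorem box_subset_box {L m : ℕ} {z c : V d} (hc : c ∈ box m z) : box L c ⊆ box (m * L) z := by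
  intro x hx
  rw [mem_box] at *
  intro i
  obtain ⟨h1, h2⟩ := hc i
  obtain ⟨h3, h4⟩ := hx i
  push_cast
  constructor
  · nlinarith
  · have : (c i) + 1 ≤ m * z i + m := h2
    nlinarith

theorem disjoint_box {L : ℕ} {z c : V d} (hc : z ≠ c) : Disjoint (box L z) (box L c) := by
  rw [Finset.disjoint_left]
  intro x hx hx'
  rw [mem_box] at *
  apply hc
  funext i
  obtain ⟨h1, h2⟩ := hx i
  obtain ⟨h3, h4⟩ := hx' i
  have hL : (0 : ℤ) < L := by linarith
  rcases lt_trichotomy (z i) (c i) with h | h | h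
  · have : z i + 1 ≤ c i := h
    nlinarith
  · exact h
  · have : c i + 1 ≤ z i := h
    nlinarith

theorem disjoint_sym2 {Vt : Type*} {Λ Λ' : Finset Vt} (h : Disjoint Λ Λ') :
    Disjoint (Λ.sym2 : Set (Sym2 Vt)) (Λ'.sym2 : Set (Sym2 Vt)) := by
  rw [Set.disjoint_left]
  intro e
  induction e with
  | _ a b =>
    intro h1 h2
    simp only [Finset.mem_coe, Finset.mk_mem_sym2_iff] at h1 h2
    exact Finset.disjoint_left.1 h h1.1 h2.1

/-- Translation of configurations. -/
def shift (a : V d) (ω : Config d) : Config d := fun e => ω (Sym2.map (· + a) e)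

/-- Translation invariance of edge probabilities. -/
def TransInv (p : Sym2 (V d) → ℝ) : Prop := ∀ (a : V d) (e), p (Sym2.map (· + a) e) = p e

theorem measurable_shift (a : V d) : Measurable (shift a : Config d → Config d) :=
  measurable_pi_iff.2 fun _ => measurable_pi_apply _

theorem map_add_injective (a : V d) : Function.Injective (Sym2.map (· + a)) :=
  Sym2.map.injective (add_left_injective a)

variable {μ : Measure (Config d)} {p : Sym2 (V d) → ℝ}

theorem IsPerc.map_shift (h : IsPerc μ p) (hp : ∀ e, 0 ≤ p e ∧ p e ≤ 1) (ht : TransInv p)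
    (a : V d) : μ.map (shift a) = μ := by
  have := h.1
  refine IsPerc.unique ⟨Measure.isProbabilityMeasure_map (measurable_shift a).aemeasurable,
    fun s f => ?_⟩ h hp
  rw [Measure.map_apply (measurable_shift a) (measurableSet_agree s f)]
  have hinv : ∀ e : Sym2 (V d), Sym2.map (· + -a) (Sym2.map (· + a) e) = e := by
    intro e
    induction e with
    | _ x y => simp
  have h2 := h.2 (s.map ⟨_, map_add_injective a⟩) (fun e => f (Sym2.map (· + -a) e))
  simp only [Finset.forall_mem_map, Function.Embedding.coeFn_mk, hinv, Finset.prod_map,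
    ht a] at h2
  exact h2

theorem conn_shift {ω : Config d} {a x y : V d} :
    Conn (shift a ω) x y ↔ Conn ω (x + a) (y + a) := by
  constructor
  · intro h
    induction h with
    | refl => exact Conn.refl _ _
    | tail _ hbc ih => exact ih.trans (Conn.of_open hbc)
  · intro h
    have : ∀ u v : V d, Conn ω u v → Conn (shift a ω) (u - a) (v - a) := by
      intro u v h
      induction h with
      | refl => exact Conn.refl _ _
      | tail _ hbc ih => exact ih.trans (Conn.of_open (by simpa [shift] using hbc))
    simpa using this _ _ h

theorem cut_shift (ω : Config d) (a : V d) (Λ : Finset (V d)) :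
    cut (Λ.sym2 : Set _) (shift a ω) =
      shift a (cut ((Λ.map (addRightEmbedding a)).sym2 : Set _) ω) := by
  funext e
  induction e with
  | _ x y => simp [cut, shift]

theorem map_box (L : ℕ) (z a : V d) :
    (box L z).map (addRightEmbedding ((L : ℤ) • a)) = box L (z + a) := by
  ext x
  simp only [Finset.mem_map, addRightEmbedding_apply, mem_box, Pi.add_apply]
  constructor
  · rintro ⟨y, hy, rfl⟩ i
    have := hy i
    simp only [Pi.add_apply, Pi.smul_apply, smul_eq_mul]
    constructor <;> nlinarith
  · intro h
    refine ⟨x - (L : ℤ) • a, fun i => ?_, by simp⟩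
    have := h i
    simp only [Pi.sub_apply, Pi.smul_apply, smul_eq_mul]
    constructor <;> nlinarith

end Boxes

/-! ## Merging independent clusters -/

section Merging

variable {Vt : Type*} {μ : Measure (Sym2 Vt → Bool)} {p : Sym2 Vt → ℝ}

/-- The edges between `A` and `B`. -/
noncomputable def between (A B : Finset Vt) : Finset (Sym2 Vt) := (A ×ˢ B).image fun q => s(q.1, q.2)

theorem mem_between {A B : Finset Vt} {e : Sym2 Vt} :
    e ∈ between A B ↔ ∃ a ∈ A, ∃ b ∈ B, s(a, b) = e := by
  simp [between, and_assoc]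

theorem card_between {A B : Finset Vt} (h : Disjoint A B) :
    (between A B).card = A.card * B.card := by
  rw [between, Finset.card_image_of_injOn, Finset.card_product]
  rintro ⟨a, b⟩ h1 ⟨a', b'⟩ h2 heq
  simp only [Finset.coe_product, Set.mem_prod, Finset.mem_coe] at h1 h2
  simp only [Sym2.eq_iff] at heq
  rcases heq with ⟨rfl, rfl⟩ | ⟨rfl, rfl⟩
  · rfl
  · exact absurd h2.2 (Finset.disjoint_left.1 h h1.1)

theorem disjoint_between {Λ Λ' A B : Finset Vt} (h : Disjoint Λ Λ') (hA : A ⊆ Λ) (hB : B ⊆ Λ') :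
    Disjoint ((Λ.sym2 ∪ Λ'.sym2 : Finset (Sym2 Vt)) : Set (Sym2 Vt)) (between A B) := by
  rw [Finset.disjoint_coe, Finset.disjoint_right]
  intro e he
  obtain ⟨a, ha, b, hb, rfl⟩ := mem_between.1 he
  simp only [Finset.mem_union, Finset.mk_mem_sym2_iff, not_or, not_and]
  exact ⟨fun _ h' => Finset.disjoint_left.1 h h' (hB hb),
    fun h' => absurd h' (Finset.disjoint_left.1 h (hA ha))⟩

/-- The event that no edge between `A` and `B` is open. -/
def Sep (A B : Finset Vt) : Set (Sym2 Vt → Bool) := {ω | ∀ e ∈ between A B, ω e = false}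

theorem dependsOn_sep (A B : Finset Vt) : DependsOn (fun ω => ω ∈ Sep A B) (between A B) := by
  intro ω ω' h
  exact propext (forall₂_congr fun e he => by rw [h e he])

theorem measurableSet_sep (A B : Finset Vt) : MeasurableSet (Sep A B) :=
  measurableSet_of_dependsOn (dependsOn_sep A B)

theorem IsPerc.measure_sep_le (h : IsPerc μ p) {A B : Finset Vt} (hAB : Disjoint A B) {g : ℝ}
    (hg : ∀ a ∈ A, ∀ b ∈ B, 1 - p s(a, b) ≤ Real.exp (-g)) :
    μ (Sep A B) ≤ ENNReal.ofReal (Real.exp (-(g * (A.card * B.card)))) := by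
  have := h.measure_closed_le (F := between A B) (g := g) (by
    intro e he
    obtain ⟨a, ha, b, hb, rfl⟩ := mem_between.1 he
    exact hg a ha b hb)
  rw [card_between hAB] at this
  exact_mod_cast this

theorem dependsOn_eq {ι β : Type*} {T : Set ι} {f : (ι → Bool) → β} (h : DependsOn f T) (b : β) :
    DependsOn (fun ω => ω ∈ {ω | f ω = b}) T := fun ω ω' he => by
  simp only [Set.mem_ofPred_eq, h he]

/-- Large clusters in disjoint regions are likely to be joined by an open edge. -/
theorem IsPerc.measure_unmerged_le (h : IsPerc μ p) {Λ Λ' : Finset Vt} (hd : Disjoint Λ Λ')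
    {X Y : (Sym2 Vt → Bool) → Finset Vt}
    (hX : DependsOn X (Λ.sym2 : Set (Sym2 Vt))) (hY : DependsOn Y (Λ'.sym2 : Set (Sym2 Vt)))
    (hXΛ : ∀ ω, X ω ⊆ Λ) (hYΛ : ∀ ω, Y ω ⊆ Λ') {g : ℝ} (hg0 : 0 ≤ g)
    (hg : ∀ a ∈ Λ, ∀ b ∈ Λ', 1 - p s(a, b) ≤ Real.exp (-g)) (s t : ℕ) :
    μ {ω | s ≤ (X ω).card ∧ t ≤ (Y ω).card ∧ ω ∈ Sep (X ω) (Y ω)} ≤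
      ENNReal.ofReal (Real.exp (-(g * (s * t)))) := by
  have := h.1
  set I := (Λ.powerset ×ˢ Λ'.powerset).filter fun q => s ≤ q.1.card ∧ t ≤ q.2.card with hI
  let E : Finset Vt × Finset Vt → Set (Sym2 Vt → Bool) := fun q => {ω | X ω = q.1} ∩ {ω | Y ω = q.2}
  have hXm : ∀ A, MeasurableSet {ω | X ω = A} := fun A =>
    measurableSet_of_dependsOn (dependsOn_eq hX A)
  have hYm : ∀ A, MeasurableSet {ω | Y ω = A} := fun A =>
    measurableSet_of_dependsOn (dependsOn_eq hY A)
  have hE : ∀ q, MeasurableSet (E q) := fun q => (hXm _).inter (hYm _)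
  have hsub : {ω | s ≤ (X ω).card ∧ t ≤ (Y ω).card ∧ ω ∈ Sep (X ω) (Y ω)} ⊆
      ⋃ q ∈ I, E q ∩ Sep q.1 q.2 := by
    rintro ω ⟨h1, h2, h3⟩
    simp only [Set.mem_iUnion]
    refine ⟨(X ω, Y ω), ?_, ⟨rfl, rfl⟩, h3⟩
    simp [hI, hXΛ, hYΛ, h1, h2]
  calc _ ≤ μ (⋃ q ∈ I, E q ∩ Sep q.1 q.2) := MeasureTheory.measure_mono hsub
    _ ≤ ∑ q ∈ I, μ (E q ∩ Sep q.1 q.2) := measure_biUnion_finset_le _ _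
    _ ≤ ∑ q ∈ I, μ (E q) * ENNReal.ofReal (Real.exp (-(g * (s * t)))) := by
      refine Finset.sum_le_sum fun q hq => ?_
      simp only [hI, Finset.mem_filter, Finset.mem_product, Finset.mem_powerset] at hq
      obtain ⟨⟨h1, h2⟩, h3, h4⟩ := hq
      rw [h.indep (disjoint_between hd h1 h2) (hE q) (measurableSet_sep _ _) ?_
        (dependsOn_sep _ _)]
      · refine mul_le_mul_right ((h.measure_sep_le (hd.mono h1 h2)
          (fun a ha b hb => hg a (h1 ha) b (h2 hb))).trans ?_) _
        refine ENNReal.ofReal_le_ofReal (Real.exp_le_exp.2 (neg_le_neg ?_))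
        gcongr
      · intro ω ω' hω
        simp only [E, Set.mem_inter_iff, Set.mem_ofPred_eq]
        rw [hX fun e he => hω e (by simpa using Or.inl he),
          hY fun e he => hω e (by simpa using Or.inr he)]
    _ = (∑ q ∈ I, μ (E q)) * ENNReal.ofReal (Real.exp (-(g * (s * t)))) := by
      rw [Finset.sum_mul]
    _ ≤ 1 * ENNReal.ofReal (Real.exp (-(g * (s * t)))) := by
      refine mul_le_mul_left ?_ _
      rw [← measure_biUnion_finset _ fun q _ => hE q]
      · exact prob_le_one
      · rintro q - q' - hne
        refine Set.disjoint_left.2 ?_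
        rintro ω ⟨h1, h2⟩ ⟨h3, h4⟩
        exact hne (Prod.ext (h1.symm.trans h3) (h2.symm.trans h4))
    _ = _ := one_mul _

end Merging

/-! ## Hierarchical growth of clusters -/

section Growth

variable {d : ℕ}

/-- Lower bound on the edge probabilities: points at distance at most `n` are joined with
probability at least `1 - exp (-b n^{-σ})`. -/
def Lower (p : Sym2 (V d) → ℝ) (b σ : ℝ) : Prop :=
  ∀ n : ℕ, 1 ≤ n → ∀ x y : V d, x ≠ y → (∀ i, |x i - y i| ≤ n) →
    1 - p s(x, y) ≤ Real.exp (-(b * (n : ℝ) ^ (-σ)))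

/-- Inside the box with side `L` and index `z` there is a cluster of size at least `s`. -/
def Seed (L s : ℕ) (z : V d) (ω : Config d) : Prop :=
  ∃ x ∈ box L z, Big (cut ((box L z).sym2 : Set (Sym2 (V d))) ω) x s

theorem dependsOn_seed (L s : ℕ) (z : V d) :
    DependsOn (fun ω => ω ∈ {ω | Seed L s z ω}) ((box L z).sym2 : Set (Sym2 (V d))) :=
  dependsOn_cut _ fun ω => ∃ x ∈ box L z, Big ω x s

theorem Seed.exists_finset {L s : ℕ} {z : V d} {ω : Config d} (h : Seed L s z ω) :
    ∃ S ⊆ box L z, s ≤ S.card ∧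
      ∀ x ∈ S, ∀ y ∈ S, Conn (cut ((box L z).sym2 : Set (Sym2 (V d))) ω) x y := by
  obtain ⟨x, hx, S, hS, hc⟩ := h
  exact ⟨S, fun y hy => (hc y hy).mem_of_cut hx, hS, fun u hu v hv => (hc u hu).symm.trans (hc v hv)⟩

/-- A cluster in the box of side `L` at scale zero. -/
noncomputable def seedSet (L s : ℕ) (z : V d) (ω : Config d) : Finset (V d) :=
  if h : ∃ S ⊆ box L z, s ≤ S.card ∧
      ∀ x ∈ S, ∀ y ∈ S, Conn (cut ((box L z).sym2 : Set (Sym2 (V d))) ω) x y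
  then h.choose else ∅

/-- Almost all of the sub-boxes contain a good cluster and these are pairwise adjacent. -/
def Good (m : ℕ) (z : V d) (X : V d → Finset (V d)) (ω : Config d) : Prop :=
  (∀ c ∈ box m z, ∀ c' ∈ box m z, X c = ∅ → X c' = ∅ → c = c') ∧
    ∀ c ∈ box m z, ∀ c' ∈ box m z, c ≠ c' → X c ≠ ∅ → X c' ≠ ∅ → ω ∉ Sep (X c) (X c')

/-- The cluster grown in the box of side `m^n L` with index `z`. -/
noncomputable def grown (m L s : ℕ) : ℕ → V d → Config d → Finset (V d)
  | 0, z, ω => seedSet L s z ω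
  | n + 1, z, ω =>
    if Good m z (fun c => grown m L s n c ω) ω then
      (box m z).biUnion fun c => grown m L s n c ω else ∅

variable {m L s : ℕ}

theorem grown_subset (n : ℕ) (z : V d) (ω : Config d) :
    grown m L s n z ω ⊆ box (m ^ n * L) z := by
  induction n generalizing z with
  | zero =>
    rw [grown, seedSet]
    split_ifs with h
    · simpa using h.choose_spec.1
    · simp
  | succ n ih =>
    rw [grown]
    split_ifs with h
    · refine Finset.biUnion_subset.2 fun c hc => (ih c).trans ?_
      rw [pow_succ', mul_assoc]
      exact box_subset_box hc
    · simp

theorem sym2_box_subset {n : ℕ} {z c : V d} (hc : c ∈ box m z) :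
    ((box (m ^ n * L) c).sym2 : Set (Sym2 (V d))) ⊆ (box (m ^ (n + 1) * L) z).sym2 := by
  rw [pow_succ', mul_assoc]
  exact Finset.coe_subset.2 (Finset.sym2_mono (box_subset_box hc))

theorem dependsOn_grown (n : ℕ) (z : V d) :
    DependsOn (grown m L s n z) ((box (m ^ n * L) z).sym2 : Set (Sym2 (V d))) := by
  induction n generalizing z with
  | zero =>
    have h := dependsOn_cut (((box L z).sym2 : Finset _) : Set (Sym2 (V d)))
      fun ω => if h : ∃ S ⊆ box L z, s ≤ S.card ∧ ∀ x ∈ S, ∀ y ∈ S, Conn ω x y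
        then h.choose else (∅ : Finset (V d))
    simp only [pow_zero, one_mul]
    exact h
  | succ n ih =>
    intro ω ω' h
    have h1 : ∀ c ∈ box m z, grown m L s n c ω = grown m L s n c ω' := fun c hc =>
      ih c fun e he => h e (sym2_box_subset hc he)
    have h2 : (box m z).biUnion (fun c => grown m L s n c ω) =
        (box m z).biUnion (fun c => grown m L s n c ω') := Finset.biUnion_congr rfl h1
    have h3 : Good m z (fun c => grown m L s n c ω) ω ↔ Good m z (fun c => grown m L s n c ω') ω' := by
      unfold Good
      refine and_congr ?_ ?_
      · refine forall₂_congr fun c hc => forall₂_congr fun c' hc' => ?_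
        beta_reduce
        rw [h1 c hc, h1 c' hc']
      · refine forall₂_congr fun c hc => forall₂_congr fun c' hc' => ?_
        beta_reduce
        rw [h1 c hc, h1 c' hc']
        refine forall₃_congr fun _ _ _ => not_congr ?_
        refine forall₂_congr fun e he => ?_
        rw [h e ?_]
        obtain ⟨a, ha, b, hb, rfl⟩ := mem_between.1 he
        have ha' := sym2_box_subset (L := L) (n := n) hc (a := s(a, a))
          (by simpa using grown_subset _ _ _ ha)
        have hb' := sym2_box_subset (L := L) (n := n) hc' (a := s(b, b))
          (by simpa using grown_subset _ _ _ hb)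
        simp only [Finset.mem_coe, Finset.mk_mem_sym2_iff] at ha' hb' ⊢
        exact ⟨ha'.1, hb'.1⟩
    rw [grown, grown, h2]
    exact if_congr h3 rfl rfl

theorem exists_open_of_notMem_sep {A B : Finset (V d)} {ω : Config d} (h : ω ∉ Sep A B) :
    ∃ a ∈ A, ∃ b ∈ B, ω s(a, b) = true := by
  by_contra! hcon
  refine h fun e he => ?_
  obtain ⟨a, ha, b, hb, rfl⟩ := mem_between.1 he
  simpa using hcon a ha b hb

theorem conn_grown (n : ℕ) (z : V d) (ω : Config d) :
    ∀ x ∈ grown m L s n z ω, ∀ y ∈ grown m L s n z ω, Conn ω x y := by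
  induction n generalizing z with
  | zero =>
    rw [grown, seedSet]
    split_ifs with h
    · exact fun x hx y hy => (h.choose_spec.2.2 x hx y hy).mono (cut_le _ _)
    · simp
  | succ n ih =>
    rw [grown]
    split_ifs with h
    · intro x hx y hy
      obtain ⟨c, hc, hxc⟩ := Finset.mem_biUnion.1 hx
      obtain ⟨c', hc', hyc⟩ := Finset.mem_biUnion.1 hy
      by_cases hcc : c = c'
      · subst hcc
        exact ih c x hxc y hyc
      · obtain ⟨a, ha, b, hb, hab⟩ := exists_open_of_notMem_sep
          (h.2 c hc c' hc' hcc (Finset.ne_empty_of_mem hxc) (Finset.ne_empty_of_mem hyc))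
        exact ((ih c x hxc a ha).trans (Conn.of_open hab)).trans (ih c' b hb y hyc)
    · simp

theorem grown_succ_of_ne_empty {n : ℕ} {z : V d} {ω : Config d}
    (h : grown m L s (n + 1) z ω ≠ ∅) :
    Good m z (fun c => grown m L s n c ω) ω ∧
      grown m L s (n + 1) z ω = (box m z).biUnion fun c => grown m L s n c ω := by
  rw [grown] at h ⊢
  split_ifs at h ⊢ with h1
  · exact ⟨h1, rfl⟩
  · exact absurd rfl h

theorem card_grown (n : ℕ) (z : V d) (ω : Config d) (h : grown m L s n z ω ≠ ∅) :
    s * (m ^ d - 1) ^ n ≤ (grown m L s n z ω).card := by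
  induction n generalizing z with
  | zero =>
    rw [grown, seedSet] at h ⊢
    split_ifs at h ⊢ with h1
    · simpa using h1.choose_spec.2.1
    · exact absurd rfl h
  | succ n ih =>
    obtain ⟨hg, heq⟩ := grown_succ_of_ne_empty h
    rw [heq, Finset.card_biUnion fun c _ c' _ hcc => (disjoint_box hcc).mono
      (grown_subset n c ω) (grown_subset n c' ω)]
    set I := (box m z).filter fun c => grown m L s n c ω ≠ ∅ with hI
    have hc1 : ((box m z).filter fun c => grown m L s n c ω = ∅).card ≤ 1 := by
      rw [Finset.card_le_one]
      intro a ha b hb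
      simp only [Finset.mem_filter] at ha hb
      exact hg.1 a ha.1 b hb.1 ha.2 hb.2
    have hc2 : m ^ d - 1 ≤ I.card := by
      have := Finset.card_filter_add_card_filter_not (s := box m z)
        (fun c => grown m L s n c ω = ∅)
      rw [card_box] at this
      have h3 : I.card = ((box m z).filter fun c => ¬ grown m L s n c ω = ∅).card := rfl
      omega
    calc s * (m ^ d - 1) ^ (n + 1) = (m ^ d - 1) * (s * (m ^ d - 1) ^ n) := by ring
      _ ≤ I.card * (s * (m ^ d - 1) ^ n) := Nat.mul_le_mul_right _ hc2
      _ = ∑ c ∈ I, s * (m ^ d - 1) ^ n := by simp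
      _ ≤ ∑ c ∈ I, (grown m L s n c ω).card :=
        Finset.sum_le_sum fun c hc => ih c (Finset.mem_filter.1 hc).2
      _ ≤ _ := Finset.sum_le_sum_of_subset (Finset.filter_subset _ _)

variable {μ : Measure (Config d)} {p : Sym2 (V d) → ℝ} {b σ : ℝ}

theorem Lower.exp_le (hl : Lower p b σ) {M : ℕ} (hM : 1 ≤ M) {z : V d} {x y : V d}
    (hx : x ∈ box M z) (hy : y ∈ box M z) (hxy : x ≠ y) :
    1 - p s(x, y) ≤ Real.exp (-(b * (M : ℝ) ^ (-σ))) :=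
  hl M hM x y hxy fun i => by exact_mod_cast abs_sub_le_of_mem_box hx hy i

theorem IsPerc.measure_grown_succ_empty_le (h : IsPerc μ p) (hl : Lower p b σ) (hb : 0 ≤ b)
    (hm : 1 ≤ m) (hL : 1 ≤ L) (hN : 3 ≤ m ^ d) (n : ℕ) (z : V d) {q : ℝ}
    (hq0 : 0 ≤ q) (hq : ∀ c, μ {ω | grown m L s n c ω = ∅} ≤ ENNReal.ofReal q) :
    μ {ω | grown m L s (n + 1) z ω = ∅} ≤ ENNReal.ofReal (((m : ℝ) ^ d) ^ 2 * (q ^ 2 +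
      Real.exp (-(b * ((m ^ (n + 1) * L : ℕ) : ℝ) ^ (-σ) *
        (((s * (m ^ d - 1) ^ n : ℕ) : ℝ) * ((s * (m ^ d - 1) ^ n : ℕ) : ℝ)))))) := by
  set t := s * (m ^ d - 1) ^ n with ht
  set g := b * ((m ^ (n + 1) * L : ℕ) : ℝ) ^ (-σ) with hg
  have hg0 : 0 ≤ g := mul_nonneg hb (Real.rpow_nonneg (Nat.cast_nonneg _) _)
  let X := fun c : V d => grown m L s n c
  let P := ((box m z) ×ˢ (box m z)).filter fun q => q.1 ≠ q.2
  have hsub : {ω | grown m L s (n + 1) z ω = ∅} ⊆ ⋃ q ∈ P,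
      ({ω | X q.1 ω = ∅} ∩ {ω | X q.2 ω = ∅}) ∪
        {ω | t ≤ (X q.1 ω).card ∧ t ≤ (X q.2 ω).card ∧ ω ∈ Sep (X q.1 ω) (X q.2 ω)} := by
    intro ω hω
    by_contra hcon
    simp only [Set.mem_iUnion, not_exists, P, Finset.mem_filter, Finset.mem_product] at hcon
    have hgood : Good m z (fun c => grown m L s n c ω) ω := by
      refine ⟨fun c hc c' hc' h1 h2 => ?_, fun c hc c' hc' hcc h1 h2 h3 => ?_⟩
      · by_contra hcc
        exact hcon (c, c') ⟨⟨hc, hc'⟩, hcc⟩ (Or.inl ⟨h1, h2⟩)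
      · exact hcon (c, c') ⟨⟨hc, hc'⟩, hcc⟩
          (Or.inr ⟨card_grown n c ω h1, card_grown n c' ω h2, h3⟩)
    have hω' : grown m L s (n + 1) z ω = ∅ := hω
    rw [grown, if_pos hgood] at hω'
    replace hω' : ∀ c ∈ box m z, grown m L s n c ω = ∅ := fun c hc =>
      Finset.subset_empty.1 (hω' ▸ Finset.subset_biUnion_of_mem (fun c => grown m L s n c ω) hc)
    have hcard : (box m z).card ≤ 1 := Finset.card_le_one.2 fun a ha b hb =>
      hgood.1 a ha b hb (hω' a ha) (hω' b hb)
    rw [card_box] at hcard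
    omega
  have hXm : ∀ c, MeasurableSet {ω | X c ω = ∅} := fun c =>
    measurableSet_of_dependsOn (dependsOn_eq (dependsOn_grown n c) ∅)
  have hP : P.card ≤ (m ^ d) ^ 2 := by
    refine (Finset.card_filter_le _ _).trans ?_
    rw [Finset.card_product, card_box, sq]
  calc _ ≤ μ (⋃ q ∈ P, ({ω | X q.1 ω = ∅} ∩ {ω | X q.2 ω = ∅}) ∪
        {ω | t ≤ (X q.1 ω).card ∧ t ≤ (X q.2 ω).card ∧ ω ∈ Sep (X q.1 ω) (X q.2 ω)}) :=
        MeasureTheory.measure_mono hsub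
    _ ≤ ∑ q ∈ P, μ (({ω | X q.1 ω = ∅} ∩ {ω | X q.2 ω = ∅}) ∪
        {ω | t ≤ (X q.1 ω).card ∧ t ≤ (X q.2 ω).card ∧ ω ∈ Sep (X q.1 ω) (X q.2 ω)}) :=
        measure_biUnion_finset_le _ _
    _ ≤ ∑ _q ∈ P, ENNReal.ofReal (q ^ 2 + Real.exp (-(g * (t * t)))) := by
        refine Finset.sum_le_sum fun c hc => (measure_union_le _ _).trans ?_
        simp only [P, Finset.mem_filter, Finset.mem_product] at hc
        have hd := disjoint_box (L := m ^ n * L) hc.2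
        rw [ENNReal.ofReal_add (sq_nonneg q) (Real.exp_nonneg _)]
        refine add_le_add ?_ ?_
        · rw [h.indep (disjoint_sym2 hd) (hXm _) (hXm _)
            (dependsOn_eq (dependsOn_grown n _) ∅) (dependsOn_eq (dependsOn_grown n _) ∅), sq,
            ENNReal.ofReal_mul hq0]
          exact mul_le_mul' (hq _) (hq _)
        · refine h.measure_unmerged_le hd (dependsOn_grown n _) (dependsOn_grown n _)
            (grown_subset n _) (grown_subset n _) hg0 (fun x hx y hy => ?_) t t
          have h1 := box_subset_box (L := m ^ n * L) hc.1.1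
          have h2 := box_subset_box (L := m ^ n * L) hc.1.2
          rw [← mul_assoc, ← pow_succ'] at h1 h2
          exact hl.exp_le (Nat.mul_pos (Nat.pow_pos hm) hL) (h1 hx) (h2 hy)
            fun hxy => Finset.disjoint_left.1 hd hx (hxy ▸ hy)
    _ = P.card * ENNReal.ofReal (q ^ 2 + Real.exp (-(g * (t * t)))) := by
        rw [Finset.sum_const, nsmul_eq_mul]
    _ ≤ ENNReal.ofReal ((((m : ℝ) ^ d)) ^ 2) * ENNReal.ofReal (q ^ 2 + Real.exp (-(g * (t * t)))) := by
        refine mul_le_mul_left ?_ _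
        rw [← ENNReal.ofReal_natCast]
        exact ENNReal.ofReal_le_ofReal (by exact_mod_cast hP)
    _ = _ := by rw [← ENNReal.ofReal_mul (by positivity)]

theorem exp_neg_le_inv {x : ℝ} (hx : 0 < x) : Real.exp (-x) ≤ 1 / x := by
  rw [Real.exp_neg, ← one_div]
  exact one_div_le_one_div_of_le hx (by linarith [Real.add_one_le_exp x])

theorem growth_exponent_le (hb : 0 ≤ b) (hm : 1 ≤ m)
    (hγ : 2 * (m : ℝ) ^ σ ≤ ((m : ℝ) ^ d - 1) ^ 2) (n : ℕ) :
    b * (s : ℝ) ^ 2 * ((m * L : ℕ) : ℝ) ^ (-σ) * 2 ^ n ≤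
      b * ((m ^ (n + 1) * L : ℕ) : ℝ) ^ (-σ) *
        (((s * (m ^ d - 1) ^ n : ℕ) : ℝ) * ((s * (m ^ d - 1) ^ n : ℕ) : ℝ)) := by
  have hm0 : (0 : ℝ) < m := by exact_mod_cast hm
  have hcast : ((m ^ d - 1 : ℕ) : ℝ) = (m : ℝ) ^ d - 1 := by
    rw [Nat.cast_sub (Nat.one_le_pow _ _ hm)]
    simp
  have h1 : ((m ^ (n + 1) * L : ℕ) : ℝ) ^ (-σ) =
      ((m * L : ℕ) : ℝ) ^ (-σ) * ((m : ℝ) ^ (-σ)) ^ n := by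
    push_cast
    rw [show (m : ℝ) ^ (n + 1) * L = (m * L) * (m : ℝ) ^ n by ring,
      Real.mul_rpow (by positivity) (by positivity), ← Real.rpow_natCast, ← Real.rpow_natCast,
      ← Real.rpow_mul hm0.le, ← Real.rpow_mul hm0.le, mul_comm (n : ℝ)]
  have h2 : (2 : ℝ) ^ n ≤ ((m : ℝ) ^ (-σ)) ^ n * (((m : ℝ) ^ d - 1) ^ n) ^ 2 := by
    rw [← pow_mul, mul_comm n 2, pow_mul, ← mul_pow]
    refine pow_le_pow_left₀ (by norm_num) ?_ n
    rw [Real.rpow_neg hm0.le, inv_mul_eq_div, le_div_iff₀ (Real.rpow_pos_of_pos hm0 _)]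
    exact hγ
  rw [h1]
  push_cast
  rw [hcast]
  have h3 : 0 ≤ b * (s : ℝ) ^ 2 * ((m * L : ℕ) : ℝ) ^ (-σ) := by positivity
  push_cast at h3
  calc _ ≤ b * (s : ℝ) ^ 2 * ((m : ℝ) * L) ^ (-σ) *
        (((m : ℝ) ^ (-σ)) ^ n * (((m : ℝ) ^ d - 1) ^ n) ^ 2) := mul_le_mul_of_nonneg_left h2 h3
    _ = _ := by ring

theorem IsPerc.measure_grown_empty_le (h : IsPerc μ p) (hl : Lower p b σ) (hb : 0 ≤ b)
    (hm : 1 ≤ m) (hL : 1 ≤ L) (hs : 1 ≤ s) (hN : 3 ≤ m ^ d)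
    (hγ : 2 * (m : ℝ) ^ σ ≤ ((m : ℝ) ^ d - 1) ^ 2)
    (hT : 16 * ((m : ℝ) ^ d) ^ 4 ≤ b * (s : ℝ) ^ 2 * ((m * L : ℕ) : ℝ) ^ (-σ))
    (hseed : ∀ z, μ {ω | ¬ Seed L s z ω} ≤ ENNReal.ofReal (1 / (4 * ((m : ℝ) ^ d) ^ 2)))
    (n : ℕ) (z : V d) :
    μ {ω | grown m L s n z ω = ∅} ≤
      ENNReal.ofReal (1 / (4 * ((m : ℝ) ^ d) ^ 2) * (1 / 2) ^ n) := by
  set N := (m : ℝ) ^ d with hNdef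
  have hN0 : 0 < N := by
    rw [hNdef]
    have : (0 : ℝ) < m := by exact_mod_cast hm
    positivity
  induction n generalizing z with
  | zero =>
    refine le_trans (MeasureTheory.measure_mono ?_) ((hseed z).trans (by simp))
    intro ω hω hsd
    have h1 : grown m L s 0 z ω = ∅ := hω
    have h2 := hsd.exists_finset
    rw [grown, seedSet, dif_pos h2] at h1
    have := h2.choose_spec.2.1
    rw [h1, Finset.card_empty] at this
    omega
  | succ n ih =>
    refine (h.measure_grown_succ_empty_le hl hb hm hL hN n z (by positivity) ih).trans ?_
    refine ENNReal.ofReal_le_ofReal ?_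
    have h1 := growth_exponent_le (s := s) (L := L) hb hm hγ n
    have h2 : 16 * N ^ 4 * 2 ^ n ≤ b * (s : ℝ) ^ 2 * ((m * L : ℕ) : ℝ) ^ (-σ) * 2 ^ n := by
      gcongr
    have h3 := (Real.exp_le_exp.2 (neg_le_neg (h2.trans h1))).trans'
      (le_refl _)
    have h4 := h3.trans (exp_neg_le_inv (x := 16 * N ^ 4 * 2 ^ n) (by positivity))
    have h5 : ((1 : ℝ) / 2) ^ n ≤ 1 := pow_le_one₀ (by norm_num) (by norm_num)
    have h6 : ((1 : ℝ) / 2) ^ n = 1 / 2 ^ n := by rw [div_pow, one_pow]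
    calc _ ≤ N ^ 2 * ((1 / (4 * N ^ 2) * (1 / 2) ^ n) ^ 2 + 1 / (16 * N ^ 4 * 2 ^ n)) := by
          gcongr
      _ = 1 / (16 * N ^ 2) * (1 / 2) ^ n * (1 / 2) ^ n + 1 / (16 * N ^ 2) * (1 / 2) ^ n := by
          rw [h6]
          field_simp
          ring
      _ ≤ 1 / (16 * N ^ 2) * (1 / 2) ^ n * 1 + 1 / (16 * N ^ 2) * (1 / 2) ^ n := by
          gcongr
      _ = _ := by
          rw [pow_succ (1 / 2 : ℝ) n]
          field_simp
          norm_num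

/-- If large clusters are likely at some scale then there is an infinite cluster. -/
theorem IsPerc.percolates_of_seed (h : IsPerc μ p) (hl : Lower p b σ) (hb : 0 ≤ b)
    (hm : 1 ≤ m) (hL : 1 ≤ L) (hs : 1 ≤ s) (hN : 3 ≤ m ^ d)
    (hγ : 2 * (m : ℝ) ^ σ ≤ ((m : ℝ) ^ d - 1) ^ 2)
    (hT : 16 * ((m : ℝ) ^ d) ^ 4 ≤ b * (s : ℝ) ^ 2 * ((m * L : ℕ) : ℝ) ^ (-σ))
    (hseed : ∀ z, μ {ω | ¬ Seed L s z ω} ≤ ENNReal.ofReal (1 / (4 * ((m : ℝ) ^ d) ^ 2))) :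
    0 < μ {ω | ∃ x : V d, (cluster ω x).Infinite} := by
  have := h.1
  rw [pos_iff_ne_zero]
  intro h0
  have hcov : (Set.univ : Set (Config d)) ⊆
      {ω | ∃ x : V d, (cluster ω x).Infinite} ∪ ⋃ n, {ω | grown m L s n 0 ω = ∅} := by
    intro ω _
    by_cases hω : ∃ n, grown m L s n 0 ω = ∅
    · exact Or.inr (Set.mem_iUnion.2 hω)
    · left
      push Not at hω
      have hz : (0 : V d) ∈ box m 0 := by
        rw [mem_box]
        intro i
        simp
        omega
      have hmono : Monotone fun n => grown m L s n 0 ω := monotone_nat_of_le_succ fun n => by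
        rw [(grown_succ_of_ne_empty (Finset.nonempty_iff_ne_empty.1 (hω (n + 1)))).2]
        exact Finset.subset_biUnion_of_mem (fun c => grown m L s n c ω) hz
      obtain ⟨x, hx⟩ := hω 0
      refine ⟨x, fun hfin => ?_⟩
      have hbd : ∀ n, 2 ^ n ≤ (cluster ω x).ncard := fun n => by
        have h1 := card_grown n 0 ω (Finset.nonempty_iff_ne_empty.1 (hω n))
        have h2 : ((grown m L s n 0 ω : Finset (V d)) : Set (V d)) ⊆ cluster ω x := fun y hy =>
          conn_grown n 0 ω x (hmono (Nat.zero_le n) hx) y hy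
        have h3 := Set.ncard_le_ncard h2 hfin
        rw [Set.ncard_coe_finset] at h3
        calc 2 ^ n ≤ (m ^ d - 1) ^ n := Nat.pow_le_pow_left (by omega) n
          _ ≤ s * (m ^ d - 1) ^ n := Nat.le_mul_of_pos_left _ hs
          _ ≤ _ := h1.trans h3
      exact absurd (hbd (cluster ω x).ncard) (not_le.2 Nat.lt_two_pow_self)
  have h1 : (1 : ℝ≥0∞) ≤ ∑' n, ENNReal.ofReal (1 / (4 * ((m : ℝ) ^ d) ^ 2) * (1 / 2) ^ n) := by
    calc (1 : ℝ≥0∞) = μ Set.univ := measure_univ.symm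
      _ ≤ _ := MeasureTheory.measure_mono hcov
      _ ≤ _ := measure_union_le _ _
      _ ≤ 0 + ∑' n, μ {ω | grown m L s n 0 ω = ∅} := add_le_add h0.le (measure_iUnion_le _)
      _ ≤ _ := by
        rw [zero_add]
        exact ENNReal.tsum_le_tsum fun n =>
          h.measure_grown_empty_le hl hb hm hL hs hN hγ hT hseed n 0
  have hN' : (3 : ℝ) ≤ (m : ℝ) ^ d := by exact_mod_cast hN
  have hsum : Summable fun n : ℕ => 1 / (4 * ((m : ℝ) ^ d) ^ 2) * ((1 : ℝ) / 2) ^ n :=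
    summable_geometric_two.mul_left _
  rw [← ENNReal.ofReal_tsum_of_nonneg (fun n => by positivity) hsum, tsum_mul_left,
    tsum_geometric_two, ENNReal.one_le_ofReal, div_mul_eq_mul_div, le_div_iff₀ (by positivity)] at h1
  nlinarith

end Growth

/-! ## Clusters inside a finite region -/

section Restricted

variable {Vt : Type*}

/-- Connection by a path of open edges inside `Λ`. -/
def ConnIn (Λ : Finset Vt) (ω : Sym2 Vt → Bool) (x y : Vt) : Prop :=
  Conn (cut (Λ.sym2 : Set (Sym2 Vt)) ω) x y

/-- The cluster of `x` inside `Λ`. -/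
noncomputable def clIn (Λ : Finset Vt) (x : Vt) (ω : Sym2 Vt → Bool) : Finset Vt :=
  Λ.filter fun y => ConnIn Λ ω x y

theorem clIn_subset (Λ : Finset Vt) (x : Vt) (ω : Sym2 Vt → Bool) : clIn Λ x ω ⊆ Λ :=
  Finset.filter_subset _ _

theorem mem_clIn {Λ : Finset Vt} {x y : Vt} {ω : Sym2 Vt → Bool} (hx : x ∈ Λ) :
    y ∈ clIn Λ x ω ↔ ConnIn Λ ω x y := by
  rw [clIn, Finset.mem_filter, and_iff_right_iff_imp]
  exact fun h => h.mem_of_cut hx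

theorem dependsOn_connIn (Λ : Finset Vt) (x y : Vt) :
    DependsOn (fun ω => ω ∈ {ω | ConnIn Λ ω x y}) (Λ.sym2 : Set (Sym2 Vt)) :=
  dependsOn_cut _ fun ω => Conn ω x y

theorem dependsOn_clIn (Λ : Finset Vt) (x : Vt) :
    DependsOn (clIn Λ x) (Λ.sym2 : Set (Sym2 Vt)) :=
  dependsOn_cut _ fun ω => Λ.filter fun y => Conn ω x y

theorem ConnIn.mono {Λ Λ' : Finset Vt} (h : Λ ⊆ Λ') {ω : Sym2 Vt → Bool} {x y : Vt}
    (hc : ConnIn Λ ω x y) : ConnIn Λ' ω x y :=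
  Conn.mono (cut_mono (Finset.coe_subset.2 (Finset.sym2_mono h)) ω) hc

theorem ConnIn.of_open {Λ : Finset Vt} {ω : Sym2 Vt → Bool} {x y : Vt} (hx : x ∈ Λ) (hy : y ∈ Λ)
    (h : ω s(x, y) = true) : ConnIn Λ ω x y :=
  Conn.of_open (cut_eq_true.2 ⟨by simp [hx, hy], h⟩)

theorem big_iff {Λ : Finset Vt} {x : Vt} (hx : x ∈ Λ) {ω : Sym2 Vt → Bool} {n : ℕ} :
    Big (cut (Λ.sym2 : Set (Sym2 Vt)) ω) x n ↔ n ≤ (clIn Λ x ω).card := by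
  constructor
  · rintro ⟨S, hS, hc⟩
    exact hS.trans (Finset.card_le_card fun y hy => (mem_clIn hx).2 (hc y hy))
  · exact fun h => ⟨_, h, fun y hy => (mem_clIn hx).1 hy⟩

variable {μ : Measure (Sym2 Vt → Bool)} {p : Sym2 Vt → ℝ}

theorem measurableSet_clIn_eq (Λ : Finset Vt) (x : Vt) (A : Finset Vt) :
    MeasurableSet {ω | clIn Λ x ω = A} :=
  measurableSet_of_dependsOn (dependsOn_eq (dependsOn_clIn Λ x) A)

theorem measureReal_clIn [IsFiniteMeasure μ] (Λ : Finset Vt) (x : Vt) (Q : Finset Vt → Prop)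
    [DecidablePred Q] :
    μ.real {ω | Q (clIn Λ x ω)} =
      ∑ A ∈ Λ.powerset, (if Q A then 1 else 0) * μ.real {ω | clIn Λ x ω = A} := by
  have : {ω : Sym2 Vt → Bool | Q (clIn Λ x ω)} =
      ⋃ A ∈ Λ.powerset.filter Q, {ω | clIn Λ x ω = A} := by
    ext ω
    simp [clIn_subset]
  rw [this, measureReal_biUnion_finset]
  · simp [Finset.sum_filter]
  · intro A _ B _ hAB
    refine Set.disjoint_left.2 ?_
    rintro ω rfl h2
    exact hAB h2
  · exact fun A _ => measurableSet_clIn_eq Λ x A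

/-- The expected size of the cluster of `x` in `Λ`. -/
noncomputable def meanIn (μ : Measure (Sym2 Vt → Bool)) (Λ : Finset Vt) (x : Vt) : ℝ :=
  ∑ y ∈ Λ, μ.real {ω | ConnIn Λ ω x y}

/-- The truncated expected size of the cluster of `x` in `Λ`. -/
noncomputable def truncIn (μ : Measure (Sym2 Vt → Bool)) (Λ : Finset Vt) (M : ℕ) (x : Vt) : ℝ :=
  ∑ A ∈ Λ.powerset.filter fun A => A.card < M, A.card * μ.real {ω | clIn Λ x ω = A}

theorem meanIn_nonneg (μ : Measure (Sym2 Vt → Bool)) (Λ : Finset Vt) (x : Vt) :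
    0 ≤ meanIn μ Λ x := Finset.sum_nonneg fun _ _ => measureReal_nonneg

theorem truncIn_nonneg (μ : Measure (Sym2 Vt → Bool)) (Λ : Finset Vt) (M : ℕ) (x : Vt) :
    0 ≤ truncIn μ Λ M x :=
  Finset.sum_nonneg fun _ _ => mul_nonneg (Nat.cast_nonneg _) measureReal_nonneg

theorem meanIn_eq [IsFiniteMeasure μ] {Λ : Finset Vt} {x : Vt} (hx : x ∈ Λ) :
    meanIn μ Λ x = ∑ A ∈ Λ.powerset, A.card * μ.real {ω | clIn Λ x ω = A} := by
  have h1 : ∀ y ∈ Λ, μ.real {ω | ConnIn Λ ω x y} =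
      ∑ A ∈ Λ.powerset, (if y ∈ A then 1 else 0) * μ.real {ω | clIn Λ x ω = A} := fun y _ => by
    rw [← measureReal_clIn Λ x fun A => y ∈ A]
    congr 1
    ext ω
    exact (mem_clIn hx).symm
  rw [meanIn, Finset.sum_congr rfl h1, Finset.sum_comm]
  refine Finset.sum_congr rfl fun A hA => ?_
  rw [← Finset.sum_mul]
  congr 1
  rw [Finset.sum_ite_mem, Finset.inter_eq_right.2 (Finset.mem_powerset.1 hA)]
  simp

theorem mul_indicator_le (B M a : ℕ) (haB : a ≤ B) (h : 3 * M ≤ a) :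
    a ≤ 3 * (M + ((Finset.Icc M B).filter fun n => 3 * n ≤ a).card) := by
  have h1 : Finset.Icc M (a / 3) ⊆ (Finset.Icc M B).filter fun n => 3 * n ≤ a := by
    intro n hn
    simp only [Finset.mem_filter, Finset.mem_Icc] at hn ⊢
    omega
  have h2 := Finset.card_le_card h1
  rw [Nat.card_Icc] at h2
  omega

/-- If large clusters are unlikely, they do not contribute much to the mean cluster size. -/
theorem IsPerc.meanIn_le (h : IsPerc μ p) (hp : ∀ e, 0 ≤ p e ∧ p e ≤ 1) {Λ : Finset Vt} {x : Vt}
    (hx : x ∈ Λ) {M : ℕ} (hM : 1 ≤ M)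
    (hQ : μ.real {ω | ∃ z ∈ Λ, Big (cut (Λ.sym2 : Set (Sym2 Vt)) ω) z M} ≤ 1 / 12) :
    meanIn μ Λ x ≤ 2 * truncIn μ Λ (3 * M) x := by
  have := h.1
  set w : Finset Vt → ℝ := fun A => μ.real {ω | clIn Λ x ω = A} with hw
  have hw0 : ∀ A, 0 ≤ w A := fun A => measureReal_nonneg
  set t : ℕ → ℝ := fun n => μ.real {ω | n ≤ (clIn Λ x ω).card} with ht
  have htw : ∀ n, t n = ∑ A ∈ Λ.powerset, (if n ≤ A.card then 1 else 0) * w A := fun n =>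
    measureReal_clIn Λ x fun A => n ≤ A.card
  have ht3 : ∀ n, M ≤ n → t (3 * n) ≤ 1 / 12 * t n := fun n hn => by
    have h1 := h.big_three_mul_le hp hx (hM.trans hn)
    simp only [big_iff hx] at h1
    have h2 := ENNReal.toReal_mono (by finiteness) h1
    rw [ENNReal.toReal_mul] at h2
    refine h2.trans ?_
    rw [mul_comm]
    refine mul_le_mul_of_nonneg_right ((measureReal_mono ?_).trans hQ) measureReal_nonneg
    rintro ω ⟨z, hz, hb⟩
    exact ⟨z, hz, hb.mono le_rfl hn⟩
  have hsplit : meanIn μ Λ x = truncIn μ Λ (3 * M) x +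
      ∑ A ∈ Λ.powerset.filter (fun A => ¬ A.card < 3 * M), A.card * w A := by
    rw [meanIn_eq hx, truncIn, Finset.sum_filter_add_sum_filter_not]
  have hbig : ∑ A ∈ Λ.powerset.filter (fun A => ¬ A.card < 3 * M), A.card * w A ≤
      3 * (M * t (3 * M) + ∑ n ∈ Finset.Icc M Λ.card, t (3 * n)) := by
    simp only [htw]
    rw [Finset.sum_comm, Finset.mul_sum, ← Finset.sum_add_distrib, Finset.mul_sum,
      Finset.sum_filter]
    refine Finset.sum_le_sum fun A hA => ?_
    rw [← Finset.sum_mul]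
    split_ifs with h1 h2 h2
    · omega
    · have h3 : 0 ≤ ∑ n ∈ Finset.Icc M Λ.card, (if 3 * n ≤ A.card then (1 : ℝ) else 0) :=
        Finset.sum_nonneg fun _ _ => by split_ifs <;> norm_num
      have := mul_nonneg h3 (hw0 A)
      simp only [zero_mul, mul_zero, zero_add]
      linarith
    · have h3 := mul_indicator_le Λ.card M A.card
        (Finset.card_le_card (Finset.mem_powerset.1 hA)) h2
      have h4 : (A.card : ℝ) ≤ 3 * (M + ∑ n ∈ Finset.Icc M Λ.card,
          (if 3 * n ≤ A.card then (1 : ℝ) else 0)) := by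
        rw [Finset.sum_boole]
        exact_mod_cast h3
      calc _ ≤ 3 * (M + ∑ n ∈ Finset.Icc M Λ.card,
          (if 3 * n ≤ A.card then (1 : ℝ) else 0)) * w A := mul_le_mul_of_nonneg_right h4 (hw0 A)
        _ = _ := by ring
    · omega
  have hsmall : M * t M + ∑ n ∈ Finset.Icc M Λ.card, t n ≤ 2 * meanIn μ Λ x := by
    rw [meanIn_eq hx]
    simp only [htw]
    rw [Finset.sum_comm, Finset.mul_sum, ← Finset.sum_add_distrib, Finset.mul_sum]
    refine Finset.sum_le_sum fun A _ => ?_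
    rw [← Finset.sum_mul, Finset.sum_boole]
    have h1 : (M : ℝ) * (if M ≤ A.card then 1 else 0) +
        ((Finset.Icc M Λ.card).filter fun n => n ≤ A.card).card ≤ 2 * A.card := by
      have h2 : ((Finset.Icc M Λ.card).filter fun n => n ≤ A.card).card ≤ A.card + 1 - M := by
        rw [← Nat.card_Icc]
        refine Finset.card_le_card fun n hn => ?_
        simp only [Finset.mem_filter, Finset.mem_Icc] at hn ⊢
        omega
      split_ifs with h3
      · have : M + ((Finset.Icc M Λ.card).filter fun n => n ≤ A.card).card ≤ 2 * A.card := by omega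
        rw [mul_one]
        exact_mod_cast this
      · have : ((Finset.Icc M Λ.card).filter fun n => n ≤ A.card).card ≤ 2 * A.card := by omega
        rw [mul_zero, zero_add]
        exact_mod_cast this
    calc _ = ((M : ℝ) * (if M ≤ A.card then 1 else 0) +
        ((Finset.Icc M Λ.card).filter fun n => n ≤ A.card).card) * w A := by ring
      _ ≤ 2 * A.card * w A := mul_le_mul_of_nonneg_right h1 (hw0 A)
      _ = _ := by ring
  have h3 : M * t (3 * M) + ∑ n ∈ Finset.Icc M Λ.card, t (3 * n) ≤
      1 / 12 * (M * t M + ∑ n ∈ Finset.Icc M Λ.card, t n) := by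
    rw [mul_add, Finset.mul_sum]
    refine add_le_add ?_ (Finset.sum_le_sum fun n hn => ht3 n (Finset.mem_Icc.1 hn).1)
    calc (M : ℝ) * t (3 * M) ≤ M * (1 / 12 * t M) :=
          mul_le_mul_of_nonneg_left (ht3 M le_rfl) (Nat.cast_nonneg _)
      _ = _ := by ring
  linarith

theorem mul_exp_le_one_sub_exp {t T : ℝ} (ht : 0 ≤ t) (hT : t ≤ T) :
    t * Real.exp (-T) ≤ 1 - Real.exp (-t) := by
  have h1 : Real.exp (-T) ≤ Real.exp (-t) := Real.exp_le_exp.2 (by linarith)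
  have h2 := Real.add_one_le_exp t
  have h3 : Real.exp t * Real.exp (-t) = 1 := by rw [← Real.exp_add]; simp
  nlinarith [Real.exp_pos (-t)]

/-- Lower bound on the connection probability of two points in disjoint regions. -/
theorem IsPerc.mul_truncIn_le (h : IsPerc μ p) {Λ Λ₁ Λ₂ : Finset Vt} (hd : Disjoint Λ₁ Λ₂)
    (h₁ : Λ₁ ⊆ Λ) (h₂ : Λ₂ ⊆ Λ) {g T : ℝ} (hg0 : 0 ≤ g)
    (hg : ∀ a ∈ Λ₁, ∀ b ∈ Λ₂, 1 - p s(a, b) ≤ Real.exp (-g)) {M : ℕ}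
    (hT : g * ((M : ℝ) * M) ≤ T) {x y : Vt} (hx : x ∈ Λ₁) (hy : y ∈ Λ₂) :
    g * Real.exp (-T) * (truncIn μ Λ₁ M x * truncIn μ Λ₂ M y) ≤
      μ.real {ω | ConnIn Λ ω x y} := by
  have := h.1
  set I := (Λ₁.powerset.filter fun A => A.card < M) ×ˢ (Λ₂.powerset.filter fun A => A.card < M)
  let E : Finset Vt × Finset Vt → Set (Sym2 Vt → Bool) := fun q =>
    {ω | clIn Λ₁ x ω = q.1} ∩ {ω | clIn Λ₂ y ω = q.2}
  have hE : ∀ q, MeasurableSet (E q) := fun q =>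
    (measurableSet_clIn_eq _ _ _).inter (measurableSet_clIn_eq _ _ _)
  have hsub : (⋃ q ∈ I, E q ∩ (Sep q.1 q.2)ᶜ) ⊆ {ω | ConnIn Λ ω x y} := by
    intro ω hω
    simp only [Set.mem_iUnion] at hω
    obtain ⟨⟨A, B⟩, -, ⟨h1, h2⟩, h3⟩ := hω
    simp only [Set.mem_ofPred_eq] at h1 h2
    have : ∃ a ∈ A, ∃ b ∈ B, ω s(a, b) = true := by
      by_contra! hcon
      refine h3 fun e he => ?_
      obtain ⟨a, ha, b, hb, rfl⟩ := mem_between.1 he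
      simpa using hcon a ha b hb
    obtain ⟨a, ha, b, hb, hab⟩ := this
    rw [← h1] at ha
    rw [← h2] at hb
    exact (((mem_clIn hx).1 ha).mono h₁).trans
      ((ConnIn.of_open (h₁ (clIn_subset _ _ _ ha)) (h₂ (clIn_subset _ _ _ hb)) hab).trans
        (((mem_clIn hy).1 hb).mono h₂).symm)
  have hterm : ∀ q ∈ I, g * Real.exp (-T) * ((q.1.card * μ.real {ω | clIn Λ₁ x ω = q.1}) *
      (q.2.card * μ.real {ω | clIn Λ₂ y ω = q.2})) ≤ μ.real (E q ∩ (Sep q.1 q.2)ᶜ) := by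
    rintro ⟨A, B⟩ hq
    simp only [I, Finset.mem_product, Finset.mem_filter, Finset.mem_powerset] at hq
    obtain ⟨⟨hA, hAM⟩, hB, hBM⟩ := hq
    have e1 : μ.real (E (A, B) ∩ (Sep A B)ᶜ) = μ.real (E (A, B)) * μ.real (Sep A B)ᶜ := by
      rw [Measure.real, h.indep (disjoint_between hd hA hB) (hE _) (measurableSet_sep _ _).compl
        ?_ ?_, ENNReal.toReal_mul]
      · rfl
      · intro ω ω' hω
        simp only [E, Set.mem_inter_iff, Set.mem_ofPred_eq]
        rw [dependsOn_clIn Λ₁ x fun e he => hω e (by simpa using Or.inl he),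
          dependsOn_clIn Λ₂ y fun e he => hω e (by simpa using Or.inr he)]
      · intro ω ω' hω
        have := dependsOn_sep A B hω
        simp only [Set.mem_compl_iff]
        exact congrArg Not this
    have e2 : μ.real (E (A, B)) = μ.real {ω | clIn Λ₁ x ω = A} * μ.real {ω | clIn Λ₂ y ω = B} := by
      rw [Measure.real, h.indep (disjoint_sym2 hd) (measurableSet_clIn_eq _ _ _)
        (measurableSet_clIn_eq _ _ _) (dependsOn_eq (dependsOn_clIn _ _) _)
        (dependsOn_eq (dependsOn_clIn _ _) _), ENNReal.toReal_mul]
      rfl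
    have e3 : g * (A.card * B.card) * Real.exp (-T) ≤ μ.real (Sep A B)ᶜ := by
      rw [probReal_compl_eq_one_sub (measurableSet_sep _ _)]
      have h1 := ENNReal.toReal_mono (by finiteness) (h.measure_sep_le (hd.mono hA hB)
        fun a ha b hb => hg a (hA ha) b (hB hb))
      rw [ENNReal.toReal_ofReal (Real.exp_nonneg _)] at h1
      have h2 : g * ((A.card : ℝ) * B.card) ≤ T := le_trans (by gcongr) hT
      have h3 := mul_exp_le_one_sub_exp (by positivity) h2
      have h4 : μ.real (Sep A B) ≤ Real.exp (-(g * (A.card * B.card))) := h1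
      linarith
    show _ ≤ μ.real (E (A, B) ∩ (Sep A B)ᶜ)
    rw [e1, e2]
    calc _ = (μ.real {ω | clIn Λ₁ x ω = A} * μ.real {ω | clIn Λ₂ y ω = B}) *
          (g * (A.card * B.card) * Real.exp (-T)) := by ring
      _ ≤ _ := mul_le_mul_of_nonneg_left e3 (mul_nonneg measureReal_nonneg measureReal_nonneg)
  calc _ = ∑ q ∈ I, g * Real.exp (-T) * ((q.1.card * μ.real {ω | clIn Λ₁ x ω = q.1}) *
      (q.2.card * μ.real {ω | clIn Λ₂ y ω = q.2})) := by
        rw [truncIn, truncIn, Finset.sum_mul_sum, ← Finset.sum_product', Finset.mul_sum]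
    _ ≤ ∑ q ∈ I, μ.real (E q ∩ (Sep q.1 q.2)ᶜ) := Finset.sum_le_sum hterm
    _ = μ.real (⋃ q ∈ I, E q ∩ (Sep q.1 q.2)ᶜ) := by
        rw [measureReal_biUnion_finset]
        · rintro q - q' - hne
          refine Set.disjoint_left.2 ?_
          rintro ω ⟨⟨h1, h2⟩, -⟩ ⟨⟨h3, h4⟩, -⟩
          exact hne (Prod.ext (h1.symm.trans h3) (h2.symm.trans h4))
        · exact fun q _ => (hE q).inter (measurableSet_sep _ _).compl
    _ ≤ _ := measureReal_mono hsub

end Restricted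

/-! ## Subcritical bounds -/

section Subcritical

variable {d : ℕ} {μ : Measure (Config d)} {p : Sym2 (V d) → ℝ}

theorem IsPerc.measure_shift (h : IsPerc μ p) (hp : ∀ e, 0 ≤ p e ∧ p e ≤ 1) (ht : TransInv p)
    (a : V d) {E : Set (Config d)} (hE : MeasurableSet E) : μ (shift a ⁻¹' E) = μ E := by
  rw [← Measure.map_apply (measurable_shift a) hE, h.map_shift hp ht a]

theorem connIn_shift {L : ℕ} {z a x y : V d} {ω : Config d} :
    ConnIn (box L z) (shift ((L : ℤ) • a) ω) x y ↔
      ConnIn (box L (z + a)) ω (x + (L : ℤ) • a) (y + (L : ℤ) • a) := by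
  rw [ConnIn, cut_shift, conn_shift, map_box, ConnIn]

theorem seed_shift {L s : ℕ} {z a : V d} {ω : Config d}
    (h : Seed L s z (shift ((L : ℤ) • a) ω)) : Seed L s (z + a) ω := by
  obtain ⟨x, hx, S, hS, hc⟩ := h
  refine ⟨x + (L : ℤ) • a, ?_, S.map (addRightEmbedding ((L : ℤ) • a)), by simpa using hS, ?_⟩
  · rw [← map_box]
    exact Finset.mem_map_of_mem _ hx
  · intro w hw
    obtain ⟨y, hy, rfl⟩ := Finset.mem_map.1 hw
    exact connIn_shift.1 (hc y hy)

theorem measurableSet_seed (L s : ℕ) (z : V d) : MeasurableSet {ω | Seed L s z ω} :=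
  measurableSet_of_dependsOn (dependsOn_seed L s z)

theorem dependsOn_not_seed (L s : ℕ) (z : V d) :
    DependsOn (fun ω => ω ∈ {ω | ¬ Seed L s z ω}) ((box L z).sym2 : Set (Sym2 (V d))) :=
  dependsOn_cut _ fun ω => ¬ ∃ x ∈ box L z, Big ω x s

theorem measurableSet_not_seed (L s : ℕ) (z : V d) : MeasurableSet {ω | ¬ Seed L s z ω} :=
  measurableSet_of_dependsOn (dependsOn_not_seed L s z)

theorem IsPerc.measure_not_seed (h : IsPerc μ p) (hp : ∀ e, 0 ≤ p e ∧ p e ≤ 1) (ht : TransInv p)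
    (L s : ℕ) (z : V d) : μ {ω | ¬ Seed L s z ω} = μ {ω | ¬ Seed L s 0 ω} := by
  have key : ∀ z a : V d, μ {ω | ¬ Seed L s (z + a) ω} ≤ μ {ω | ¬ Seed L s z ω} := fun z a => by
    rw [← h.measure_shift hp ht ((L : ℤ) • a) (measurableSet_not_seed L s z)]
    exact MeasureTheory.measure_mono fun ω hω hsd => hω (seed_shift hsd)
  refine le_antisymm ?_ ?_
  · simpa using key 0 z
  · simpa using key z (-z)

theorem Seed.mono {L m s : ℕ} {z c : V d} (hc : c ∈ box m z) {ω : Config d} (h : Seed L s c ω) :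
    Seed (m * L) s z ω := by
  obtain ⟨x, hx, hB⟩ := h
  exact ⟨x, box_subset_box hc hx, hB.mono (cut_mono (Finset.coe_subset.2
    (Finset.sym2_mono (box_subset_box hc))) ω) le_rfl⟩

theorem zero_mem_box {m : ℕ} (hm : 1 ≤ m) : (0 : V d) ∈ box m 0 := by
  rw [mem_box]
  intro i
  simp
  omega

theorem exists_ne_mem_box {m : ℕ} (hN : 3 ≤ m ^ d) : ∃ c ∈ box m (0 : V d), c ≠ 0 := by
  have : 1 < (box m (0 : V d)).card := by
    rw [card_box]
    omega
  exact Finset.exists_mem_ne this 0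

theorem IsPerc.measure_not_seed_mul_le (h : IsPerc μ p) (hp : ∀ e, 0 ≤ p e ∧ p e ≤ 1)
    (ht : TransInv p) {m : ℕ} (hm : 1 ≤ m) (hN : 3 ≤ m ^ d) (L s : ℕ) :
    μ {ω | ¬ Seed (m * L) s 0 ω} ≤ μ {ω | ¬ Seed L s 0 ω} ^ 2 := by
  obtain ⟨c, hc, hc0⟩ := exists_ne_mem_box hN
  calc _ ≤ μ ({ω | ¬ Seed L s 0 ω} ∩ {ω | ¬ Seed L s c ω}) := by
        refine MeasureTheory.measure_mono fun ω hω => ⟨fun hs => hω ?_, fun hs => hω ?_⟩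
        · exact hs.mono (zero_mem_box hm)
        · exact hs.mono hc
    _ = _ := by
        rw [h.indep (disjoint_sym2 (disjoint_box hc0.symm)) (measurableSet_not_seed _ _ _)
          (measurableSet_not_seed _ _ _) (dependsOn_not_seed _ _ _) (dependsOn_not_seed _ _ _),
          h.measure_not_seed hp ht L s c, sq]

theorem IsPerc.measure_not_seed_pow_le (h : IsPerc μ p) (hp : ∀ e, 0 ≤ p e ∧ p e ≤ 1)
    (ht : TransInv p) {m : ℕ} (hm : 1 ≤ m) (hN : 3 ≤ m ^ d) (L s j : ℕ) :
    μ {ω | ¬ Seed (m ^ j * L) s 0 ω} ≤ μ {ω | ¬ Seed L s 0 ω} ^ 2 ^ j := by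
  induction j with
  | zero => simp
  | succ j ih =>
    rw [pow_succ', mul_assoc, pow_succ, pow_mul]
    exact (h.measure_not_seed_mul_le hp ht hm hN _ s).trans (pow_le_pow_left₀ (zero_le) ih 2)

/-- In the absence of percolation, large clusters are unlikely. -/
theorem IsPerc.measure_seed_le (h : IsPerc μ p) (hp : ∀ e, 0 ≤ p e ∧ p e ≤ 1)
    (ht : TransInv p) {b σ : ℝ} (hl : Lower p b σ) (hb : 0 ≤ b)
    (hno : μ {ω | ∃ x : V d, (cluster ω x).Infinite} = 0) {m : ℕ} (hm : 1 ≤ m) (hN : 3 ≤ m ^ d)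
    (hγ : 2 * (m : ℝ) ^ σ ≤ ((m : ℝ) ^ d - 1) ^ 2) {j L s : ℕ} (hL : 1 ≤ L) (hs : 1 ≤ s)
    (hj : (11 / 12 : ℝ) ^ 2 ^ j ≤ 1 / (4 * ((m : ℝ) ^ d) ^ 2))
    (hT : 16 * ((m : ℝ) ^ d) ^ 4 ≤ b * (s : ℝ) ^ 2 * ((m * (m ^ j * L) : ℕ) : ℝ) ^ (-σ)) :
    μ.real {ω | Seed L s 0 ω} ≤ 1 / 12 := by
  have := h.1
  by_contra! hcon
  have h1 : μ {ω | ¬ Seed L s 0 ω} ≤ ENNReal.ofReal (11 / 12) := by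
    have h2 : μ.real {ω | ¬ Seed L s 0 ω} = 1 - μ.real {ω | Seed L s 0 ω} :=
      probReal_compl_eq_one_sub (measurableSet_seed L s 0)
    rw [← ofReal_measureReal]
    exact ENNReal.ofReal_le_ofReal (by linarith)
  have h2 : ∀ z, μ {ω | ¬ Seed (m ^ j * L) s z ω} ≤
      ENNReal.ofReal (1 / (4 * ((m : ℝ) ^ d) ^ 2)) := fun z => by
    rw [h.measure_not_seed hp ht]
    calc _ ≤ _ := h.measure_not_seed_pow_le hp ht hm hN L s j
      _ ≤ ENNReal.ofReal (11 / 12) ^ 2 ^ j := pow_le_pow_left₀ (zero_le) h1 _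
      _ = ENNReal.ofReal ((11 / 12) ^ 2 ^ j) := (ENNReal.ofReal_pow (by norm_num) _).symm
      _ ≤ _ := ENNReal.ofReal_le_ofReal hj
  have h3 := h.percolates_of_seed hl hb hm (Nat.mul_pos (Nat.pow_pos hm) hL) hs hN hγ hT h2
  exact h3.ne' hno

/-- The sum of all connection probabilities in a box. -/
noncomputable def total (μ : Measure (Config d)) (L : ℕ) (z : V d) : ℝ :=
  ∑ x ∈ box L z, meanIn μ (box L z) x

theorem total_nonneg (μ : Measure (Config d)) (L : ℕ) (z : V d) : 0 ≤ total μ L z :=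
  Finset.sum_nonneg fun _ _ => meanIn_nonneg _ _ _

theorem total_le [IsProbabilityMeasure μ] (L : ℕ) (z : V d) :
    total μ L z ≤ ((L : ℝ) ^ d) ^ 2 := by
  calc total μ L z ≤ ∑ x ∈ box L z, ∑ y ∈ box L z, 1 :=
        Finset.sum_le_sum fun x _ => Finset.sum_le_sum fun y _ => measureReal_le_one
    _ = _ := by simp [card_box, sq]

theorem IsPerc.total_eq (h : IsPerc μ p) (hp : ∀ e, 0 ≤ p e ∧ p e ≤ 1) (ht : TransInv p)
    (L : ℕ) (z : V d) : total μ L z = total μ L 0 := by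
  have hb : box L z = (box L 0).map (addRightEmbedding ((L : ℤ) • z)) := by
    rw [map_box, zero_add]
  rw [total, total]
  conv_lhs => rw [hb, Finset.sum_map]
  refine Finset.sum_congr rfl fun x _ => ?_
  rw [meanIn, meanIn]
  conv_lhs => rw [Finset.sum_map]
  refine Finset.sum_congr rfl fun y _ => ?_
  rw [← hb, Measure.real, Measure.real, ← h.measure_shift hp ht ((L : ℤ) • z)
    (measurableSet_of_dependsOn (dependsOn_connIn (box L 0) x y))]
  congr 2
  ext ω
  have := connIn_shift (L := L) (z := 0) (a := z) (x := x) (y := y) (ω := ω)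
  rw [zero_add] at this
  exact this.symm

theorem IsPerc.total_mul_ge (h : IsPerc μ p) (hp : ∀ e, 0 ≤ p e ∧ p e ≤ 1) (ht : TransInv p)
    {b σ T : ℝ} (hl : Lower p b σ) (hb : 0 ≤ b) {m : ℕ} (hm : 1 ≤ m) (hN : 3 ≤ m ^ d) {L M : ℕ}
    (hL : 1 ≤ L) (hM : 1 ≤ M) (hQ : μ.real {ω | Seed L M 0 ω} ≤ 1 / 12)
    (hT : b * ((m * L : ℕ) : ℝ) ^ (-σ) * (((3 * M : ℕ) : ℝ) * (3 * M : ℕ)) ≤ T) :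
    b * ((m * L : ℕ) : ℝ) ^ (-σ) * Real.exp (-T) / 4 * total μ L 0 ^ 2 ≤ total μ (m * L) 0 := by
  have := h.1
  obtain ⟨c, hc, hc0⟩ := exists_ne_mem_box hN
  have hz := zero_mem_box (d := d) hm
  set g := b * ((m * L : ℕ) : ℝ) ^ (-σ) with hg
  have hg0 : 0 ≤ g := mul_nonneg hb (Real.rpow_nonneg (Nat.cast_nonneg _) _)
  have hQ' : μ.real {ω | Seed L M c ω} ≤ 1 / 12 := by
    have h1 := probReal_compl_eq_one_sub (μ := μ) (measurableSet_seed L M c)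
    have h2 := probReal_compl_eq_one_sub (μ := μ) (measurableSet_seed L M (0 : V d))
    have h3 : μ.real {ω | Seed L M c ω}ᶜ = μ.real {ω | Seed L M 0 ω}ᶜ :=
      congrArg ENNReal.toReal (h.measure_not_seed hp ht L M c)
    linarith
  have h1 : box L 0 ⊆ box (m * L) (0 : V d) := box_subset_box hz
  have h2 : box L c ⊆ box (m * L) (0 : V d) := box_subset_box hc
  have hd := disjoint_box (L := L) hc0.symm
  have key : ∀ x ∈ box L (0 : V d), ∀ y ∈ box L c,
      g * Real.exp (-T) / 4 * (meanIn μ (box L 0) x * meanIn μ (box L c) y) ≤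
        μ.real {ω | ConnIn (box (m * L) 0) ω x y} := fun x hx y hy => by
    refine le_trans ?_ (h.mul_truncIn_le hd h1 h2 hg0 (fun u hu v hv => hl.exp_le
      (Nat.mul_pos hm hL) (h1 hu) (h2 hv) fun huv => Finset.disjoint_left.1 hd hu (huv ▸ hv)) hT hx hy)
    have h3 := h.meanIn_le hp hx hM hQ
    have h4 := h.meanIn_le hp hy hM hQ'
    have h5 := mul_le_mul h3 h4 (meanIn_nonneg _ _ _)
      (mul_nonneg zero_le_two (truncIn_nonneg _ _ _ _))
    have h6 : 0 ≤ g * Real.exp (-T) := mul_nonneg hg0 (Real.exp_nonneg _)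
    nlinarith
  calc g * Real.exp (-T) / 4 * total μ L 0 ^ 2
      = g * Real.exp (-T) / 4 * (total μ L 0 * total μ L c) := by
        rw [h.total_eq hp ht L c, sq]
    _ = ∑ x ∈ box L 0, ∑ y ∈ box L c,
          g * Real.exp (-T) / 4 * (meanIn μ (box L 0) x * meanIn μ (box L c) y) := by
        rw [total, total, Finset.sum_mul_sum, Finset.mul_sum]
        exact Finset.sum_congr rfl fun x _ => by rw [Finset.mul_sum]
    _ ≤ ∑ x ∈ box L 0, ∑ y ∈ box L c, μ.real {ω | ConnIn (box (m * L) 0) ω x y} :=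
        Finset.sum_le_sum fun x hx => Finset.sum_le_sum fun y hy => key x hx y hy
    _ ≤ ∑ x ∈ box L 0, meanIn μ (box (m * L) 0) x :=
        Finset.sum_le_sum fun x _ => Finset.sum_le_sum_of_subset_of_nonneg h2
          fun _ _ _ => measureReal_nonneg
    _ ≤ _ := Finset.sum_le_sum_of_subset_of_nonneg h1 fun _ _ _ => meanIn_nonneg _ _ _

/-- A sequence that grows at most exponentially cannot square itself at each step. -/
theorem le_two_of_sq_le {v : ℕ → ℝ} (hsq : ∀ k, v k ^ 2 ≤ v (k + 1)) {c D : ℝ} (hD : 0 ≤ D)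
    (hv : ∀ k, v k ≤ c * D ^ k) (k : ℕ) : v k ≤ 2 := by
  by_contra! hk
  have h1 : ∀ j, (2 : ℝ) ^ 2 ^ j ≤ v (k + j) := by
    intro j
    induction j with
    | zero => simpa using hk.le
    | succ j ih =>
      calc (2 : ℝ) ^ 2 ^ (j + 1) = (2 ^ 2 ^ j) ^ 2 := by rw [pow_succ 2 j, pow_mul]
        _ ≤ v (k + j) ^ 2 := pow_le_pow_left₀ (by positivity) ih 2
        _ ≤ _ := hsq _
  obtain ⟨E, hE⟩ := pow_unbounded_of_one_lt (max (c * D ^ k) D) (one_lt_two (α := ℝ))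
  have h2 : ∀ j, 2 ^ j ≤ E * (1 + j) := by
    intro j
    have h3 : (2 : ℝ) ^ 2 ^ j ≤ 2 ^ (E * (1 + j)) := by
      calc (2 : ℝ) ^ 2 ^ j ≤ c * D ^ (k + j) := (h1 j).trans (hv _)
        _ = c * D ^ k * D ^ j := by ring
        _ ≤ 2 ^ E * (2 ^ E) ^ j := by
          gcongr
          · exact (le_max_left _ _).trans hE.le
          · exact (le_max_right _ _).trans hE.le
        _ = _ := by rw [← pow_succ', ← pow_mul, add_comm]
    exact (pow_le_pow_iff_right₀ (one_lt_two (α := ℝ))).1 h3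
  have h4 := h2 (4 * E)
  have h5 : 2 * E + 1 ≤ 2 ^ (2 * E) := Nat.lt_two_pow_self
  have h6 : 2 ^ (4 * E) = 2 ^ (2 * E) * 2 ^ (2 * E) := by rw [← pow_add]; ring_nf
  nlinarith

theorem exists_pow_le {q δ : ℝ} (hq0 : 0 ≤ q) (hq : q < 1) (hδ : 0 < δ) :
    ∃ j : ℕ, q ^ 2 ^ j ≤ δ := by
  obtain ⟨n, hn⟩ := exists_pow_lt_of_lt_one hδ hq
  exact ⟨n, (pow_le_pow_of_le_one hq0 hq.le Nat.lt_two_pow_self.le).trans hn.le⟩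

theorem total_le_of_step [IsProbabilityMeasure μ] {m : ℕ} (hm : 1 ≤ m) {σ : ℝ} (hσ : 0 ≤ σ)
    {c₀ : ℝ} (hc₀ : 0 < c₀) (hstep : ∀ k : ℕ, c₀ * ((m : ℝ) ^ σ) ^ (-((k : ℤ) + 1)) *
      total μ (m ^ k) 0 ^ 2 ≤ total μ (m ^ (k + 1)) 0) (k : ℕ) :
    total μ (m ^ k) 0 ≤ 2 / c₀ * (m : ℝ) ^ (2 * σ) * ((m ^ k : ℕ) : ℝ) ^ σ := by
  have hm0 : (0 : ℝ) < m := by exact_mod_cast hm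
  have hm1 : (1 : ℝ) ≤ m := by exact_mod_cast hm
  set X : ℝ := (m : ℝ) ^ σ with hX
  have hX1 : 1 ≤ X := Real.one_le_rpow hm1 hσ
  have hX0 : 0 < X := by positivity
  have h2 := le_two_of_sq_le (v := fun k => c₀ * X ^ (-((k : ℤ) + 2)) * total μ (m ^ k) 0)
    (c := c₀) (D := (m : ℝ) ^ (2 * d)) (fun k => by
      have h3 := mul_le_mul_of_nonneg_left (hstep k)
        (show 0 ≤ c₀ * X ^ (-((k : ℤ) + 3)) by positivity)
      have h4 : X ^ (-((k : ℤ) + 3)) * X ^ (-((k : ℤ) + 1)) = (X ^ (-((k : ℤ) + 2))) ^ 2 := by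
        rw [← zpow_natCast, ← zpow_mul, ← zpow_add₀ hX0.ne']
        congr 1
        push_cast
        ring
      have h5 : (-(((k + 1 : ℕ) : ℤ) + 2)) = -((k : ℤ) + 3) := by push_cast; ring
      rw [h5]
      refine le_trans (le_of_eq ?_) h3
      rw [mul_pow, mul_pow, ← h4]
      ring) (by positivity) (fun k => by
      have h3 := total_le (μ := μ) (d := d) (m ^ k) 0
      have h4 : X ^ (-((k : ℤ) + 2)) ≤ 1 := zpow_le_one_of_nonpos₀ hX1 (by omega)
      have h5 : (((m ^ k : ℕ) : ℝ) ^ d) ^ 2 = ((m : ℝ) ^ (2 * d)) ^ k := by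
        push_cast
        ring
      rw [h5] at h3
      calc c₀ * X ^ (-((k : ℤ) + 2)) * total μ (m ^ k) 0
          ≤ c₀ * 1 * ((m : ℝ) ^ (2 * d)) ^ k := by
            gcongr
            exact total_nonneg _ _ _
        _ = _ := by ring) k
  beta_reduce at h2
  have h3 : ((m ^ k : ℕ) : ℝ) ^ σ = X ^ k := by
    push_cast
    rw [hX, ← Real.rpow_natCast, ← Real.rpow_natCast, ← Real.rpow_mul hm0.le,
      ← Real.rpow_mul hm0.le, mul_comm]
  have h4 : (m : ℝ) ^ (2 * σ) = X ^ 2 := by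
    rw [hX, ← Real.rpow_natCast, ← Real.rpow_mul hm0.le, mul_comm]
    norm_num
  rw [h3, h4]
  have h5 : X ^ (-((k : ℤ) + 2)) = (X ^ (k + 2))⁻¹ := by
    rw [zpow_neg]
    norm_cast
  rw [h5] at h2
  have h6 : 0 < X ^ (k + 2) := by positivity
  calc total μ (m ^ k) 0 = (c₀ * (X ^ (k + 2))⁻¹ * total μ (m ^ k) 0) * (X ^ (k + 2) / c₀) := by
        field_simp
    _ ≤ 2 * (X ^ (k + 2) / c₀) := by gcongr
    _ = _ := by
      rw [pow_add]
      ring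

set_option maxHeartbeats 800000 in
/-- In the absence of percolation the mean cluster size in boxes satisfies a power-law bound,
uniformly for parameters in a compact interval. -/
theorem exists_total_le {m : ℕ} (hm : 1 ≤ m) (hN : 3 ≤ m ^ d) {σ : ℝ} (hσ : 0 ≤ σ)
    (hγ : 2 * (m : ℝ) ^ σ ≤ ((m : ℝ) ^ d - 1) ^ 2) {b₀ b₁ : ℝ} (hb₀ : 0 < b₀) :
    ∃ A : ℝ, 0 < A ∧ ∀ (b : ℝ) (μ : Measure (Config d)) (p : Sym2 (V d) → ℝ), IsPerc μ p →
      (∀ e, 0 ≤ p e ∧ p e ≤ 1) → TransInv p → Lower p b σ → b₀ ≤ b → b ≤ b₁ →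
      μ {ω | ∃ x : V d, (cluster ω x).Infinite} = 0 →
      ∀ k : ℕ, total μ (m ^ k) 0 ≤ A * ((m ^ k : ℕ) : ℝ) ^ σ := by
  have hm0 : (0 : ℝ) < m := by exact_mod_cast hm
  have hm1 : (1 : ℝ) ≤ m := by exact_mod_cast hm
  set N : ℝ := (m : ℝ) ^ d with hNdef
  have hN0 : 0 < N := by positivity
  obtain ⟨j, hj⟩ := exists_pow_le (q := 11 / 12) (δ := 1 / (4 * N ^ 2)) (by norm_num) (by norm_num)
    (by positivity)
  set T : ℝ := 72 * (16 * N ^ 4 * (m : ℝ) ^ (j * σ) + b₁) with hTdef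
  set c₀ : ℝ := b₀ * Real.exp (-T) / 4 with hc₀def
  have hc₀ : 0 < c₀ := by positivity
  refine ⟨2 / c₀ * (m : ℝ) ^ (2 * σ), by positivity, ?_⟩
  intro b μ p h hp ht hl hbb₀ hbb₁ hno k
  have := h.1
  have hb : 0 < b := hb₀.trans_le hbb₀
  have hstep : ∀ k : ℕ, c₀ * ((m : ℝ) ^ σ) ^ (-((k : ℤ) + 1)) * total μ (m ^ k) 0 ^ 2 ≤
      total μ (m ^ (k + 1)) 0 := by
    intro k
    set R : ℝ := ((m * (m ^ j * m ^ k) : ℕ) : ℝ) ^ σ with hR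
    have hR0 : 0 < R := by positivity
    set y : ℝ := 16 * N ^ 4 * R / b with hy
    have hy0 : 0 ≤ y := by positivity
    set M := ⌈Real.sqrt y⌉₊ + 1 with hM
    have hM1 : y ≤ (M : ℝ) ^ 2 := by
      have h1 : Real.sqrt y ≤ M := (Nat.le_ceil _).trans (by rw [hM]; push_cast; linarith)
      calc y = Real.sqrt y ^ 2 := (Real.sq_sqrt hy0).symm
        _ ≤ _ := pow_le_pow_left₀ (Real.sqrt_nonneg _) h1 2
    have hM2 : (M : ℝ) ^ 2 ≤ 2 * y + 8 := by
      have h1 : (M : ℝ) ≤ Real.sqrt y + 2 := by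
        have := (Nat.ceil_lt_add_one (Real.sqrt_nonneg y)).le
        rw [hM]
        push_cast
        linarith
      have h2 := Real.sq_sqrt hy0
      have h3 := Real.sqrt_nonneg y
      nlinarith [sq_nonneg (Real.sqrt y - 2)]
    have hRn : ((m * (m ^ j * m ^ k) : ℕ) : ℝ) ^ (-σ) = R⁻¹ := by
      rw [Real.rpow_neg (Nat.cast_nonneg _)]
    have hQ := h.measure_seed_le hp ht hl hb.le hno hm hN hγ (L := m ^ k) (s := M) (j := j)
      (Nat.one_le_pow _ _ hm) (by omega) hj (by
        rw [hRn]
        have : 16 * N ^ 4 = b * y * R⁻¹ := by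
          rw [hy]
          field_simp
        rw [this]
        gcongr)
    have hP : ((m * m ^ k : ℕ) : ℝ) ^ (-σ) = ((m : ℝ) ^ σ) ^ (-((k : ℤ) + 1)) := by
      rw [← Real.rpow_intCast, ← Real.rpow_mul hm0.le]
      push_cast
      rw [← pow_succ', ← Real.rpow_natCast, ← Real.rpow_mul hm0.le]
      congr 1
      push_cast
      ring
    have hRP : R * ((m * m ^ k : ℕ) : ℝ) ^ (-σ) = (m : ℝ) ^ (j * σ) := by
      have h1 : R = (m : ℝ) ^ (j * σ) * ((m * m ^ k : ℕ) : ℝ) ^ σ := by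
        rw [hR, Real.rpow_mul hm0.le, Real.rpow_natCast, ← Real.mul_rpow (by positivity)
          (by positivity)]
        push_cast
        ring_nf
      rw [h1, mul_assoc, ← Real.rpow_add (by positivity)]
      simp
    have hP1 : ((m * m ^ k : ℕ) : ℝ) ^ (-σ) ≤ 1 := by
      refine Real.rpow_le_one_of_one_le_of_nonpos ?_ (by linarith)
      exact_mod_cast Nat.mul_pos hm (Nat.pow_pos hm)
    set P : ℝ := ((m * m ^ k : ℕ) : ℝ) ^ (-σ) with hPdef
    have hP0 : 0 ≤ P := Real.rpow_nonneg (Nat.cast_nonneg _) _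
    have hTb : b * P * (((3 * M : ℕ) : ℝ) * (3 * M : ℕ)) ≤ T := by
      have h1 : b * P * y = 16 * N ^ 4 * (m : ℝ) ^ (j * σ) := by
        rw [← hRP, hy]
        field_simp
      have h2 : b * P ≤ b₁ := by nlinarith
      have h4 : 0 ≤ b * P := by positivity
      have h5 : 0 ≤ 16 * N ^ 4 * (m : ℝ) ^ (j * σ) := by positivity
      have h3 := mul_le_mul_of_nonneg_left hM2 h4
      push_cast
      rw [hTdef]
      nlinarith
    have h1 := h.total_mul_ge hp ht hl hb.le hm hN (Nat.one_le_pow k _ hm) (by omega) hQ hTb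
    rw [← pow_succ'] at h1
    rw [← hP]
    refine le_trans ?_ h1
    rw [hc₀def]
    have h2 : ((m ^ (k + 1) : ℕ) : ℝ) ^ (-σ) = P := by rw [hPdef, pow_succ']
    rw [h2]
    have h3 : 0 ≤ Real.exp (-T) / 4 * P * total μ (m ^ k) 0 ^ 2 :=
      mul_nonneg (mul_nonneg (by positivity) hP0) (sq_nonneg _)
    linarith [mul_le_mul_of_nonneg_right hbb₀ h3]
  exact total_le_of_step hm hσ hc₀ hstep k

end Subcritical

/-! ## The kernel -/

section Norms

variable {d : ℕ}

theorem norm_toR_sub (x y : V d) : ‖toR x - toR y‖ = ‖x - y‖ := by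
  refine le_antisymm ((pi_norm_le_iff_of_nonneg (norm_nonneg _)).2 fun i => ?_)
    ((pi_norm_le_iff_of_nonneg (norm_nonneg _)).2 fun i => ?_)
  · have h := norm_le_pi_norm (x - y) i
    rw [← Int.norm_cast_real] at h
    simpa [toR] using h
  · have h := norm_le_pi_norm (toR x - toR y) i
    rw [← Int.norm_cast_real]
    simpa [toR] using h

theorem norm_le_natCast_iff {x : V d} {n : ℕ} : ‖x‖ ≤ n ↔ ∀ i, |x i| ≤ n := by
  rw [pi_norm_le_iff_of_nonneg (Nat.cast_nonneg n)]
  refine forall_congr' fun i => ?_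
  rw [Int.norm_eq_abs]
  norm_cast

theorem one_le_norm {x : V d} (hx : x ≠ 0) : 1 ≤ ‖x‖ := by
  obtain ⟨i, hi⟩ := Function.ne_iff.1 hx
  refine le_trans ?_ (norm_le_pi_norm x i)
  rw [Int.norm_eq_abs]
  exact_mod_cast Int.one_le_abs hi

theorem exists_seminorm_le (N : Seminorm ℝ (Fin d → ℝ)) :
    ∃ c : ℝ, 0 < c ∧ ∀ x, N x ≤ c * ‖x‖ := by
  refine ⟨∑ i, N (Pi.single i 1) + 1, by
    have : 0 ≤ ∑ i, N (Pi.single i 1) := Finset.sum_nonneg fun i _ => apply_nonneg N _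
    linarith, fun x => ?_⟩
  have h1 : N x ≤ ∑ i, N (x i • Pi.single i (1 : ℝ)) := by
    conv_lhs => rw [pi_eq_sum_univ' x]
    refine le_trans (Finset.le_sum_of_subadditive N (map_zero N).le (map_add_le_add N) _ _)
      (le_of_eq (Finset.sum_congr rfl fun i _ => ?_))
    congr 2
  refine h1.trans ?_
  have h2 : ∀ i, N (x i • Pi.single i (1 : ℝ)) ≤ N (Pi.single i 1) * ‖x‖ := fun i => by
    rw [map_smul_eq_mul, mul_comm]
    exact mul_le_mul_of_nonneg_left (norm_le_pi_norm x i) (apply_nonneg N _)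
  calc ∑ i, N (x i • Pi.single i (1 : ℝ)) ≤ ∑ i, N (Pi.single i 1) * ‖x‖ :=
        Finset.sum_le_sum fun i _ => h2 i
    _ ≤ _ := by
      rw [← Finset.sum_mul]
      exact mul_le_mul_of_nonneg_right (by linarith) (norm_nonneg x)

theorem exists_le_seminorm (hd : 1 ≤ d) (N : Seminorm ℝ (Fin d → ℝ))
    (hN : ∀ x, x ≠ 0 → 0 < N x) : ∃ c : ℝ, 0 < c ∧ ∀ x, c * ‖x‖ ≤ N x := by
  obtain ⟨C, hC, hNC⟩ := exists_seminorm_le N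
  have hcont : Continuous N := by
    refine Seminorm.continuous (r := 1) ?_
    refine Filter.mem_of_superset (Metric.ball_mem_nhds 0 (inv_pos.2 hC)) fun x hx => ?_
    rw [Seminorm.mem_ball_zero]
    rw [mem_ball_zero_iff] at hx
    calc N x ≤ C * ‖x‖ := hNC x
      _ < C * C⁻¹ := by gcongr
      _ = 1 := mul_inv_cancel₀ hC.ne'
  have : Nonempty (Fin d) := ⟨⟨0, hd⟩⟩
  obtain ⟨u, hu, hmin⟩ := (isCompact_sphere (0 : Fin d → ℝ) 1).exists_isMinOn
    (NormedSpace.sphere_nonempty.2 zero_le_one) hcont.continuousOn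
  rw [mem_sphere_zero_iff_norm] at hu
  refine ⟨N u, hN u (fun h => by simp [h] at hu), fun x => ?_⟩
  rcases eq_or_ne x 0 with rfl | hx
  · simp
  have hx0 : 0 < ‖x‖ := norm_pos_iff.2 hx
  have h1 : N u ≤ N (‖x‖⁻¹ • x) := hmin (by
    rw [mem_sphere_zero_iff_norm, norm_smul, norm_inv, norm_norm, inv_mul_cancel₀ hx0.ne'])
  rw [map_smul_eq_mul, norm_inv, norm_norm] at h1
  calc N u * ‖x‖ ≤ ‖x‖⁻¹ * N x * ‖x‖ := by gcongr
    _ = N x := by field_simp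

end Norms

theorem edgeProb_nonneg {t : ℝ} (ht : 0 ≤ t) : 0 ≤ edgeProb t := by
  rw [edgeProb]
  linarith [Real.exp_le_one_iff.2 (neg_nonpos.2 ht)]

theorem edgeProb_le_one (t : ℝ) : edgeProb t ≤ 1 := by
  rw [edgeProb]
  linarith [Real.exp_pos (-t)]

theorem edgeProb_mono : Monotone edgeProb := fun s t h => by
  simp only [edgeProb]
  linarith [Real.exp_le_exp.2 (neg_le_neg h)]

theorem edgeProb_le (t : ℝ) : edgeProb t ≤ t := by
  rw [edgeProb]
  linarith [Real.add_one_le_exp (-t)]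

namespace Kernel

variable {d : ℕ} {α : ℝ} (κ : Kernel d α)

theorem exists_le_nd (hd : 1 ≤ d) : ∃ c : ℝ, 0 < c ∧ ∀ x y : V d, c * ‖x - y‖ ≤ κ.nd x y := by
  obtain ⟨c, hc, h⟩ := exists_le_seminorm hd κ.N κ.N_pos
  exact ⟨c, hc, fun x y => by rw [← norm_toR_sub]; exact h _⟩

theorem exists_nd_le : ∃ c : ℝ, 0 < c ∧ ∀ x y : V d, κ.nd x y ≤ c * ‖x - y‖ := by
  obtain ⟨c, hc, h⟩ := exists_seminorm_le κ.N
  exact ⟨c, hc, fun x y => by rw [← norm_toR_sub]; exact h _⟩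

theorem nd_pos {x y : V d} (h : x ≠ y) : 0 < κ.nd x y := by
  refine κ.N_pos _ fun h0 => h ?_
  have := norm_toR_sub x y
  rw [h0, norm_zero, eq_comm, norm_eq_zero] at this
  exact sub_eq_zero.1 this

theorem nd_add (x y a : V d) : κ.nd (x + a) (y + a) = κ.nd x y := by
  rw [nd, nd]
  congr 1
  ext i
  simp [toR]

theorem J'_nonpos {r : ℝ} (hr : 0 < r) : κ.J' r ≤ 0 := by
  rw [← (κ.J_hasDeriv r hr).deriv,
    ← derivWithin_of_isOpen isOpen_Ioi (Set.mem_Ioi.2 hr)]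
  exact κ.J_anti.derivWithin_nonpos

theorem integral_abs_J' {s r : ℝ} (hs : 0 < s) (hsr : s ≤ r) :
    ∫ u in Set.Ioc s r, |κ.J' u| = κ.J s - κ.J r := by
  have h1 : ∀ u ∈ Set.Icc s r, HasDerivAt (fun u => -κ.J u) (-κ.J' u) u := fun u hu =>
    (κ.J_hasDeriv u (hs.trans_le hu.1)).neg
  have h2 : ContinuousOn (fun u => -κ.J u) (Set.Icc s r) := fun u hu =>
    (h1 u hu).continuousAt.continuousWithinAt
  have h3 : ∫ u in s..r, -κ.J' u = -κ.J r - -κ.J s := by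
    refine intervalIntegral.integral_eq_sub_of_hasDerivAt_of_le hsr h2
      (fun u hu => h1 u ⟨hu.1.le, hu.2.le⟩) ?_
    rw [intervalIntegrable_iff_integrableOn_Ioc_of_le hsr]
    exact intervalIntegral.integrableOn_deriv_of_nonneg h2
      (fun u hu => h1 u ⟨hu.1.le, hu.2.le⟩)
      (fun u hu => neg_nonneg.2 (κ.J'_nonpos (hs.trans hu.1)))
  rw [intervalIntegral.integral_of_le hsr] at h3
  rw [setIntegral_congr_fun measurableSet_Ioc
    (fun u hu => abs_of_nonpos (κ.J'_nonpos (hs.trans hu.1))), h3]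
  ring

theorem kerCut_eq (r : ℝ) (x y : V d) : κ.kerCut r x y =
    if x ≠ y ∧ κ.nd x y ≤ r then κ.J (κ.nd x y) - κ.J r else 0 := by
  rw [kerCut]
  split_ifs with h
  · exact κ.integral_abs_J' (κ.nd_pos h.1) h.2
  · rfl

theorem kerCut_nonneg (r : ℝ) (x y : V d) : 0 ≤ κ.kerCut r x y := by
  rw [kerCut]
  split_ifs
  · exact integral_nonneg fun _ => abs_nonneg _
  · rfl

theorem ker_nonneg (x y : V d) : 0 ≤ κ.ker x y := by
  rw [ker]
  split_ifs with h
  · rfl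
  · exact κ.J_nonneg _ (κ.nd_pos h)

theorem kerCut_le_ker (r : ℝ) (x y : V d) : κ.kerCut r x y ≤ κ.ker x y := by
  have h0 := κ.ker_nonneg x y
  rw [kerCut_eq]
  split_ifs with h
  · rw [ker, if_neg h.1]
    linarith [κ.J_nonneg r ((κ.nd_pos h.1).trans_le h.2)]
  · exact h0

theorem ker_add (x y a : V d) : κ.ker (x + a) (y + a) = κ.ker x y := by
  rw [ker, ker, nd_add]
  exact if_congr (add_left_injective a).eq_iff rfl rfl

theorem kerCut_add (r : ℝ) (x y a : V d) : κ.kerCut r (x + a) (y + a) = κ.kerCut r x y := by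
  rw [kerCut, kerCut, nd_add]
  exact if_congr (and_congr_left' (add_left_injective a).ne_iff) rfl rfl

@[simp] theorem edgeP_mk (β : ℝ) (x y : V d) : κ.edgeP β s(x, y) = edgeProb (β * κ.ker x y) := rfl

@[simp] theorem edgePCut_mk (β r : ℝ) (x y : V d) :
    κ.edgePCut β r s(x, y) = edgeProb (β * κ.kerCut r x y) := rfl

theorem edgeP_mem {β : ℝ} (hβ : 0 ≤ β) (e : Sym2 (V d)) : 0 ≤ κ.edgeP β e ∧ κ.edgeP β e ≤ 1 := by
  induction e with
  | _ x y => exact ⟨edgeProb_nonneg (mul_nonneg hβ (κ.ker_nonneg x y)), edgeProb_le_one _⟩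

theorem edgePCut_mem {β : ℝ} (hβ : 0 ≤ β) (r : ℝ) (e : Sym2 (V d)) :
    0 ≤ κ.edgePCut β r e ∧ κ.edgePCut β r e ≤ 1 := by
  induction e with
  | _ x y => exact ⟨edgeProb_nonneg (mul_nonneg hβ (κ.kerCut_nonneg r x y)), edgeProb_le_one _⟩

theorem edgePCut_le {β : ℝ} (hβ : 0 ≤ β) (r : ℝ) (e : Sym2 (V d)) :
    κ.edgePCut β r e ≤ κ.edgeP β e := by
  induction e with
  | _ x y => exact edgeProb_mono (mul_le_mul_of_nonneg_left (κ.kerCut_le_ker r x y) hβ)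

theorem edgeP_transInv (β : ℝ) : TransInv (κ.edgeP β) := fun a e => by
  induction e with
  | _ x y => simp [ker_add]

theorem edgePCut_transInv (β r : ℝ) : TransInv (κ.edgePCut β r) := fun a e => by
  induction e with
  | _ x y => simp [kerCut_add]

theorem continuous_edgeP (e : Sym2 (V d)) : Continuous fun β => κ.edgeP β e := by
  induction e with
  | _ x y =>
    simp only [edgeP_mk, edgeProb]
    fun_prop

theorem exists_J_bounds (hd : 1 ≤ d) (hα : 0 < α) : ∃ R : ℝ, 1 ≤ R ∧
    (∀ s, R ≤ s → 1 / (2 * (d + α)) * s ^ (-((d : ℝ) + α)) ≤ κ.J s) ∧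
    ∀ s r, R ≤ s → s ≤ r → κ.J s - κ.J r ≤ 2 / (d + α) * s ^ (-((d : ℝ) + α)) := by
  set σ : ℝ := d + α with hσd
  have hσ : 0 < σ := by positivity
  obtain ⟨R₀, hR₀⟩ := Filter.eventually_atTop.1
    (κ.δ_lim.eventually (Metric.ball_mem_nhds 0 (show (0 : ℝ) < 1 / 2 by norm_num)))
  set R := max R₀ 1 with hR
  have hR1 : 1 ≤ R := le_max_right _ _
  have hJ : ∀ u, R ≤ u → -(3 / 2 * u ^ (-σ - 1)) ≤ κ.J' u ∧ κ.J' u ≤ -(1 / 2 * u ^ (-σ - 1)) := by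
    intro u hu
    have hu0 : 0 < u := by linarith
    have h1 := κ.J'_eq u hu0
    rw [abs_of_nonpos (κ.J'_nonpos hu0), show -(d : ℝ) - α - 1 = -σ - 1 by rw [hσd]; ring] at h1
    have h2 := hR₀ u ((le_max_left _ _).trans hu)
    rw [dist_zero_right, Real.norm_eq_abs, abs_lt] at h2
    have h3 : 0 < u ^ (-σ - 1) := Real.rpow_pos_of_pos hu0 _
    constructor <;> nlinarith
  have hder : ∀ c u : ℝ, R ≤ u →
      HasDerivAt (fun u => κ.J u - c / σ * u ^ (-σ)) (κ.J' u + c * u ^ (-σ - 1)) u := by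
    intro c u hu
    have hu0 : 0 < u := by linarith
    have h1 := (κ.J_hasDeriv u hu0).sub
      ((Real.hasDerivAt_rpow_const (p := -σ) (Or.inl hu0.ne')).const_mul (c / σ))
    have h2 : κ.J' u - c / σ * (-σ * u ^ (-σ - 1)) = κ.J' u + c * u ^ (-σ - 1) := by
      rw [← mul_assoc, mul_neg, div_mul_cancel₀ _ hσ.ne']
      ring
    rw [h2] at h1
    exact h1
  have hcont : ∀ c : ℝ, ContinuousOn (fun u => κ.J u - c / σ * u ^ (-σ)) (Set.Ici R) :=
    fun c u hu => (hder c u hu).continuousAt.continuousWithinAt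
  have hanti : AntitoneOn (fun u => κ.J u - 1 / 2 / σ * u ^ (-σ)) (Set.Ici R) := by
    refine antitoneOn_of_deriv_nonpos (convex_Ici R) (hcont _) (fun u hu => ?_) fun u hu => ?_
    · rw [interior_Ici] at hu
      exact (hder _ u (le_of_lt hu)).differentiableAt.differentiableWithinAt
    · rw [interior_Ici] at hu
      rw [(hder _ u (le_of_lt hu)).deriv]
      linarith [(hJ u (le_of_lt hu)).2]
  have hmono : MonotoneOn (fun u => κ.J u - 3 / 2 / σ * u ^ (-σ)) (Set.Ici R) := by
    refine monotoneOn_of_deriv_nonneg (convex_Ici R) (hcont _) (fun u hu => ?_) fun u hu => ?_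
    · rw [interior_Ici] at hu
      exact (hder _ u (le_of_lt hu)).differentiableAt.differentiableWithinAt
    · rw [interior_Ici] at hu
      rw [(hder _ u (le_of_lt hu)).deriv]
      linarith [(hJ u (le_of_lt hu)).1]
  refine ⟨R, hR1, fun s hs => ?_, fun s r hs hsr => ?_⟩
  · have hlim : Tendsto (fun u : ℝ => -(1 / 2 / σ * u ^ (-σ))) atTop (nhds 0) := by
      simpa using ((tendsto_rpow_neg_atTop hσ).const_mul (1 / 2 / σ)).neg
    have h1 : (0 : ℝ) ≤ κ.J s - 1 / 2 / σ * s ^ (-σ) := by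
      refine le_of_tendsto hlim ?_
      filter_upwards [Filter.eventually_ge_atTop s] with u hu
      have h2 := hanti (Set.mem_Ici.2 hs) (Set.mem_Ici.2 (hs.trans hu)) hu
      have h3 := κ.J_nonneg u (by linarith)
      simp only at h2
      linarith
    have h2 : 1 / (2 * σ) = 1 / 2 / σ := by rw [div_div]
    rw [h2]
    linarith
  · have h2 := hmono (Set.mem_Ici.2 hs) (Set.mem_Ici.2 (hs.trans hsr)) hsr
    simp only at h2
    have h3 : 0 ≤ r ^ (-σ) := Real.rpow_nonneg (by linarith) _
    have h4 : 0 ≤ s ^ (-σ) := Real.rpow_nonneg (by linarith) _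
    have h5 : 3 / 2 / σ ≤ 2 / σ := by gcongr; norm_num
    have h6 : 0 ≤ 3 / 2 / σ := by positivity
    nlinarith

theorem exists_kerCut_le (hd : 1 ≤ d) (hα : 0 < α) : ∃ C : ℝ, 0 < C ∧
    ∀ (r : ℝ) (x y : V d), κ.kerCut r x y ≤ C * ‖x - y‖ ^ (-((d : ℝ) + α)) := by
  obtain ⟨R, hR, -, hJ⟩ := κ.exists_J_bounds hd hα
  obtain ⟨c, hc, hnd⟩ := κ.exists_le_nd hd
  set σ : ℝ := d + α with hσd
  have hσ : 0 < σ := by positivity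
  refine ⟨max (2 / σ * c ^ (-σ)) (κ.J c * (R / c) ^ σ), lt_max_of_lt_left (by positivity),
    fun r x y => ?_⟩
  rw [kerCut_eq]
  split_ifs with h
  · have h1 := one_le_norm (sub_ne_zero.2 h.1)
    have h0 : 0 < ‖x - y‖ := by linarith
    have h2 := hnd x y
    have h3 := κ.nd_pos h.1
    have h4 : 0 ≤ ‖x - y‖ ^ (-σ) := by positivity
    rcases le_total R (κ.nd x y) with hle | hle
    · refine (hJ _ _ hle h.2).trans ((?_ : _ ≤ 2 / σ * c ^ (-σ) * ‖x - y‖ ^ (-σ)).trans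
        (mul_le_mul_of_nonneg_right (le_max_left _ _) h4))
      rw [mul_assoc, ← Real.mul_rpow hc.le h0.le]
      refine mul_le_mul_of_nonneg_left ?_ (by positivity)
      exact Real.rpow_le_rpow_of_nonpos (by positivity) h2 (by linarith)
    · have h5 : κ.J (κ.nd x y) - κ.J r ≤ κ.J c := by
        have := κ.J_anti (Set.mem_Ioi.2 hc) (Set.mem_Ioi.2 h3) (by nlinarith)
        linarith [κ.J_nonneg r (h3.trans_le h.2)]
      refine h5.trans ((?_ : _ ≤ κ.J c * (R / c) ^ σ * ‖x - y‖ ^ (-σ)).trans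
        (mul_le_mul_of_nonneg_right (le_max_right _ _) h4))
      have h6 : ‖x - y‖ ≤ R / c := by
        rw [le_div_iff₀ hc]
        linarith
      have h7 : 1 ≤ (R / c) ^ σ * ‖x - y‖ ^ (-σ) := by
        rw [Real.rpow_neg h0.le, ← div_eq_mul_inv, one_le_div (by positivity)]
        exact Real.rpow_le_rpow h0.le h6 hσ.le
      rw [mul_assoc]
      exact le_mul_of_one_le_right (κ.J_nonneg c hc) h7
  · have : 0 < max (2 / σ * c ^ (-σ)) (κ.J c * (R / c) ^ σ) := lt_max_of_lt_left (by positivity)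
    positivity

theorem exists_lower (hd : 1 ≤ d) (hα : 0 < α) : ∃ c : ℝ, 0 < c ∧
    ∀ β : ℝ, 0 ≤ β → Lower (κ.edgeP β) (β * c) (d + α) := by
  obtain ⟨R, hR, hJ, -⟩ := κ.exists_J_bounds hd hα
  obtain ⟨c, hc, hnd⟩ := κ.exists_nd_le
  have hσ : 0 < (d : ℝ) + α := by positivity
  refine ⟨1 / (2 * (d + α)) * (max R c) ^ (-((d : ℝ) + α)), by positivity,
    fun β hβ n hn x y hxy hle => ?_⟩
  have hn1 : (1 : ℝ) ≤ n := by exact_mod_cast hn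
  have hM : R ≤ max R c * n := (le_max_left R c).trans (le_mul_of_one_le_right (by positivity) hn1)
  have h1 : κ.nd x y ≤ max R c * n := by
    have h2 : ‖x - y‖ ≤ n := norm_le_natCast_iff.2 hle
    calc κ.nd x y ≤ c * ‖x - y‖ := hnd x y
      _ ≤ _ := by gcongr; exact le_max_right _ _
  have h2 : 1 / (2 * (d + α)) * (max R c) ^ (-((d : ℝ) + α)) * (n : ℝ) ^ (-((d : ℝ) + α)) ≤
      κ.ker x y := by
    rw [mul_assoc, ← Real.mul_rpow (by positivity) (by positivity), ker, if_neg hxy]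
    exact (hJ _ hM).trans (κ.J_anti (Set.mem_Ioi.2 (κ.nd_pos hxy))
      (Set.mem_Ioi.2 (by linarith)) h1)
  rw [edgeP_mk, edgeProb, _root_.sub_sub_cancel, Real.exp_le_exp, neg_le_neg_iff, mul_assoc]
  exact mul_le_mul_of_nonneg_left h2 hβ

end Kernel

/-! ## The critical point -/

section Cubes

variable {d : ℕ} {μ : Measure (Config d)} {p : Sym2 (V d) → ℝ}

/-- The lattice points at distance at most `R` from the origin. -/
noncomputable def cube (d R : ℕ) : Finset (V d) :=
  Fintype.piFinset fun _ => Finset.Icc (-(R : ℤ)) R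

theorem mem_cube {R : ℕ} {x : V d} : x ∈ cube d R ↔ ‖x‖ ≤ R := by
  rw [norm_le_natCast_iff]
  simp only [cube, Fintype.mem_piFinset, Finset.mem_Icc, abs_le]

theorem zero_mem_cube (R : ℕ) : (0 : V d) ∈ cube d R := by
  rw [mem_cube, norm_zero]
  positivity

theorem cube_mono {R R' : ℕ} (h : R ≤ R') : cube d R ⊆ cube d R' := fun x hx => by
  rw [mem_cube] at *
  exact hx.trans (by exact_mod_cast h)

theorem IsPerc.meanIn_map (h : IsPerc μ p) (hp : ∀ e, 0 ≤ p e ∧ p e ≤ 1) (ht : TransInv p)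
    (Λ : Finset (V d)) (x a : V d) :
    meanIn μ (Λ.map (addRightEmbedding a)) (x + a) = meanIn μ Λ x := by
  rw [meanIn, Finset.sum_map]
  refine Finset.sum_congr rfl fun y _ => ?_
  rw [Measure.real, Measure.real, ← h.measure_shift hp ht a
    (measurableSet_of_dependsOn (dependsOn_connIn Λ x y))]
  congr 2
  ext ω
  simp only [Set.mem_preimage, Set.mem_ofPred_eq, ConnIn, cut_shift, conn_shift,
    addRightEmbedding_apply]

theorem meanIn_mono [IsFiniteMeasure μ] {Λ Λ' : Finset (V d)} (h : Λ ⊆ Λ') (x : V d) :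
    meanIn μ Λ x ≤ meanIn μ Λ' x :=
  (Finset.sum_le_sum fun y _ => measureReal_mono fun ω hω => ConnIn.mono h hω).trans
    (Finset.sum_le_sum_of_subset_of_nonneg h fun _ _ _ => measureReal_nonneg)

/-- The mean cluster size in a cube is controlled by that in a larger box. -/
theorem IsPerc.meanIn_cube_le (h : IsPerc μ p) (hp : ∀ e, 0 ≤ p e ∧ p e ≤ 1) (ht : TransInv p)
    {R L : ℕ} (hRL : 4 * R ≤ L) : ((L : ℝ) / 2) ^ d * meanIn μ (cube d R) 0 ≤ total μ L 0 := by
  have := h.1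
  set W : Finset (V d) := Fintype.piFinset fun _ => Finset.Ico (R : ℤ) ((L : ℤ) - R) with hW
  have hmem : ∀ x ∈ W, ∀ i, (R : ℤ) ≤ x i ∧ x i < (L : ℤ) - R := fun x hx i => by
    simpa using Fintype.mem_piFinset.1 hx i
  have hsub : W ⊆ box L 0 := fun x hx => mem_box.2 fun i => by
    have := hmem x hx i
    simp only [Pi.zero_apply, mul_zero]
    omega
  have hcard : ((L : ℝ) / 2) ^ d ≤ (W.card : ℝ) := by
    rw [hW, Fintype.card_piFinset]
    simp only [Int.card_Ico, Finset.prod_const, Finset.card_univ, Fintype.card_fin]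
    push_cast
    refine pow_le_pow_left₀ (by positivity) ?_ d
    have h1 : (((L : ℤ) - R - R).toNat : ℤ) = (L : ℤ) - R - R := Int.toNat_of_nonneg (by omega)
    have h2 : ((((L : ℤ) - R - R).toNat : ℕ) : ℝ) = (L : ℝ) - R - R := by exact_mod_cast h1
    have h3 : (4 : ℝ) * R ≤ L := by exact_mod_cast hRL
    rw [h2]
    linarith
  have hpt : ∀ x ∈ W, meanIn μ (cube d R) 0 ≤ meanIn μ (box L 0) x := fun x hx => by
    rw [← h.meanIn_map hp ht (cube d R) 0 x, zero_add]
    refine meanIn_mono (fun y hy => ?_) x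
    obtain ⟨z, hz, rfl⟩ := Finset.mem_map.1 hy
    rw [mem_box]
    intro i
    have h1 := hmem x hx i
    have h2 := abs_le.1 (norm_le_natCast_iff.1 (mem_cube.1 hz) i)
    simp only [Pi.zero_apply, mul_zero, addRightEmbedding_apply, Pi.add_apply]
    omega
  calc ((L : ℝ) / 2) ^ d * meanIn μ (cube d R) 0 ≤ W.card * meanIn μ (cube d R) 0 := by
        gcongr
        exact meanIn_nonneg _ _ _
    _ = ∑ x ∈ W, meanIn μ (cube d R) 0 := by simp
    _ ≤ ∑ x ∈ W, meanIn μ (box L 0) x := Finset.sum_le_sum hpt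
    _ ≤ _ := Finset.sum_le_sum_of_subset_of_nonneg hsub fun _ _ _ => meanIn_nonneg _ _ _

theorem IsPerc.total_le_of_eq_zero (h : IsPerc μ p) (hp : ∀ e, p e = 0) (L : ℕ) :
    total μ L (0 : V d) ≤ (L : ℝ) ^ d := by
  have := h.1
  have hnull : ∀ x y : V d, x ≠ y → μ.real {ω | ConnIn (box L 0) ω x y} = 0 := by
    intro x y hxy
    have h1 : μ (⋃ e : Sym2 (V d), {ω | ω e = true}) = 0 := by
      rw [measure_iUnion_null_iff]
      intro e
      rw [h.measure_open, hp, ENNReal.ofReal_zero]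
    have h2 : {ω : Config d | ConnIn (box L 0) ω x y} ⊆ ⋃ e : Sym2 (V d), {ω | ω e = true} := by
      intro ω hω
      obtain ⟨u, v, -, -, huv⟩ := Conn.exists_boundary (S := {x}) hω rfl hxy.symm
      exact Set.mem_iUnion.2 ⟨s(u, v), (cut_eq_true.1 huv).2⟩
    rw [Measure.real, measure_mono_null h2 h1, ENNReal.toReal_zero]
  have h3 : ∀ x ∈ box L (0 : V d), meanIn μ (box L 0) x ≤ 1 := fun x hx => by
    rw [meanIn, Finset.sum_eq_single_of_mem x hx fun y _ hy => hnull x y hy.symm]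
    exact measureReal_le_one
  calc total μ L (0 : V d) ≤ ∑ x ∈ box L (0 : V d), 1 := Finset.sum_le_sum h3
    _ = _ := by simp [card_box]

/-- The sum of connection probabilities in a box, as a function of the edge probabilities. -/
noncomputable def totalPf (p : Sym2 (V d) → ℝ) (L : ℕ) : ℝ :=
  ∑ x ∈ box L (0 : V d), ∑ y ∈ box L (0 : V d), Pf (box L (0 : V d)).sym2 p
    fun s => if indic s ∈ {ω | ConnIn (box L (0 : V d)) ω x y} then 1 else 0

theorem IsPerc.total_eq_totalPf (h : IsPerc μ p) (hp : ∀ e, 0 ≤ p e ∧ p e ≤ 1) (L : ℕ) :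
    total μ L 0 = totalPf p L := by
  refine Finset.sum_congr rfl fun x _ => Finset.sum_congr rfl fun y _ => ?_
  rw [Measure.real, h.measure_eq_Pf hp (dependsOn_connIn (box L 0) x y), ENNReal.toReal_ofReal]
  refine Pf_nonneg hp ?_
  intro s _
  split_ifs <;> norm_num

theorem totalPf_mono {q : Sym2 (V d) → ℝ} (hp : ∀ e, 0 ≤ p e ∧ p e ≤ 1)
    (hq : ∀ e, 0 ≤ q e ∧ q e ≤ 1) (hpq : ∀ e, p e ≤ q e) (L : ℕ) :
    totalPf p L ≤ totalPf q L := by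
  refine Finset.sum_le_sum fun x _ => Finset.sum_le_sum fun y _ =>
    Pf_mono_prob _ hp hq hpq _ fun s t hst => ?_
  by_cases h1 : indic s ∈ {ω | ConnIn (box L (0 : V d)) ω x y}
  · have h2 : indic t ∈ {ω | ConnIn (box L (0 : V d)) ω x y} :=
      Conn.mono (cut_le_cut _ (indic_le hst)) h1
    simp only [if_pos h1, if_pos h2, le_refl]
  · simp only [if_neg h1]
    split_ifs <;> norm_num

end Cubes

theorem exists_scale {d : ℕ} {α : ℝ} (hd : 1 ≤ d) (hα1 : α < 1) : ∃ m : ℕ, 3 ≤ m ∧ 3 ≤ m ^ d ∧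
    2 * (m : ℝ) ^ ((d : ℝ) + α) ≤ ((m : ℝ) ^ d - 1) ^ 2 := by
  obtain ⟨m, hm8, hm3⟩ := ((((tendsto_rpow_atTop (sub_pos.2 hα1)).comp
    tendsto_natCast_atTop_atTop).eventually_ge_atTop 8).and (Filter.eventually_ge_atTop 3)).exists
  have hm1 : (3 : ℝ) ≤ m := by exact_mod_cast hm3
  have hd1 : (1 : ℝ) ≤ d := by exact_mod_cast hd
  refine ⟨m, hm3, hm3.trans (Nat.le_self_pow (by omega) m), ?_⟩
  have h1 : (8 : ℝ) ≤ (m : ℝ) ^ ((d : ℝ) - α) :=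
    le_trans hm8 (Real.rpow_le_rpow_of_exponent_le (by linarith) (by linarith))
  have h2 : (m : ℝ) ^ ((d : ℝ) + α) * (m : ℝ) ^ ((d : ℝ) - α) = ((m : ℝ) ^ d) ^ 2 := by
    rw [← Real.rpow_add (by linarith), ← Real.rpow_natCast (m : ℝ) d, ← Real.rpow_natCast,
      ← Real.rpow_mul (by linarith)]
    congr 1
    push_cast
    ring
  have h3 : 0 < (m : ℝ) ^ ((d : ℝ) + α) := by positivity
  have h4 : (3 : ℝ) ≤ (m : ℝ) ^ d := hm1.trans (le_self_pow₀ (by linarith) (by omega))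
  nlinarith

namespace Kernel

variable {d : ℕ} {α : ℝ} (κ : Kernel d α)

theorem exists_percolates (hd : 1 ≤ d) (hα : 0 < α) (hα1 : α < 1) :
    ∃ β : ℝ, 0 ≤ β ∧ κ.percolates β := by
  obtain ⟨m, hm3, hN, hγ⟩ := exists_scale (α := α) hd hα1
  obtain ⟨c, hc, hl⟩ := κ.exists_lower hd hα
  have hm0 : (0 : ℝ) < m := by exact_mod_cast (by omega : 0 < m)
  set X : ℝ := ((m * 1 : ℕ) : ℝ) ^ (-((d : ℝ) + α)) with hX
  have hX0 : 0 < X := by rw [hX]; push_cast; positivity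
  set β : ℝ := 16 * ((m : ℝ) ^ d) ^ 4 / (c * X) with hβ
  have hβ0 : 0 ≤ β := by positivity
  refine ⟨β, hβ0, fun μ h => h.percolates_of_seed (hl β hβ0) (by positivity) (by omega : 1 ≤ m)
    le_rfl le_rfl hN hγ ?_ fun z => ?_⟩
  · rw [← hX, hβ]
    apply le_of_eq
    push_cast
    field_simp
  · have h1 : {ω : Config d | ¬ Seed 1 1 z ω} = ∅ := by
      rw [Set.eq_empty_iff_forall_notMem]
      intro ω hω
      exact hω ⟨z, by simp [box_one], {z}, by simp, by simp [Conn.refl]⟩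
    rw [h1, measure_empty]
    exact zero_le

theorem betaC_nonneg : 0 ≤ κ.betaC := Real.sInf_nonneg fun _ h => h.1

theorem exists_no_percolation {β : ℝ} (hβ : 0 ≤ β) (hβc : β < κ.betaC) :
    ∃ μ, IsPerc μ (κ.edgeP β) ∧ μ {ω | ∃ x : V d, (cluster ω x).Infinite} = 0 := by
  have h1 : ¬ κ.percolates β := fun h => notMem_of_lt_csInf hβc ⟨0, fun _ h => h.1⟩ ⟨hβ, h⟩
  rw [percolates] at h1
  push Not at h1
  obtain ⟨μ, hμ, h2⟩ := h1
  exact ⟨μ, hμ, le_antisymm h2 zero_le⟩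

theorem exists_total_le (hd : 1 ≤ d) (hα : 0 < α) (hα1 : α < 1) : ∃ m : ℕ, 3 ≤ m ∧
    ∃ A : ℝ, 0 < A ∧ ∀ (r : ℝ) (μ : Measure (Config d)), IsPerc μ (κ.edgePCut κ.betaC r) →
      ∀ k : ℕ, total μ (m ^ k) 0 ≤ A * ((m ^ k : ℕ) : ℝ) ^ ((d : ℝ) + α) := by
  obtain ⟨m, hm3, hN, hγ⟩ := exists_scale (α := α) hd hα1
  refine ⟨m, hm3, ?_⟩
  rcases κ.betaC_nonneg.eq_or_lt with h0 | hpos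
  · refine ⟨1, one_pos, fun r μ h k => ?_⟩
    refine (h.total_le_of_eq_zero (fun e => ?_) _).trans ?_
    · induction e with
      | _ x y => rw [edgePCut_mk, ← h0, zero_mul, edgeProb, neg_zero, Real.exp_zero, sub_self]
    · have h1 : (1 : ℝ) ≤ (m ^ k : ℕ) := by exact_mod_cast Nat.one_le_pow _ _ (by omega)
      rw [one_mul, ← Real.rpow_natCast _ d]
      exact Real.rpow_le_rpow_of_exponent_le h1 (by linarith)
  obtain ⟨c, hc, hl⟩ := κ.exists_lower hd hα
  obtain ⟨A, hA, hbd⟩ := LRP.exists_total_le (d := d) (m := m) (by omega) hN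
    (σ := (d : ℝ) + α) (by positivity) hγ (b₀ := κ.betaC / 2 * c) (b₁ := κ.betaC * c) (by positivity)
  refine ⟨A, hA, fun r μ h k => ?_⟩
  have h1 : totalPf (κ.edgeP κ.betaC) (m ^ k) ≤ A * ((m ^ k : ℕ) : ℝ) ^ ((d : ℝ) + α) := by
    have hcont : Continuous fun β => totalPf (κ.edgeP β) (m ^ k) :=
      continuous_finsetSum _ fun x _ => continuous_finsetSum _ fun y _ =>
        continuous_Pf _ _ κ.continuous_edgeP _
    refine le_of_tendsto (hcont.continuousAt.tendsto.mono_left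
      (nhdsWithin_le_nhds (s := Set.Iio κ.betaC))) ?_
    filter_upwards [Ioo_mem_nhdsLT (half_lt_self hpos)] with β hβ
    have hβ0 : 0 ≤ β := by linarith [hβ.1]
    obtain ⟨ν, hν, hν0⟩ := κ.exists_no_percolation hβ0 hβ.2
    rw [← hν.total_eq_totalPf (κ.edgeP_mem hβ0)]
    exact hbd (β * c) ν _ hν (κ.edgeP_mem hβ0) (κ.edgeP_transInv β) (hl β hβ0)
      (by nlinarith [hβ.1]) (by nlinarith [hβ.2]) hν0 k
  rw [h.total_eq_totalPf (κ.edgePCut_mem κ.betaC_nonneg r)]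
  exact (totalPf_mono (κ.edgePCut_mem κ.betaC_nonneg r) (κ.edgeP_mem κ.betaC_nonneg)
    (κ.edgePCut_le κ.betaC_nonneg r) _).trans h1

theorem exists_meanIn_cube_le (hd : 1 ≤ d) (hα : 0 < α) (hα1 : α < 1) :
    ∃ A : ℝ, 0 < A ∧ ∀ (r : ℝ) (μ : Measure (Config d)), IsPerc μ (κ.edgePCut κ.betaC r) →
      ∀ R : ℕ, 1 ≤ R → meanIn μ (cube d R) 0 ≤ A * (R : ℝ) ^ α := by
  obtain ⟨m, hm3, A, hA, hbd⟩ := κ.exists_total_le hd hα hα1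
  have hm1 : (3 : ℝ) ≤ m := by exact_mod_cast hm3
  refine ⟨A * 2 ^ d * (4 * m) ^ α, by positivity, fun r μ h R hR => ?_⟩
  have hR1 : (1 : ℝ) ≤ R := by exact_mod_cast hR
  obtain ⟨k, hk1, hk2⟩ := exists_nat_pow_near (x := 4 * (R : ℝ)) (y := m) (by linarith)
    (by linarith)
  set L : ℕ := m ^ (k + 1) with hL
  have hLR : 4 * R ≤ L := by
    rw [hL]
    exact_mod_cast hk2.le
  have hL0 : (0 : ℝ) < L := by rw [hL]; positivity
  have hL2 : (L : ℝ) ≤ 4 * m * R := by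
    rw [hL]
    push_cast
    rw [pow_succ]
    nlinarith
  have h1 := (h.meanIn_cube_le (κ.edgePCut_mem κ.betaC_nonneg r) (κ.edgePCut_transInv _ _)
    hLR).trans (hbd r μ h (k + 1))
  rw [Real.rpow_add hL0, Real.rpow_natCast] at h1
  have h2 : 0 < ((L : ℝ) / 2) ^ d := by positivity
  have h3 : meanIn μ (cube d R) 0 ≤ A * 2 ^ d * (L : ℝ) ^ α := by
    refine le_of_mul_le_mul_left (h1.trans (le_of_eq ?_)) h2
    rw [div_pow]
    field_simp
  refine h3.trans ?_
  rw [mul_assoc (A * 2 ^ d), ← Real.mul_rpow (by positivity) (by positivity)]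
  gcongr

end Kernel

/-! ## The boundary functional -/

/-- The expected number of open edges from the cluster of the origin in the cube of radius `j` to
the outside of the cube. -/
noncomputable def phi {d : ℕ} (μ : Measure (Config d)) (p : Sym2 (V d) → ℝ) (j : ℕ) : ℝ≥0∞ :=
  ∑ x ∈ cube d j, ∑' y : V d, if y ∈ cube d j then 0 else
    μ {ω | ConnIn (cube d j) ω 0 x} * ENNReal.ofReal (p s(x, y))

theorem card_cube (d R : ℕ) : (cube d R).card = (2 * R + 1) ^ d := by
  simp only [cube, Fintype.card_piFinset, Int.card_Icc, Finset.prod_const, Finset.card_univ,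
    Fintype.card_fin]
  congr 1
  omega

theorem exists_tsum_norm_le {d : ℕ} {α : ℝ} (hd : 1 ≤ d) (hα : 0 < α) (hα1 : α < 1) :
    ∃ D : ℝ, 0 < D ∧ ∀ ρ : ℝ, 1 ≤ ρ →
      ∑' w : V d, (if w ≠ 0 ∧ ‖w‖ ≤ ρ then ENNReal.ofReal (‖w‖ ^ (1 - ((d : ℝ) + α))) else 0) ≤
        ENNReal.ofReal (D * ρ ^ (1 - α)) := by
  have hd1 : (1 : ℝ) ≤ d := by exact_mod_cast hd
  set q : ℝ := 2 ^ (1 - α) with hq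
  have hq1 : 1 < q := Real.one_lt_rpow one_lt_two (sub_pos.2 hα1)
  have hq0 : 0 < q - 1 := by linarith
  refine ⟨5 ^ d * (q / (q - 1)), by positivity, fun ρ hρ => ?_⟩
  obtain ⟨K, hK1, hK2⟩ := exists_nat_pow_near hρ one_lt_two
  set a : ℕ → ℝ := fun k => ((2 : ℝ) ^ k) ^ (1 - ((d : ℝ) + α)) with ha
  have ha0 : ∀ k, 0 ≤ a k := fun k => by positivity
  have hpt : ∀ w : V d, (if w ≠ 0 ∧ ‖w‖ ≤ ρ then
      ENNReal.ofReal (‖w‖ ^ (1 - ((d : ℝ) + α))) else 0) ≤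
      ∑ k ∈ Finset.range (K + 1), if w ∈ cube d (2 ^ (k + 1)) then ENNReal.ofReal (a k) else 0 := by
    intro w
    split_ifs with hw
    · obtain ⟨k, hk1, hk2⟩ := exists_nat_pow_near (one_le_norm hw.1) one_lt_two
      have hkK : k < K + 1 := by
        have : (2 : ℝ) ^ k < 2 ^ (K + 1) := (hk1.trans hw.2).trans_lt hK2
        exact (pow_lt_pow_iff_right₀ (one_lt_two (α := ℝ))).1 this
      have hmem : w ∈ cube d (2 ^ (k + 1)) := by
        rw [mem_cube]
        exact_mod_cast hk2.le
      refine le_trans ?_ (Finset.single_le_sum (fun _ _ => zero_le) (Finset.mem_range.2 hkK))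
      rw [if_pos hmem]
      exact ENNReal.ofReal_le_ofReal
        (Real.rpow_le_rpow_of_nonpos (by positivity) hk1 (by linarith))
    · exact zero_le
  have hone : ∀ k, (2 * 2 ^ (k + 1) + 1 : ℝ) ^ d * a k ≤ 5 ^ d * q ^ k := by
    intro k
    have h1 : (1 : ℝ) ≤ 2 ^ k := one_le_pow₀ one_le_two
    have h2 : (2 * 2 ^ (k + 1) + 1 : ℝ) ^ d ≤ (5 * 2 ^ k) ^ d := by
      refine pow_le_pow_left₀ (by positivity) ?_ d
      rw [pow_succ]
      linarith
    have h3 : ((2 : ℝ) ^ k) ^ d * a k = q ^ k := by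
      rw [ha, ← Real.rpow_natCast _ d]
      beta_reduce
      rw [← Real.rpow_add (by positivity), hq, ← Real.rpow_natCast, ← Real.rpow_natCast,
        ← Real.rpow_mul zero_le_two, ← Real.rpow_mul zero_le_two]
      congr 1
      ring
    calc (2 * 2 ^ (k + 1) + 1 : ℝ) ^ d * a k ≤ (5 * 2 ^ k) ^ d * a k :=
          mul_le_mul_of_nonneg_right h2 (ha0 k)
      _ = _ := by rw [mul_pow, mul_assoc, h3]
  calc ∑' w : V d, (if w ≠ 0 ∧ ‖w‖ ≤ ρ then ENNReal.ofReal (‖w‖ ^ (1 - ((d : ℝ) + α))) else 0)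
      ≤ ∑' w : V d, ∑ k ∈ Finset.range (K + 1),
          if w ∈ cube d (2 ^ (k + 1)) then ENNReal.ofReal (a k) else 0 := ENNReal.tsum_le_tsum hpt
    _ = ∑ k ∈ Finset.range (K + 1), ∑' w : V d,
          if w ∈ cube d (2 ^ (k + 1)) then ENNReal.ofReal (a k) else 0 :=
        Summable.tsum_finsetSum fun _ _ => ENNReal.summable
    _ = ∑ k ∈ Finset.range (K + 1), ENNReal.ofReal ((2 * 2 ^ (k + 1) + 1) ^ d * a k) := by
        refine Finset.sum_congr rfl fun k _ => ?_
        rw [tsum_eq_sum (s := cube d (2 ^ (k + 1))) fun w hw => if_neg hw,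
          Finset.sum_congr rfl fun w hw => if_pos hw, Finset.sum_const, card_cube, nsmul_eq_mul,
          ENNReal.ofReal_mul (by positivity)]
        congr 1
        rw [← ENNReal.ofReal_natCast]
        push_cast
        rfl
    _ ≤ ∑ k ∈ Finset.range (K + 1), ENNReal.ofReal (5 ^ d * q ^ k) :=
        Finset.sum_le_sum fun k _ => ENNReal.ofReal_le_ofReal (hone k)
    _ = ENNReal.ofReal (5 ^ d * ∑ k ∈ Finset.range (K + 1), q ^ k) := by
        rw [Finset.mul_sum, ENNReal.ofReal_sum_of_nonneg fun k _ => by positivity]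
    _ ≤ _ := by
        refine ENNReal.ofReal_le_ofReal ?_
        rw [mul_assoc, geom_sum_eq hq1.ne']
        refine mul_le_mul_of_nonneg_left ?_ (by positivity)
        rw [div_mul_eq_mul_div]
        refine div_le_div_of_nonneg_right ?_ hq0.le
        have h1 : q ^ K ≤ ρ ^ (1 - α) := by
          rw [hq, ← Real.rpow_natCast, ← Real.rpow_mul zero_le_two, mul_comm,
            Real.rpow_mul zero_le_two, Real.rpow_natCast]
          exact Real.rpow_le_rpow (by positivity) hK1 (by linarith)
        have h2 : 0 < q := by linarith
        rw [pow_succ]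
        nlinarith

section Average

variable {d : ℕ} {μ : Measure (Config d)} {p : Sym2 (V d) → ℝ}

theorem card_crossing_le (x y : V d) (R : ℕ) :
    (((Finset.Ico R (2 * R)).filter fun j => x ∈ cube d j ∧ y ∉ cube d j).card : ℝ) ≤
      2 * ‖x - y‖ := by
  rcases eq_or_ne x y with rfl | hxy
  · simp
  have h1 : (Finset.Ico R (2 * R)).filter (fun j => x ∈ cube d j ∧ y ∉ cube d j) ⊆
      Finset.Ico ⌈‖x‖⌉₊ ⌈‖y‖⌉₊ := fun j hj => by
    obtain ⟨-, h2, h3⟩ := Finset.mem_filter.1 hj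
    rw [mem_cube] at h2 h3
    exact Finset.mem_Ico.2 ⟨Nat.ceil_le.2 h2, Nat.lt_ceil.2 (not_le.1 h3)⟩
  have h2 := Finset.card_le_card h1
  rw [Nat.card_Ico] at h2
  have h3 := one_le_norm (sub_ne_zero.2 hxy)
  have h4 := Nat.le_ceil ‖x‖
  have h5 := Nat.ceil_lt_add_one (norm_nonneg y)
  have h6 := norm_sub_norm_le y x
  rw [norm_sub_rev] at h6
  refine (Nat.cast_le.2 h2).trans ?_
  rcases le_total ⌈‖y‖⌉₊ ⌈‖x‖⌉₊ with h7 | h7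
  · rw [Nat.sub_eq_zero_of_le h7, Nat.cast_zero]
    linarith
  · rw [Nat.cast_sub h7]
    linarith

theorem sum_phi_le [IsFiniteMeasure μ] (hp : ∀ e, 0 ≤ p e) {B : ℝ≥0∞}
    (hB : ∀ x : V d, ∑' y : V d, ENNReal.ofReal (p s(x, y) * ‖x - y‖) ≤ B) (R : ℕ) :
    ∑ j ∈ Finset.Ico R (2 * R), phi μ p j ≤
      ENNReal.ofReal (meanIn μ (cube d (2 * R)) 0) * (2 * B) := by
  set τ : V d → ℝ≥0∞ := fun x => μ {ω | ConnIn (cube d (2 * R)) ω 0 x} with hτ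
  have h1 : ∀ j ∈ Finset.Ico R (2 * R), phi μ p j ≤ ∑ x ∈ cube d (2 * R), ∑' y : V d,
      if x ∈ cube d j ∧ y ∉ cube d j then τ x * ENNReal.ofReal (p s(x, y)) else 0 := by
    intro j hj
    have hsub : cube d j ⊆ cube d (2 * R) := cube_mono (Finset.mem_Ico.1 hj).2.le
    refine le_trans (Finset.sum_le_sum fun x hx => ENNReal.tsum_le_tsum fun y => ?_)
      (Finset.sum_le_sum_of_subset hsub)
    by_cases hy : y ∈ cube d j
    · rw [if_pos hy]
      exact zero_le
    · rw [if_neg hy, if_pos ⟨hx, hy⟩]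
      exact mul_le_mul_left (measure_mono fun ω hω => ConnIn.mono hsub hω) _
  have h2 : ∀ x y : V d, ∑ j ∈ Finset.Ico R (2 * R),
      (if x ∈ cube d j ∧ y ∉ cube d j then τ x * ENNReal.ofReal (p s(x, y)) else 0) ≤
        τ x * (2 * ENNReal.ofReal (p s(x, y) * ‖x - y‖)) := by
    intro x y
    rw [← Finset.sum_filter, Finset.sum_const, nsmul_eq_mul, mul_left_comm]
    refine mul_le_mul_right ?_ _
    rw [← ENNReal.ofReal_natCast, ← ENNReal.ofReal_mul (Nat.cast_nonneg _),
      ← ENNReal.ofReal_ofNat, ← ENNReal.ofReal_mul zero_le_two]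
    refine ENNReal.ofReal_le_ofReal ?_
    have := mul_le_mul_of_nonneg_left (card_crossing_le x y R) (hp s(x, y))
    linarith
  calc ∑ j ∈ Finset.Ico R (2 * R), phi μ p j
      ≤ ∑ j ∈ Finset.Ico R (2 * R), ∑ x ∈ cube d (2 * R), ∑' y : V d,
        if x ∈ cube d j ∧ y ∉ cube d j then τ x * ENNReal.ofReal (p s(x, y)) else 0 :=
        Finset.sum_le_sum h1
    _ = ∑ x ∈ cube d (2 * R), ∑' y : V d, ∑ j ∈ Finset.Ico R (2 * R),
        if x ∈ cube d j ∧ y ∉ cube d j then τ x * ENNReal.ofReal (p s(x, y)) else 0 := by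
        rw [Finset.sum_comm]
        exact Finset.sum_congr rfl fun x _ =>
          (Summable.tsum_finsetSum fun _ _ => ENNReal.summable).symm
    _ ≤ ∑ x ∈ cube d (2 * R), τ x * (2 * B) := Finset.sum_le_sum fun x _ => by
        refine (ENNReal.tsum_le_tsum (h2 x)).trans ?_
        rw [ENNReal.tsum_mul_left, ENNReal.tsum_mul_left]
        gcongr
        exact hB x
    _ = _ := by
        rw [← Finset.sum_mul, meanIn, ENNReal.ofReal_sum_of_nonneg fun _ _ => measureReal_nonneg]
        congr 1
        exact Finset.sum_congr rfl fun x _ => by rw [ofReal_measureReal]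

end Average

namespace Kernel

variable {d : ℕ} {α : ℝ} (κ : Kernel d α)

theorem exists_norm_sub_le (hd : 1 ≤ d) : ∃ c : ℝ, 1 ≤ c ∧ ∀ (β r : ℝ) (x y : V d),
    κ.edgePCut β r s(x, y) ≠ 0 → x ≠ y ∧ ‖x - y‖ ≤ c * r := by
  obtain ⟨c, hc, h⟩ := κ.exists_le_nd hd
  refine ⟨max c⁻¹ 1, le_max_right _ _, fun β r x y hp => ?_⟩
  have h1 : x ≠ y ∧ κ.nd x y ≤ r := by
    by_contra hn
    rw [edgePCut_mk, kerCut, if_neg hn, mul_zero, edgeProb, neg_zero, Real.exp_zero, sub_self] at hp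
    exact hp rfl
  refine ⟨h1.1, ?_⟩
  have h2 := (h x y).trans h1.2
  have hr : 0 ≤ r := (κ.nd_pos h1.1).le.trans h1.2
  calc ‖x - y‖ = c⁻¹ * (c * ‖x - y‖) := by field_simp
    _ ≤ c⁻¹ * r := by gcongr
    _ ≤ _ := by gcongr; exact le_max_left _ _

theorem exists_tsum_edge_le (hd : 1 ≤ d) (hα : 0 < α) (hα1 : α < 1) {β : ℝ} (hβ : 0 ≤ β) :
    ∃ D : ℝ, 0 < D ∧ ∀ r : ℝ, 1 ≤ r → ∀ x : V d,
      ∑' y : V d, ENNReal.ofReal (κ.edgePCut β r s(x, y) * ‖x - y‖) ≤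
        ENNReal.ofReal (D * r ^ (1 - α)) := by
  obtain ⟨c, hc, hnorm⟩ := κ.exists_norm_sub_le hd
  obtain ⟨C, hC, hker⟩ := κ.exists_kerCut_le hd hα
  obtain ⟨D, hD, hsum⟩ := exists_tsum_norm_le (d := d) hd hα hα1
  refine ⟨(β * C + 1) * (D * c ^ (1 - α)), by positivity, fun r hr x => ?_⟩
  set g : V d → ℝ≥0∞ := fun w =>
    if w ≠ 0 ∧ ‖w‖ ≤ c * r then ENNReal.ofReal (‖w‖ ^ (1 - ((d : ℝ) + α))) else 0 with hg
  have hpt : ∀ y, ENNReal.ofReal (κ.edgePCut β r s(x, y) * ‖x - y‖) ≤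
      ENNReal.ofReal (β * C + 1) * g (x - y) := by
    intro y
    by_cases h0 : κ.edgePCut β r s(x, y) = 0
    · rw [h0, zero_mul, ENNReal.ofReal_zero]
      exact zero_le
    · obtain ⟨hxy, hle⟩ := hnorm β r x y h0
      have hx := one_le_norm (sub_ne_zero.2 hxy)
      rw [hg]
      beta_reduce
      rw [if_pos ⟨sub_ne_zero.2 hxy, hle⟩, ← ENNReal.ofReal_mul (by positivity)]
      refine ENNReal.ofReal_le_ofReal ?_
      have h1 : κ.edgePCut β r s(x, y) ≤ β * (C * ‖x - y‖ ^ (-((d : ℝ) + α))) :=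
        (edgeProb_le _).trans (mul_le_mul_of_nonneg_left (hker r x y) hβ)
      have h2 : ‖x - y‖ ^ (-((d : ℝ) + α)) * ‖x - y‖ = ‖x - y‖ ^ (1 - ((d : ℝ) + α)) := by
        rw [← Real.rpow_add_one (by linarith)]
        congr 1
        ring
      calc κ.edgePCut β r s(x, y) * ‖x - y‖
          ≤ β * (C * ‖x - y‖ ^ (-((d : ℝ) + α))) * ‖x - y‖ := by gcongr
        _ = β * C * ‖x - y‖ ^ (1 - ((d : ℝ) + α)) := by rw [← h2]; ring
        _ ≤ _ := by
          gcongr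
          linarith
  refine (ENNReal.tsum_le_tsum hpt).trans ?_
  have hshift : ∑' y, g (x - y) = ∑' w, g w := (Equiv.subLeft x).tsum_eq g
  rw [ENNReal.tsum_mul_left, hshift, mul_assoc,
    ENNReal.ofReal_mul (by positivity)]
  gcongr
  refine (hsum (c * r) (by nlinarith)).trans (le_of_eq ?_)
  rw [Real.mul_rpow (by linarith) (by linarith), mul_assoc]

theorem exists_phi_le (hd : 1 ≤ d) (hα : 0 < α) (hα1 : α < 1) :
    ∃ C : ℝ, 0 < C ∧ ∀ r : ℝ, 1 ≤ r → ∀ μ : Measure (Config d),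
      IsPerc μ (κ.edgePCut κ.betaC r) →
        ∃ j : ℕ, (j : ℝ) ≤ C * r ∧ phi μ (κ.edgePCut κ.betaC r) j ≤ 2⁻¹ := by
  obtain ⟨A, hA, hmean⟩ := κ.exists_meanIn_cube_le hd hα hα1
  obtain ⟨D, hD, hedge⟩ := κ.exists_tsum_edge_le hd hα hα1 κ.betaC_nonneg
  have ha : 0 < 1 - α := sub_pos.2 hα1
  set C : ℝ := (8 * A * D) ^ (1 - α)⁻¹ with hC
  have hC0 : 0 < C := by positivity
  refine ⟨2 * C + 4, by positivity, fun r hr μ h => ?_⟩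
  have := h.1
  set R : ℕ := ⌈C * r⌉₊ with hR
  have hr0 : 0 < r := by linarith
  have hCr : 0 < C * r := by positivity
  have hR1 : 1 ≤ R := Nat.one_le_ceil_iff.2 hCr
  have hR2 : C * r ≤ R := Nat.le_ceil _
  have hR3 : (R : ℝ) ≤ C * r + 1 := (Nat.ceil_lt_add_one hCr.le).le
  have hR0 : (0 : ℝ) < R := by positivity
  have h1 := sum_phi_le (μ := μ) (fun e => (κ.edgePCut_mem κ.betaC_nonneg r e).1) (hedge r hr) R
  have h2 := hmean r μ h (2 * R) (by omega)
  have h3 : A * ((2 * R : ℕ) : ℝ) ^ α * (2 * (D * r ^ (1 - α))) ≤ R * 2⁻¹ := by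
    have h4 : ((2 * R : ℕ) : ℝ) ^ α ≤ 2 * (R : ℝ) ^ α := by
      push_cast
      rw [Real.mul_rpow zero_le_two hR0.le]
      gcongr
      exact (Real.rpow_le_rpow_of_exponent_le one_le_two hα1.le).trans (Real.rpow_one 2).le
    have h5 : 8 * A * D * r ^ (1 - α) ≤ (R : ℝ) ^ (1 - α) := by
      have h6 : C ^ (1 - α) = 8 * A * D := by
        rw [hC, Real.rpow_inv_rpow (by positivity) ha.ne']
      rw [← h6, ← Real.mul_rpow hC0.le hr0.le]
      exact Real.rpow_le_rpow hCr.le hR2 ha.le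
    have h7 : (R : ℝ) ^ α * (R : ℝ) ^ (1 - α) = R := by
      rw [← Real.rpow_add hR0]
      simp
    calc A * ((2 * R : ℕ) : ℝ) ^ α * (2 * (D * r ^ (1 - α)))
        ≤ A * (2 * (R : ℝ) ^ α) * (2 * (D * r ^ (1 - α))) := by gcongr
      _ = (R : ℝ) ^ α * (8 * A * D * r ^ (1 - α)) * 2⁻¹ := by ring
      _ ≤ (R : ℝ) ^ α * (R : ℝ) ^ (1 - α) * 2⁻¹ := by gcongr
      _ = _ := by rw [h7]
  have h4 : ∑ j ∈ Finset.Ico R (2 * R), phi μ (κ.edgePCut κ.betaC r) j ≤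
      ∑ j ∈ Finset.Ico R (2 * R), (2⁻¹ : ℝ≥0∞) := by
    refine h1.trans ?_
    rw [Finset.sum_const, Nat.card_Ico, nsmul_eq_mul, show 2 * R - R = R by omega,
      ← ENNReal.ofReal_ofNat, ← ENNReal.ofReal_mul zero_le_two,
      ← ENNReal.ofReal_mul (meanIn_nonneg _ _ _), ← ENNReal.ofReal_natCast,
      ← ENNReal.ofReal_inv_of_pos zero_lt_two, ← ENNReal.ofReal_mul hR0.le]
    refine ENNReal.ofReal_le_ofReal (le_trans ?_ h3)
    gcongr
  obtain ⟨j, hj, hphi⟩ : ∃ j ∈ Finset.Ico R (2 * R), phi μ (κ.edgePCut κ.betaC r) j ≤ 2⁻¹ := by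
    by_contra! hcon
    exact absurd h4 (not_le.2 (ENNReal.sum_lt_sum_of_nonempty
      (Finset.nonempty_Ico.2 (by omega)) hcon))
  refine ⟨j, ?_, hphi⟩
  have h5 : (j : ℝ) ≤ 2 * R := by exact_mod_cast (Finset.mem_Ico.1 hj).2.le
  nlinarith

end Kernel

/-! ## Last exit decomposition -/

section LastExit

variable {Vt : Type*}

/-- The edges that do not touch `A`. -/
def away (A : Finset Vt) : Set (Sym2 Vt) := {e | ∀ v ∈ A, v ∉ e}

theorem mem_away {A : Finset Vt} {x y : Vt} : s(x, y) ∈ away A ↔ x ∉ A ∧ y ∉ A := by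
  constructor
  · exact fun h => ⟨fun hx => h x hx (Sym2.mem_mk_left x y), fun hy => h y hy (Sym2.mem_mk_right x y)⟩
  · rintro ⟨hx, hy⟩ v hv hve
    rcases Sym2.mem_iff.1 hve with rfl | rfl
    · exact hx hv
    · exact hy hv

theorem Conn.last_exit {ω : Sym2 Vt → Bool} {A : Finset Vt} {a z : Vt} (h : Conn ω a z)
    (hz : z ∉ A) : (a ∉ A ∧ Conn (cut (away A) ω) a z) ∨
      ∃ u ∈ A, ∃ v ∉ A, ω s(u, v) = true ∧ Conn (cut (away A) ω) v z := by
  induction h using Relation.ReflTransGen.head_induction_on with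
  | refl => exact Or.inl ⟨hz, Conn.refl _ _⟩
  | @head a b hab _ ih =>
    rcases ih with ⟨hb, hc⟩ | h
    · by_cases ha : a ∈ A
      · exact Or.inr ⟨a, ha, b, hb, hab, hc⟩
      · exact Or.inl ⟨ha, (Conn.of_open (cut_eq_true.2 ⟨mem_away.2 ⟨ha, hb⟩, hab⟩)).trans hc⟩
    · exact Or.inr h

theorem Conn.exists_exit {ω : Sym2 Vt → Bool} {Λ : Finset Vt} {o z : Vt} (h : Conn ω o z)
    (ho : o ∈ Λ) (hz : z ∉ Λ) : ∃ x ∈ clIn Λ o ω, ∃ y ∉ Λ, ω s(x, y) = true ∧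
      Conn (cut (away (clIn Λ o ω)) ω) y z := by
  have hoA : o ∈ clIn Λ o ω := (mem_clIn ho).2 (Conn.refl _ _)
  rcases h.last_exit fun hzA => hz (clIn_subset _ _ _ hzA) with h1 | ⟨x, hx, y, hy, hxy, hc⟩
  · exact absurd hoA h1.1
  · refine ⟨x, hx, y, fun hyΛ => hy ?_, hxy, hc⟩
    exact (mem_clIn ho).2 (Conn.trans ((mem_clIn ho).1 hx)
      (ConnIn.of_open (clIn_subset _ _ _ hx) hyΛ hxy))

/-- The edges inside `Λ` that touch `A`. -/
def touching (Λ A : Finset Vt) : Set (Sym2 Vt) := (Λ.sym2 : Set (Sym2 Vt)) \ away A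

theorem clIn_eq_iff {Λ A : Finset Vt} {o : Vt} (ho : o ∈ Λ) (ω : Sym2 Vt → Bool) :
    clIn Λ o ω = A ↔ clIn Λ o (cut (touching Λ A) ω) = A := by
  have hle : clIn Λ o (cut (touching Λ A) ω) ⊆ clIn Λ o ω := fun y hy => by
    rw [mem_clIn ho] at *
    exact Conn.mono (cut_le_cut _ (cut_le _ _)) hy
  have hge : ∀ B : Finset Vt, o ∈ B → (∀ u ∈ B, ∀ v ∉ B, u ∈ A →
      cut (Λ.sym2 : Set (Sym2 Vt)) ω s(u, v) = true → False) → B ⊆ A → clIn Λ o ω ⊆ B := by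
    intro B hoB hB hBA y hy
    rw [mem_clIn ho] at hy
    by_contra hyB
    obtain ⟨u, v, hu, hv, huv⟩ := Conn.exists_boundary hy (S := (B : Set Vt)) hoB hyB
    exact hB u hu v hv (hBA hu) huv
  have key : clIn Λ o (cut (touching Λ A) ω) ⊆ A →
      clIn Λ o ω ⊆ clIn Λ o (cut (touching Λ A) ω) := by
    intro hA
    refine hge _ ((mem_clIn ho).2 (Conn.refl _ _)) ?_ hA
    intro u hu v hv huA huv
    obtain ⟨hm, ho'⟩ := cut_eq_true.1 huv
    refine hv ((mem_clIn ho).2 (Conn.trans ((mem_clIn ho).1 hu) (Conn.of_open ?_)))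
    exact cut_eq_true.2 ⟨hm, cut_eq_true.2 ⟨⟨hm, fun h => (mem_away.1 h).1 huA⟩, ho'⟩⟩
  constructor
  · intro h
    exact (hle.antisymm (key (hle.trans h.le))).trans h
  · intro h
    exact ((key h.le).antisymm hle).trans h

theorem dependsOn_clIn_eq {Λ A : Finset Vt} {o : Vt} (ho : o ∈ Λ) :
    DependsOn (fun ω => ω ∈ {ω | clIn Λ o ω = A}) (touching Λ A) := by
  have : (fun ω => ω ∈ {ω : Sym2 Vt → Bool | clIn Λ o ω = A}) =
      fun ω => clIn Λ o (cut (touching Λ A) ω) = A := by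
    funext ω
    exact propext (clIn_eq_iff ho ω)
  rw [this]
  exact dependsOn_cut _ fun ω => clIn Λ o ω = A

variable {μ : Measure (Sym2 Vt → Bool)} {p : Sym2 Vt → ℝ}

theorem IsPerc.measure_exit_le [Countable Vt] (h : IsPerc μ p) {Λ : Finset Vt} {o x y : Vt}
    (ho : o ∈ Λ) (hy : y ∉ Λ) (z : Vt) :
    μ {ω | x ∈ clIn Λ o ω ∧ ω s(x, y) = true ∧ Conn (cut (away (clIn Λ o ω)) ω) y z} ≤
      μ {ω | ConnIn Λ ω o x} * ENNReal.ofReal (p s(x, y)) * μ {ω | Conn ω y z} := by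
  set P := Λ.powerset.filter fun A => x ∈ A with hP
  have hA : ∀ A ∈ P, μ ({ω | clIn Λ o ω = A} ∩ ({ω | ω s(x, y) = true} ∩
      {ω | Conn (cut (away A) ω) y z})) ≤
      μ {ω | clIn Λ o ω = A} * (ENNReal.ofReal (p s(x, y)) * μ {ω | Conn ω y z}) := by
    intro A hA
    have hxA : x ∈ A := (Finset.mem_filter.1 hA).2
    have hm : MeasurableSet {ω : Sym2 Vt → Bool | Conn (cut (away A) ω) y z} :=
      measurable_cut (away A) (measurableSet_conn y z)
    have hd1 : DependsOn (fun ω => ω ∈ {ω : Sym2 Vt → Bool | ω s(x, y) = true}) {s(x, y)} :=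
      fun ω ω' hω => by simp [hω s(x, y) rfl]
    have hd2 : DependsOn (fun ω => ω ∈ {ω : Sym2 Vt → Bool | Conn (cut (away A) ω) y z})
        (away A) := dependsOn_cut _ fun ω => Conn ω y z
    have hd3 : DependsOn (fun ω => ω ∈ ({ω : Sym2 Vt → Bool | ω s(x, y) = true} ∩
        {ω | Conn (cut (away A) ω) y z})) ({s(x, y)} ∪ away A) := fun ω ω' hω => by
      have e1 := hd1 fun i hi => hω i (Or.inl hi)
      have e2 := hd2 fun i hi => hω i (Or.inr hi)
      exact congrArg₂ And e1 e2
    rw [h.indep _ (measurableSet_clIn_eq Λ o A) ((measurableSet_open _).inter hm)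
      (dependsOn_clIn_eq ho) hd3, h.indep _ (measurableSet_open _) hm hd1 hd2, h.measure_open]
    · gcongr
      exact fun hω => Conn.mono (cut_le _ _) hω
    · exact Set.disjoint_singleton_left.2 fun hs => (mem_away.1 hs).1 hxA
    · refine Set.disjoint_union_right.2 ⟨Set.disjoint_singleton_right.2 fun hs => hy ?_,
        Set.disjoint_sdiff_left⟩
      have := hs.1
      simp only [Finset.mem_coe, Finset.mk_mem_sym2_iff] at this
      exact this.2
  calc _ ≤ μ (⋃ A ∈ P, {ω | clIn Λ o ω = A} ∩ ({ω | ω s(x, y) = true} ∩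
        {ω | Conn (cut (away A) ω) y z})) := by
        refine MeasureTheory.measure_mono ?_
        rintro ω ⟨h1, h2, h3⟩
        exact Set.mem_biUnion (x := clIn Λ o ω)
          (Finset.mem_filter.2 ⟨Finset.mem_powerset.2 (clIn_subset _ _ _), h1⟩) ⟨rfl, h2, h3⟩
    _ ≤ ∑ A ∈ P, μ {ω | clIn Λ o ω = A} * (ENNReal.ofReal (p s(x, y)) * μ {ω | Conn ω y z}) :=
        (measure_biUnion_finset_le _ _).trans (Finset.sum_le_sum hA)
    _ = μ {ω | ConnIn Λ ω o x} * (ENNReal.ofReal (p s(x, y)) * μ {ω | Conn ω y z}) := by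
        rw [← Finset.sum_mul]
        congr 1
        rw [← measure_biUnion_finset _ fun A _ => measurableSet_clIn_eq Λ o A]
        · congr 1
          ext ω
          simp [hP, clIn_subset, mem_clIn ho]
        · intro A _ B _ hAB
          refine Set.disjoint_left.2 ?_
          rintro ω rfl h2
          exact hAB h2
    _ = _ := (mul_assoc _ _ _).symm

end LastExit

/-! ## Exponential decay of the two-point function beyond the scale `ρ` -/

section Decay

variable {d : ℕ} {μ : Measure (Config d)} {p : Sym2 (V d) → ℝ}

/-- The two-point function. -/
noncomputable def tau (μ : Measure (Config d)) (z : V d) : ℝ≥0∞ := μ {ω | Conn ω 0 z}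

theorem IsPerc.measure_conn (h : IsPerc μ p) (hp : ∀ e, 0 ≤ p e ∧ p e ≤ 1) (ht : TransInv p)
    (y z : V d) : μ {ω | Conn ω y z} = tau μ (z - y) := by
  rw [tau, ← h.measure_shift hp ht y (measurableSet_conn 0 (z - y))]
  congr 1
  ext ω
  simp [conn_shift]

theorem IsPerc.tau_le (h : IsPerc μ p) (hp : ∀ e, 0 ≤ p e ∧ p e ≤ 1) (ht : TransInv p)
    {j : ℕ} {z : V d} (hz : z ∉ cube d j) :
    tau μ z ≤ ∑ x ∈ cube d j, ∑' y : V d, if y ∈ cube d j then 0 else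
      μ {ω | ConnIn (cube d j) ω 0 x} * ENNReal.ofReal (p s(x, y)) * tau μ (z - y) := by
  set Λ := cube d j
  calc tau μ z ≤ μ (⋃ x ∈ Λ, ⋃ y : V d, if y ∈ Λ then ∅ else
        {ω | x ∈ clIn Λ 0 ω ∧ ω s(x, y) = true ∧ Conn (cut (away (clIn Λ 0 ω)) ω) y z}) := by
        refine MeasureTheory.measure_mono fun ω hω => ?_
        obtain ⟨x, hx, y, hy, hxy, hc⟩ := Conn.exists_exit hω (zero_mem_cube j) hz
        refine Set.mem_biUnion (clIn_subset _ _ _ hx) (Set.mem_iUnion.2 ⟨y, ?_⟩)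
        rw [if_neg hy]
        exact ⟨hx, hxy, hc⟩
    _ ≤ _ := by
        refine (measure_biUnion_finset_le _ _).trans (Finset.sum_le_sum fun x _ => ?_)
        refine (measure_iUnion_le _).trans (ENNReal.tsum_le_tsum fun y => ?_)
        split_ifs with hy
        · simp
        · rw [← h.measure_conn hp ht y z]
          exact h.measure_exit_le (zero_mem_cube j) hy z

/-- The contribution to the susceptibility of the points at distance at least `t`. -/
noncomputable def tail (μ : Measure (Config d)) (t : ℝ) : ℝ≥0∞ :=
  ∑' z : V d, if t ≤ ‖z‖ then tau μ z else 0

theorem IsPerc.tail_add_le (h : IsPerc μ p) (hp : ∀ e, 0 ≤ p e ∧ p e ≤ 1) (ht : TransInv p)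
    {j : ℕ} {ρ t : ℝ} (hj : (j : ℝ) < ρ) (ht0 : 0 ≤ t)
    (hρ : ∀ x ∈ cube d j, ∀ y, p s(x, y) ≠ 0 → ‖y‖ ≤ ρ) :
    tail μ (t + ρ) ≤ phi μ p j * tail μ t := by
  set w : V d → V d → ℝ≥0∞ := fun x y => if y ∈ cube d j then 0 else
    μ {ω | ConnIn (cube d j) ω 0 x} * ENNReal.ofReal (p s(x, y)) with hw
  calc tail μ (t + ρ) ≤ ∑' z : V d, ∑ x ∈ cube d j, ∑' y : V d,
        w x y * (if t ≤ ‖z - y‖ then tau μ (z - y) else 0) := by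
        refine ENNReal.tsum_le_tsum fun z => ?_
        split_ifs with hz
        · have hzc : z ∉ cube d j := fun hzc => by
            rw [mem_cube] at hzc
            linarith
          refine (h.tau_le hp ht hzc).trans (Finset.sum_le_sum fun x hx =>
            ENNReal.tsum_le_tsum fun y => ?_)
          by_cases hy : y ∈ cube d j
          · simp [hy]
          · by_cases hpe : p s(x, y) = 0
            · simp [hpe]
            · have h1 : t ≤ ‖z - y‖ := by
                have h2 := hρ x hx y hpe
                have h3 := norm_sub_norm_le z y
                linarith
              simp [hw, hy, h1]
        · exact zero_le
    _ = ∑ x ∈ cube d j, ∑' y : V d, w x y * tail μ t := by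
        rw [Summable.tsum_finsetSum fun _ _ => ENNReal.summable]
        refine Finset.sum_congr rfl fun x _ => ?_
        rw [ENNReal.tsum_comm]
        refine tsum_congr fun y => ?_
        rw [ENNReal.tsum_mul_left, tail]
        congr 1
        exact (Equiv.subRight y).tsum_eq fun z : V d => if t ≤ ‖z‖ then tau μ z else 0
    _ = phi μ p j * tail μ t := by
        simp only [ENNReal.tsum_mul_right]
        rw [← Finset.sum_mul, phi]

theorem IsPerc.tail_le (h : IsPerc μ p) (hp : ∀ e, 0 ≤ p e ∧ p e ≤ 1) (ht : TransInv p)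
    {j : ℕ} {ρ : ℝ} (hj : (j : ℝ) < ρ)
    (hρ : ∀ x ∈ cube d j, ∀ y, p s(x, y) ≠ 0 → ‖y‖ ≤ ρ) (hφ : phi μ p j ≤ 2⁻¹) (k : ℕ) :
    tail μ (k * ρ) ≤ 2⁻¹ ^ k * ∑' z, tau μ z := by
  have hρ0 : 0 ≤ ρ := (Nat.cast_nonneg j).trans hj.le
  induction k with
  | zero =>
    rw [pow_zero, one_mul]
    refine ENNReal.tsum_le_tsum fun z => ?_
    split_ifs
    · exact le_rfl
    · exact zero_le
  | succ k ih =>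
    rw [Nat.cast_succ, add_mul, one_mul]
    refine (h.tail_add_le hp ht hj (by positivity) hρ).trans ?_
    rw [pow_succ', mul_assoc]
    exact mul_le_mul' hφ ih

end Decay

/-! ## The radius of gyration -/

section Gyration

variable {d : ℕ} {μ : Measure (Config d)} {p : Sym2 (V d) → ℝ}

theorem lintegral_tsum_cluster (μ : Measure (Config d)) (f : V d → ℝ≥0∞) :
    ∫⁻ ω, ∑' x : cluster ω (0 : V d), f x ∂μ = ∑' z, f z * tau μ z := by
  have h1 : ∀ ω : Config d, ∑' x : cluster ω (0 : V d), f x =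
      ∑' z, {ω : Config d | Conn ω 0 z}.indicator (fun _ => f z) ω := fun ω => by
    rw [tsum_subtype (cluster ω 0) f]
    rfl
  simp only [h1]
  rw [lintegral_tsum fun z => (measurable_const.indicator (measurableSet_conn 0 z)).aemeasurable]
  refine tsum_congr fun z => ?_
  rw [lintegral_indicator_const (measurableSet_conn 0 z), tau]

theorem eCard_eq_tsum {Vt : Type*} (s : Set Vt) : eCard s = ∑' _ : s, (1 : ℝ≥0∞) := by
  rw [ENNReal.tsum_set_one, eCard]
  split_ifs with hs
  · rw [← hs.cast_ncard_eq, ENat.toENNReal_coe]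
  · rw [Set.Infinite.encard_eq hs, ENat.toENNReal_top]

theorem clMom_one (μ : Measure (Config d)) : clMom μ 1 = ∑' z, tau μ z := by
  simp only [clMom, pow_one, eCard_eq_tsum]
  rw [lintegral_tsum_cluster μ fun _ => 1]
  simp

theorem enorm2_le (z : V d) : enorm2 z ≤ d * ‖z‖ := by
  rw [enorm2]
  refine Real.sqrt_le_iff.2 ⟨by positivity, ?_⟩
  have h1 : ∀ i, ((z i : ℝ)) ^ 2 ≤ ‖z‖ ^ 2 := fun i => by
    have := norm_le_pi_norm z i
    rw [Int.norm_eq_abs] at this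
    rw [← sq_abs]
    exact pow_le_pow_left₀ (abs_nonneg _) this 2
  calc ∑ i, ((z i : ℝ)) ^ 2 ≤ ∑ _i : Fin d, ‖z‖ ^ 2 := Finset.sum_le_sum fun i _ => h1 i
    _ = d * ‖z‖ ^ 2 := by simp
    _ ≤ (d * ‖z‖) ^ 2 := by
        rw [mul_pow]
        refine mul_le_mul_of_nonneg_right ?_ (sq_nonneg _)
        exact_mod_cast Nat.le_self_pow two_ne_zero d

theorem summable_rpow_mul_half_pow (q : ℝ) :
    Summable fun k : ℕ => ((k : ℝ) + 1) ^ q * 2⁻¹ ^ k := by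
  have h1 : Summable fun k : ℕ => ((k : ℝ) ^ ⌈q⌉₊ * 2⁻¹ ^ k) :=
    summable_pow_mul_geometric_of_norm_lt_one _ (by norm_num)
  have h2 : Summable fun k : ℕ => 2 * (((k + 1 : ℕ) : ℝ) ^ ⌈q⌉₊ * 2⁻¹ ^ (k + 1)) :=
    ((summable_nat_add_iff 1).2 h1).mul_left 2
  refine Summable.of_nonneg_of_le (fun k => by positivity) (fun k => ?_) h2
  have h3 : ((k : ℝ) + 1) ^ q ≤ ((k : ℝ) + 1) ^ ⌈q⌉₊ := by
    rw [← Real.rpow_natCast]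
    exact Real.rpow_le_rpow_of_exponent_le (by linarith [(Nat.cast_nonneg k : (0 : ℝ) ≤ k)])
      (Nat.le_ceil q)
  calc ((k : ℝ) + 1) ^ q * 2⁻¹ ^ k ≤ ((k : ℝ) + 1) ^ ⌈q⌉₊ * 2⁻¹ ^ k := by gcongr
    _ = _ := by
        push_cast
        ring

theorem IsPerc.gyr_le (h : IsPerc μ p) (hp : ∀ e, 0 ≤ p e ∧ p e ≤ 1) (ht : TransInv p)
    {j : ℕ} {ρ : ℝ} (hj : (j : ℝ) < ρ)
    (hρ : ∀ x ∈ cube d j, ∀ y, p s(x, y) ≠ 0 → ‖y‖ ≤ ρ) (hφ : phi μ p j ≤ 2⁻¹)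
    {q : ℝ} (hq : 0 < q) :
    gyr μ q ≤ ENNReal.ofReal ((d * ρ) ^ q * ∑' k : ℕ, ((k : ℝ) + 1) ^ q * 2⁻¹ ^ k) *
      clMom μ 1 := by
  have hρ0 : 0 < ρ := (Nat.cast_nonneg j).trans_lt hj
  set a : ℕ → ℝ := fun k => (d * ρ) ^ q * ((k : ℝ) + 1) ^ q with ha
  have ha0 : ∀ k, 0 ≤ a k := fun k => by positivity
  have hpt : ∀ z : V d, ENNReal.ofReal (enorm2 z ^ q) * tau μ z ≤
      ∑' k : ℕ, ENNReal.ofReal (a k) * if k * ρ ≤ ‖z‖ then tau μ z else 0 := by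
    intro z
    refine le_trans ?_ (ENNReal.le_tsum ⌊‖z‖ / ρ⌋₊)
    rw [if_pos ((le_div_iff₀ hρ0).1 (Nat.floor_le (by positivity)))]
    gcongr
    rw [ha]
    beta_reduce
    rw [← Real.mul_rpow (by positivity) (by positivity)]
    refine Real.rpow_le_rpow (Real.sqrt_nonneg _) ((enorm2_le z).trans ?_) hq.le
    rw [mul_assoc]
    refine mul_le_mul_of_nonneg_left ?_ (Nat.cast_nonneg d)
    rw [mul_comm, ← div_le_iff₀ hρ0]
    exact (Nat.lt_floor_add_one _).le
  rw [gyr, lintegral_tsum_cluster μ fun z => ENNReal.ofReal (enorm2 z ^ q), clMom_one]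
  calc ∑' z, ENNReal.ofReal (enorm2 z ^ q) * tau μ z
      ≤ ∑' z : V d, ∑' k : ℕ, ENNReal.ofReal (a k) * if k * ρ ≤ ‖z‖ then tau μ z else 0 :=
        ENNReal.tsum_le_tsum hpt
    _ = ∑' k : ℕ, ENNReal.ofReal (a k) * tail μ (k * ρ) := by
        rw [ENNReal.tsum_comm]
        exact tsum_congr fun k => ENNReal.tsum_mul_left
    _ ≤ ∑' k : ℕ, ENNReal.ofReal ((d * ρ) ^ q * (((k : ℝ) + 1) ^ q * 2⁻¹ ^ k)) *
          ∑' z, tau μ z := by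
        refine ENNReal.tsum_le_tsum fun k => ?_
        rw [← mul_assoc, ENNReal.ofReal_mul (ha0 k), mul_assoc, ENNReal.ofReal_pow (by norm_num),
          ENNReal.ofReal_inv_of_pos two_pos, ENNReal.ofReal_ofNat]
        exact mul_le_mul_right (h.tail_le hp ht hj hρ hφ k) _
    _ = _ := by
        rw [ENNReal.tsum_mul_right, ← ENNReal.ofReal_tsum_of_nonneg (fun k => by positivity)
          ((summable_rpow_mul_half_pow q).mul_left _), tsum_mul_left]

theorem IsPerc.xi_le (h : IsPerc μ p) (hp : ∀ e, 0 ≤ p e ∧ p e ≤ 1) (ht : TransInv p)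
    {j : ℕ} {ρ : ℝ} (hj : (j : ℝ) < ρ)
    (hρ : ∀ x ∈ cube d j, ∀ y, p s(x, y) ≠ 0 → ‖y‖ ≤ ρ) (hφ : phi μ p j ≤ 2⁻¹)
    {q : ℝ} (hq : 0 < q) :
    xi μ q ≤ ENNReal.ofReal (d * ρ * (∑' k : ℕ, ((k : ℝ) + 1) ^ q * 2⁻¹ ^ k) ^ (1 / q)) := by
  have hρ0 : 0 ≤ ρ := (Nat.cast_nonneg j).trans hj.le
  have hs : 0 ≤ ∑' k : ℕ, ((k : ℝ) + 1) ^ q * 2⁻¹ ^ k := tsum_nonneg fun k => by positivity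
  rw [xi]
  refine (ENNReal.rpow_le_rpow (ENNReal.div_le_of_le_mul (h.gyr_le hp ht hj hρ hφ hq))
    (by positivity)).trans_eq ?_
  rw [ENNReal.ofReal_rpow_of_nonneg (by positivity) (by positivity),
    Real.mul_rpow (by positivity) hs, one_div, Real.rpow_rpow_inv (by positivity) hq.ne']

end Gyration

theorem Kernel.exists_xi_le {d : ℕ} {α : ℝ} (κ : Kernel d α) (hd : 1 ≤ d) (hα : 0 < α)
    (hα1 : α < 1) {q : ℝ} (hq : 0 < q) :
    ∃ C : ℝ, 0 < C ∧ ∀ r : ℝ, 1 ≤ r → ∀ μ : Measure (Config d),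
      IsPerc μ (κ.edgePCut κ.betaC r) → xi μ q ≤ ENNReal.ofReal (C * r) := by
  obtain ⟨C, hC, hφ⟩ := κ.exists_phi_le hd hα hα1
  obtain ⟨c, hc, hn⟩ := κ.exists_norm_sub_le hd
  set M : ℝ := (∑' k : ℕ, ((k : ℝ) + 1) ^ q * 2⁻¹ ^ k) ^ (1 / q) with hM
  have hM0 : 0 ≤ M := Real.rpow_nonneg (tsum_nonneg fun k => by positivity) _
  refine ⟨d * (C + c) * M + 1, by positivity, fun r hr μ h => ?_⟩
  obtain ⟨j, hj, hφj⟩ := hφ r hr μ h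
  have hcr : 0 < c * r := by positivity
  refine (h.xi_le (κ.edgePCut_mem κ.betaC_nonneg r) (κ.edgePCut_transInv _ r) (j := j)
    (ρ := (C + c) * r) (by linarith) ?_ hφj hq).trans (ENNReal.ofReal_le_ofReal ?_)
  · intro x hx y hxy
    have h1 := (hn _ _ x y hxy).2
    have h2 := mem_cube.1 hx
    have h3 := norm_sub_norm_le y x
    rw [norm_sub_rev] at h3
    linarith
  · rw [← hM]
    nlinarith

/-- If `0 < α < 1` then the correlation length condition (CL) holds:
`β_c < ∞` and for every `p > 0` there is a constant `C_p < ∞` such that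
`ξ_p(β_c, r) ≤ C_p r` for every `r ≥ 1`. -/
theorem statement2 (d : ℕ) (α : ℝ) (hd : 1 ≤ d) (hα : 0 < α) (hα1 : α < 1)
    (κ : Kernel d α) : κ.CL :=
  ⟨κ.exists_percolates hd hα hα1, fun _ hq => κ.exists_xi_le hd hα hα1 hq⟩

end LRP
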